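/- Assume (H1)–(H3), d ≤ 3, f is an ignition reaction with f ∈ F(f₀,M,ζ,ξ) for some ζ < c₀²/4 and ξ > 0, and c*(e) is a deterministic front speed in direction e ∈ S^{d−1} for u_t = Δu + f(x,u,ω). Then c*(e) is a deterministic exclusive front speed in direction e. -/

import Mathlib

open MeasureTheory Metric Set Filter
open scoped Topology RealInnerProductSpace NNReal Pointwise

noncomputable section

/-- `d`-dimensional Euclidean space. -/
abbrev Euc (d : ℕ) : Type := EuclideanSpace ℝ (Fin d)

/-- The spatial Laplacian of `φ : ℝ^d → ℝ`. -/
def lap {d : ℕ} (φ : Euc d → ℝ) (x : Euc d) : ℝ :=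
  ∑ i : Fin d,
    fderiv ℝ (fun y => fderiv ℝ φ y (EuclideanSpace.single i 1)) x (EuclideanSpace.single i 1)

/-- A classical solution `u : [0,∞)×ℝ^d → [0,1]` of `u_t = Δu + F(x,u)` with initial
datum `g`: continuous and `C^{1,2}` in space for `t>0`, solving the equation classically for
`t>0`, with `u(0,·) = g` and `u(t,x) → g(x₀)` as `(t,x) → (0⁺,x₀)` at continuity points of `g`. -/
structure IsSolR {d : ℕ} (F : Euc d → ℝ → ℝ) (g : Euc d → ℝ) (u : ℝ → Euc d → ℝ) : Prop where
  mem_Icc : ∀ t x, 0 ≤ t → u t x ∈ Icc (0:ℝ) 1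
  contOn : ContinuousOn (fun p : ℝ × Euc d => u p.1 p.2) (Ioi 0 ×ˢ univ)
  spatial : ∀ t, 0 < t → ContDiff ℝ 2 (u t)
  eqn : ∀ t x, 0 < t → HasDerivAt (fun s => u s x) (lap (u t) x + F x (u t x)) t
  init : ∀ x, u 0 x = g x
  initLim : ∀ x₀ : Euc d, ContinuousAt g x₀ →
    Tendsto (fun p : ℝ × Euc d => u p.1 p.2) ((𝓝[>] (0:ℝ)) ×ˢ 𝓝 x₀) (𝓝 (g x₀))

/-- Hypothesis (H1). -/
structure H1 {d : ℕ} {Ω : Type*} (f : Euc d → ℝ → Ω → ℝ) (f₀ : ℝ → ℝ) (M θ₀ : ℝ) : Prop where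
  M_ge_one : 1 ≤ M
  lip : ∀ x x' : Euc d, ∀ u u' : ℝ, ∀ ω : Ω, u ∈ Icc (0:ℝ) 1 → u' ∈ Icc (0:ℝ) 1 →
    |f x u ω - f x' u' ω| ≤ M * (‖x - x'‖ + |u - u'|)
  nonneg : ∀ x u ω, u ∈ Icc (0:ℝ) 1 → 0 ≤ f x u ω
  zero_at_zero : ∀ x ω, f x 0 ω = 0
  zero_at_one : ∀ x ω, f x 1 ω = 0
  theta_mem : θ₀ ∈ Ioo (0:ℝ) 1
  f0_lip : ∃ L : ℝ≥0, LipschitzOnWith L f₀ (Icc 0 1)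
  f0_nonneg : ∀ u ∈ Icc (0:ℝ) 1, 0 ≤ f₀ u
  f0_zero_low : ∀ u ∈ Icc (0:ℝ) θ₀, f₀ u = 0
  f0_zero_one : f₀ 1 = 0
  f0_pos : ∀ u ∈ Ioo θ₀ 1, 0 < f₀ u
  f0_le : ∀ x u ω, u ∈ Icc (0:ℝ) 1 → f₀ u ≤ f x u ω

/-- `c₀` is the traveling front speed of the homogeneous reaction `f₀`. -/
def IsTravelingFrontSpeed (f₀ : ℝ → ℝ) (c₀ : ℝ) : Prop :=
  ∃ U₀ U₀' : ℝ → ℝ, StrictAnti U₀ ∧ (∀ s, U₀ s ∈ Ioo (0:ℝ) 1) ∧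
    (∀ s, HasDerivAt U₀ (U₀' s) s) ∧
    (∀ s, HasDerivAt U₀' (-(c₀ * U₀' s) - f₀ (U₀ s)) s) ∧
    Tendsto U₀ atBot (𝓝 1) ∧ Tendsto U₀ atTop (𝓝 0)

/-- `γ_f(x,ω;ζ) = inf{u ≥ 0 : f(x,u,ω) > ζu}`. -/
def gammaF {d : ℕ} {Ω : Type*} (f : Euc d → ℝ → Ω → ℝ) (ζ : ℝ) (x : Euc d) (ω : Ω) : ℝ :=
  sInf {u : ℝ | 0 ≤ u ∧ ζ * u < f x u ω}

/-- `f ∈ F(f₀,M,ζ,ξ)`: the lower bound `f ≥ ξ` on `[γ_f(x,ω;ζ),θ₀]` (the (H1)-part is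
recorded separately by `H1`). -/
def memF {d : ℕ} {Ω : Type*} (f : Euc d → ℝ → Ω → ℝ) (θ₀ ζ ξ : ℝ) : Prop :=
  ∀ x ω, {u : ℝ | 0 ≤ u ∧ ζ * u < f x u ω}.Nonempty →
    ∀ u ∈ Icc (gammaF f ζ x ω) θ₀, ξ ≤ f x u ω

/-- `R₀` is admissible: every solution of `v_t = Δv + f₀(v)` with initial datum
`((1+θ₀)/2)χ_{B_{R₀}(0)}` converges to `1` locally uniformly as `t → ∞`. -/
def Admissible (d : ℕ) (f₀ : ℝ → ℝ) (θ₀ R₀ : ℝ) : Prop :=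
  ∀ v : ℝ → Euc d → ℝ,
    IsSolR (fun (_ : Euc d) u => f₀ u)
      ((ball (0:Euc d) R₀).indicator fun _ => (1+θ₀)/2) v →
    TendstoLocallyUniformly (fun t x => v t x) (fun _ => (1:ℝ)) atTop

/-- The Wulff-shape set `S = {se : e ∈ S^{d-1}, 0 ≤ s < w(e)}` of a radial function `w`. -/
def wulff {d : ℕ} (w : Euc d → ℝ) : Set (Euc d) :=
  {x | ∃ e ∈ sphere (0:Euc d) 1, ∃ s : ℝ, 0 ≤ s ∧ s < w e ∧ x = s • e}

/-- `S` is a deterministic Wulff shape for `u_t = Δu + f(x,u,ω)`. -/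
def DetWulff {d : ℕ} {Ω : Type*} [MeasurableSpace Ω] (P : Measure Ω)
    (f : Euc d → ℝ → Ω → ℝ) (f₀ : ℝ → ℝ) (θ₀ : ℝ) (S : Set (Euc d)) : Prop :=
  ∃ Ω₀ : Set Ω, MeasurableSet Ω₀ ∧ P Ω₀ = 1 ∧ ∀ ω ∈ Ω₀, ∀ R₀ : ℝ, 0 < R₀ →
    Admissible d f₀ θ₀ R₀ →
    ∀ u : ℝ → Euc d → ℝ,
      IsSolR (fun x v => f x v ω) ((ball (0:Euc d) R₀).indicator fun _ => (1+θ₀)/2) u →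
      ∀ δ : ℝ, 0 < δ →
        (∀ ε : ℝ, 0 < ε → ∃ T : ℝ, ∀ t ≥ T, ∀ x ∈ ((1-δ)*t) • S, 1 - ε ≤ u t x) ∧
        (∀ ε : ℝ, 0 < ε → ∃ T : ℝ, ∀ x : Euc d, ∀ t ≥ T, x ∉ ((1+δ)*t) • S → u t x ≤ ε)

/-- `c` is a deterministic front speed in direction `e` for `u_t = Δu + f(x,u,ω)`. -/
def DetFrontSpeed {d : ℕ} {Ω : Type*} [MeasurableSpace Ω] (P : Measure Ω)
    (f : Euc d → ℝ → Ω → ℝ) (θ₀ : ℝ) (e : Euc d) (c : ℝ) : Prop :=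
  ∃ Ω₀ : Set Ω, MeasurableSet Ω₀ ∧ P Ω₀ = 1 ∧ ∀ ω ∈ Ω₀,
    ∀ u : ℝ → Euc d → ℝ,
      IsSolR (fun x v => f x v ω)
        ({x : Euc d | ⟪x, e⟫ < 0}.indicator fun _ => (1+θ₀)/2) u →
      ∀ K : Set (Euc d), IsCompact K → K ⊆ {x : Euc d | 0 < ⟪x, e⟫} →
        (∀ ε : ℝ, 0 < ε → ∃ T : ℝ, ∀ t ≥ T, ∀ k ∈ K, 1 - ε ≤ u t (t • (c • e - k))) ∧
        (∀ ε : ℝ, 0 < ε → ∃ T : ℝ, ∀ t ≥ T, ∀ k ∈ K, u t (t • (c • e + k)) ≤ ε)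

/-- `c` is a deterministic exclusive front speed in direction `e`. -/
def DetExclFrontSpeed {d : ℕ} {Ω : Type*} [MeasurableSpace Ω] (P : Measure Ω)
    (f : Euc d → ℝ → Ω → ℝ) (θ₀ : ℝ) (e : Euc d) (c : ℝ) : Prop :=
  DetFrontSpeed P f θ₀ e c ∧
  ∀ K : Set (Euc d), IsCompact K → K ⊆ {x : Euc d | 0 < ⟪x, e⟫} →
    ∃ β : ℝ → ℝ, (∀ α ∈ Ioc (0:ℝ) 1, β α ∈ Ioc (0:ℝ) 1) ∧
      Tendsto β (𝓝[>] (0:ℝ)) (𝓝 0) ∧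
      ∃ Ω₀ : Set Ω, MeasurableSet Ω₀ ∧ P Ω₀ = 1 ∧ ∀ ω ∈ Ω₀, ∀ α ∈ Ioc (0:ℝ) 1,
        ∀ u : ℝ → Euc d → ℝ,
          IsSolR (fun x v => f x v ω) (fun x => if ⟪x, e⟫ < 0 then 1 else α) u →
          ∀ ε : ℝ, 0 < ε → ∃ T : ℝ, ∀ t ≥ T, ∀ k ∈ K, u t (t • (c • e + k)) ≤ β α + ε

lemma IsSolR.at_zero {d : ℕ} {F : Euc d → ℝ → ℝ} {g : Euc d → ℝ} {u : ℝ → Euc d → ℝ} (hu : IsSolR F g u) (x : Euc d) : u 0 x = g x := by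
  obtain ⟨_, _, _, _, h, _⟩ := hu
  exact h x

section
open MeasureTheory Metric Set Filter
open scoped Topology RealInnerProductSpace NNReal Pointwise

set_option linter.unusedVariables false
/-! ### Laplacian lemmas -/

/-- The real inner product as a continuous bilinear map. -/
def ip {d : ℕ} : Euc d →L[ℝ] (Euc d →L[ℝ] ℝ) :=
  LinearMap.mkContinuous₂ (innerₗ (Euc d)) 1 (fun x y => by
    rw [one_mul]; simpa using abs_real_inner_le_norm x y)

@[simp] lemma ip_apply {d : ℕ} (x y : Euc d) : ip x y = ⟪x, y⟫ := rfl

lemma ip_norm {d : ℕ} (x : Euc d) : ‖ip x‖ ≤ ‖x‖ :=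
  ContinuousLinearMap.opNorm_le_bound _ (norm_nonneg _) fun y => by
    simpa using abs_real_inner_le_norm x y

lemma hasFDerivAt_normsq {d : ℕ} (x₀ y : Euc d) : HasFDerivAt (fun y : Euc d => ‖y - x₀‖ ^ 2)
      ((2:ℝ) • ip (y - x₀)) y := by
    have := ((hasFDerivAt_id y).sub_const x₀).norm_sq
    refine HasFDerivAt.congr_fderiv this ?_
    ext z
    simp

lemma ip_single {d : ℕ} (x : Euc d) (i : Fin d) : ip x (EuclideanSpace.single i 1) = x i := by
  simp [EuclideanSpace.inner_single_right]

lemma lap_eq_of_hasFDerivAt {d : ℕ} {φ : Euc d → ℝ} {x : Euc d}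
    {A : Euc d → (Euc d →L[ℝ] ℝ)} {A' : Euc d →L[ℝ] (Euc d →L[ℝ] ℝ)}
    (h1 : ∀ᶠ y in 𝓝 x, HasFDerivAt φ (A y) y) (h2 : HasFDerivAt A A' x) :
    lap φ x = ∑ i : Fin d, A' (EuclideanSpace.single i 1) (EuclideanSpace.single i 1) := by
  unfold lap
  refine Finset.sum_congr rfl fun i _ => ?_
  have h3 : (fun y => fderiv ℝ φ y (EuclideanSpace.single i 1)) =ᶠ[𝓝 x]
      fun y => A y (EuclideanSpace.single i 1) := by
    filter_upwards [h1] with y hy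
    rw [hy.fderiv]
  rw [h3.fderiv_eq]
  have h4 : HasFDerivAt (fun y => A y (EuclideanSpace.single i 1))
      ((ContinuousLinearMap.apply ℝ ℝ (EuclideanSpace.single i 1 : Euc d)).comp A') x :=
    (ContinuousLinearMap.apply ℝ ℝ (EuclideanSpace.single i 1 : Euc d)).hasFDerivAt.comp x h2
  rw [h4.fderiv]
  rfl

lemma lap_eq_fderiv2 {d : ℕ} {φ : Euc d → ℝ} {x : Euc d} (h : ContDiffAt ℝ 2 φ x) :
    lap φ x = ∑ i : Fin d, fderiv ℝ (fderiv ℝ φ) x (EuclideanSpace.single i 1)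
      (EuclideanSpace.single i 1) := by
  apply lap_eq_of_hasFDerivAt
  · have : ∀ᶠ y in 𝓝 x, ContDiffAt ℝ 2 φ y := h.eventually (by simp)
    filter_upwards [this] with y hy
    exact (hy.differentiableAt (by norm_num)).hasFDerivAt
  · have : ContDiffAt ℝ 1 (fderiv ℝ φ) x := h.fderiv_right (by norm_num)
    exact (this.differentiableAt (by norm_num)).hasFDerivAt

lemma fderiv_ev {d : ℕ} {φ : Euc d → ℝ} {x : Euc d} (h : ContDiffAt ℝ 2 φ x) :
    ∀ᶠ y in 𝓝 x, HasFDerivAt φ (fderiv ℝ φ y) y := by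
  have : ∀ᶠ y in 𝓝 x, ContDiffAt ℝ 2 φ y := h.eventually (by simp)
  filter_upwards [this] with y hy
  exact (hy.differentiableAt (by norm_num)).hasFDerivAt

lemma fderiv_diff {d : ℕ} {φ : Euc d → ℝ} {x : Euc d} (h : ContDiffAt ℝ 2 φ x) :
    HasFDerivAt (fderiv ℝ φ) (fderiv ℝ (fderiv ℝ φ) x) x := by
  have : ContDiffAt ℝ 1 (fderiv ℝ φ) x := h.fderiv_right (by norm_num)
  exact (this.differentiableAt (by norm_num)).hasFDerivAt

lemma lap_add {d : ℕ} {φ ψ : Euc d → ℝ} {x : Euc d} (h : ContDiffAt ℝ 2 φ x)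
    (h' : ContDiffAt ℝ 2 ψ x) : lap (fun y => φ y + ψ y) x = lap φ x + lap ψ x := by
  rw [lap_eq_fderiv2 h, lap_eq_fderiv2 h', ← Finset.sum_add_distrib]
  rw [lap_eq_of_hasFDerivAt (A := fun y => fderiv ℝ φ y + fderiv ℝ ψ y)
    (A' := fderiv ℝ (fderiv ℝ φ) x + fderiv ℝ (fderiv ℝ ψ) x)]
  · rfl
  · filter_upwards [fderiv_ev h, fderiv_ev h'] with y h1 h2
    exact h1.add h2
  · exact (fderiv_diff h).add (fderiv_diff h')

lemma lap_sub {d : ℕ} {φ ψ : Euc d → ℝ} {x : Euc d} (h : ContDiffAt ℝ 2 φ x)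
    (h' : ContDiffAt ℝ 2 ψ x) : lap (fun y => φ y - ψ y) x = lap φ x - lap ψ x := by
  rw [lap_eq_fderiv2 h, lap_eq_fderiv2 h', ← Finset.sum_sub_distrib]
  rw [lap_eq_of_hasFDerivAt (A := fun y => fderiv ℝ φ y - fderiv ℝ ψ y)
    (A' := fderiv ℝ (fderiv ℝ φ) x - fderiv ℝ (fderiv ℝ ψ) x)]
  · rfl
  · filter_upwards [fderiv_ev h, fderiv_ev h'] with y h1 h2
    exact h1.sub h2
  · exact (fderiv_diff h).sub (fderiv_diff h')

lemma lap_const_mul {d : ℕ} {φ : Euc d → ℝ} {x : Euc d} (c : ℝ) (h : ContDiffAt ℝ 2 φ x) :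
    lap (fun y => c * φ y) x = c * lap φ x := by
  rw [lap_eq_fderiv2 h, Finset.mul_sum]
  rw [lap_eq_of_hasFDerivAt (A := fun y => c • fderiv ℝ φ y)
    (A' := c • fderiv ℝ (fderiv ℝ φ) x)]
  · rfl
  · filter_upwards [fderiv_ev h] with y h1
    exact h1.const_mul c
  · exact (fderiv_diff h).const_smul c

lemma lap_const {d : ℕ} (c : ℝ) (x : Euc d) : lap (fun _ : Euc d => c) x = 0 := by
  rw [lap_eq_of_hasFDerivAt (A := fun _ => 0) (A' := 0)]
  · simp
  · exact Eventually.of_forall fun y => hasFDerivAt_const c y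
  · exact hasFDerivAt_const _ _

lemma lap_neg {d : ℕ} {φ : Euc d → ℝ} {x : Euc d} (h : ContDiffAt ℝ 2 φ x) :
    lap (fun y => - φ y) x = - lap φ x := by
  have := lap_const_mul (-1) h
  simpa using this

lemma lap_le_zero_of_isLocalMax {d : ℕ} {φ : Euc d → ℝ} {x : Euc d} (h : ContDiffAt ℝ 2 φ x)
    (hm : IsLocalMax φ x) : lap φ x ≤ 0 := by
  rw [lap_eq_fderiv2 h]
  refine Finset.sum_nonpos fun i _ => ?_
  set e : Euc d := EuclideanSpace.single i 1
  by_contra hcon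
  push Not at hcon
  let g : ℝ → ℝ := fun s => φ (x + s • e)
  have hl : ∀ s : ℝ, HasDerivAt (fun s : ℝ => x + s • e) e s := fun s => by
    simpa using ((hasDerivAt_id s).smul_const e).const_add x
  have hx0 : x + (0:ℝ) • e = x := by simp
  have htend : Tendsto (fun s : ℝ => x + s • e) (𝓝 0) (𝓝 x) := by
    have := (hl 0).continuousAt.tendsto
    rwa [hx0] at this
  have hg1 : ∀ᶠ s in 𝓝 (0:ℝ), HasDerivAt g (fderiv ℝ φ (x + s • e) e) s := by
    filter_upwards [htend.eventually (fderiv_ev h)] with s hs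
    exact hs.comp_hasDerivAt s (hl s)
  have hd1 : deriv g =ᶠ[𝓝 0] fun s => fderiv ℝ φ (x + s • e) e := by
    filter_upwards [hg1] with s hs using hs.deriv
  have hg2 : HasDerivAt (fun s : ℝ => fderiv ℝ φ (x + s • e) e)
      (fderiv ℝ (fderiv ℝ φ) x e e) 0 := by
    have h2 := fderiv_diff h
    rw [← hx0] at h2
    have h3 := h2.comp_hasDerivAt (0:ℝ) (hl 0)
    have h4 := (ContinuousLinearMap.apply ℝ ℝ e).hasFDerivAt.comp_hasDerivAt (0:ℝ) h3
    rw [hx0] at h4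
    exact h4
  have hdd : deriv (deriv g) 0 = fderiv ℝ (fderiv ℝ φ) x e e := by
    rw [hd1.deriv_eq]; exact hg2.deriv
  have hgm : IsLocalMax g 0 := by
    have := htend.eventually hm
    simp only [IsLocalMax, IsMaxFilter, g, hx0]
    exact this
  have hd0 : deriv g 0 = 0 := hgm.deriv_eq_zero
  have hc : ContinuousAt g 0 := (hg1.self_of_nhds).continuousAt
  have hmin : IsLocalMin g 0 := isLocalMin_of_deriv_deriv_pos (by rw [hdd]; exact hcon) hd0 hc
  have hconst : g =ᶠ[𝓝 0] fun _ => g 0 := by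
    filter_upwards [hgm, hmin] with s h1 h2
    exact le_antisymm h1 h2
  have : deriv g =ᶠ[𝓝 0] fun _ => 0 := by
    have := hconst.deriv
    simpa using this
  have h0 : deriv (deriv g) 0 = 0 := by rw [this.deriv_eq]; simp
  rw [hdd] at h0
  linarith

lemma lap_radial {d : ℕ} {H H' : ℝ → ℝ} {H'' : ℝ} (x₀ x : Euc d)
    (h1 : ∀ᶠ s in 𝓝 (‖x - x₀‖ ^ 2), HasDerivAt H (H' s) s)
    (h2 : HasDerivAt H' H'' (‖x - x₀‖ ^ 2)) :
    lap (fun y => H (‖y - x₀‖ ^ 2)) x = 4 * H'' * ‖x - x₀‖ ^ 2 + 2 * d * H' (‖x - x₀‖ ^ 2) := by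
  have hq := fun y => hasFDerivAt_normsq x₀ y
  rw [lap_eq_of_hasFDerivAt (A := fun y => H' (‖y - x₀‖ ^ 2) • ((2:ℝ) • ip (y - x₀)))
    (A' := H' (‖x - x₀‖ ^ 2) • ((2:ℝ) • ip) +
      (H'' • ((2:ℝ) • ip (x - x₀))).smulRight ((2:ℝ) • ip (x - x₀)))]
  · have hn : ‖x - x₀‖ ^ 2 = ∑ i, (x i - x₀ i) ^ 2 := by
      rw [EuclideanSpace.norm_sq_eq]; simp
    have h3 : ∀ i : Fin d, (H' (‖x - x₀‖ ^ 2) • ((2:ℝ) • ip) +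
      (H'' • ((2:ℝ) • ip (x - x₀))).smulRight ((2:ℝ) • ip (x - x₀)) : Euc d →L[ℝ] (Euc d →L[ℝ] ℝ))
      (EuclideanSpace.single i 1 : Euc d) (EuclideanSpace.single i 1 : Euc d) =
        2 * H' (‖x - x₀‖ ^ 2) + 4 * H'' * (x i - x₀ i) ^ 2 := fun i => by
      simp [EuclideanSpace.inner_single_right]
      ring
    rw [Finset.sum_congr rfl fun i _ => h3 i, Finset.sum_add_distrib, ← Finset.mul_sum, ← Finset.mul_sum, ← hn]
    simp
    ring
  · have : Tendsto (fun y : Euc d => ‖y - x₀‖ ^ 2) (𝓝 x) (𝓝 (‖x - x₀‖ ^ 2)) :=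
      (hq x).continuousAt.tendsto
    filter_upwards [this.eventually h1] with y hy
    exact hy.comp_hasFDerivAt y (hq y)
  · have ha : HasFDerivAt (fun y : Euc d => H' (‖y - x₀‖ ^ 2)) (H'' • ((2:ℝ) • ip (x - x₀))) x :=
      h2.comp_hasFDerivAt x (hq x)
    have hb : HasFDerivAt (fun y : Euc d => (2:ℝ) • ip (y - x₀)) ((2:ℝ) • ip) x := by
      have := (ip (d := d)).hasFDerivAt.comp x ((hasFDerivAt_id x).sub_const x₀)
      exact this.const_smul (2:ℝ)
    exact ha.smul hb

lemma lap_normsq {d : ℕ} (x₀ x : Euc d) : lap (fun y => ‖y - x₀‖ ^ 2) x = 2 * d := by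
  have := lap_radial (H := fun s => s) (H' := fun _ => 1) (H'' := 0) x₀ x
    (Eventually.of_forall fun s => hasDerivAt_id s) (hasDerivAt_const _ _)
  simpa using this

/-- The regularized radius. -/
def rad {d : ℕ} (A : ℝ) (x₀ x : Euc d) : ℝ := Real.sqrt (A ^ 2 + ‖x - x₀‖ ^ 2)

lemma rad_pos {d : ℕ} {A : ℝ} (hA : 0 < A) (x₀ x : Euc d) : 0 < rad A x₀ x :=
  Real.sqrt_pos.2 (by positivity)

lemma rad_sq {d : ℕ} (A : ℝ) (x₀ x : Euc d) : rad A x₀ x ^ 2 = A ^ 2 + ‖x - x₀‖ ^ 2 :=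
  Real.sq_sqrt (by positivity)

lemma le_rad {d : ℕ} {A : ℝ} (hA : 0 < A) (x₀ x : Euc d) : ‖x - x₀‖ ≤ rad A x₀ x :=
  Real.le_sqrt_of_sq_le (by nlinarith [sq_nonneg A])

lemma A_le_rad {d : ℕ} {A : ℝ} (hA : 0 < A) (x₀ x : Euc d) : A ≤ rad A x₀ x :=
  Real.le_sqrt_of_sq_le (by nlinarith [sq_nonneg ‖x - x₀‖])

lemma rad_le {d : ℕ} {A : ℝ} (hA : 0 < A) (x₀ x : Euc d) : rad A x₀ x ≤ A + ‖x - x₀‖ := by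
  apply Real.sqrt_le_iff.2 ⟨by positivity, by nlinarith [norm_nonneg (x - x₀)]⟩

lemma rad_self {d : ℕ} {A : ℝ} (hA : 0 < A) (x : Euc d) : rad A x x = A := by
  simp [rad, Real.sqrt_sq hA.le]

lemma rad_contDiff {d : ℕ} {A : ℝ} (hA : 0 < A) (x₀ : Euc d) {n : WithTop ℕ∞} :
    ContDiff ℝ n (rad A x₀) := by
  unfold rad
  refine ContDiff.sqrt (by
    refine contDiff_const.add ?_
    exact (contDiff_id.sub contDiff_const).norm_sq ℝ) fun x => by positivity

lemma rad_continuous {d : ℕ} {A : ℝ} (hA : 0 < A) (x₀ : Euc d) : Continuous (rad A x₀) :=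
  (rad_contDiff hA x₀ (n := 0)).continuous

lemma lap_rad {d : ℕ} {A : ℝ} (hA : 0 < A) {φ φ' : ℝ → ℝ} {φ'' : ℝ} (x₀ x : Euc d)
    (h1 : ∀ s, HasDerivAt φ (φ' s) s) (h2 : HasDerivAt φ' φ'' (rad A x₀ x)) :
    lap (fun y => φ (rad A x₀ y)) x =
      φ'' * (‖x - x₀‖ ^ 2 / rad A x₀ x ^ 2)
        + φ' (rad A x₀ x) * (d / rad A x₀ x - ‖x - x₀‖ ^ 2 / rad A x₀ x ^ 3) := by
  have hq : 0 < A ^ 2 + ‖x - x₀‖ ^ 2 := by positivity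
  have hg := rad_pos hA x₀ x
  have hsq : ∀ s : ℝ, 0 < A ^ 2 + s → HasDerivAt (fun s => Real.sqrt (A ^ 2 + s))
      (1 / (2 * Real.sqrt (A ^ 2 + s))) s := fun s hs => by
    exact ((hasDerivAt_id s).const_add (A ^ 2)).sqrt hs.ne'
  have := lap_radial (d := d) (H := fun s => φ (Real.sqrt (A ^ 2 + s)))
    (H' := fun s => φ' (Real.sqrt (A ^ 2 + s)) * (1 / (2 * Real.sqrt (A ^ 2 + s))))
    (H'' := φ'' * (1 / (2 * rad A x₀ x)) * (1 / (2 * rad A x₀ x))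
      + φ' (rad A x₀ x) * (- (1 / (4 * rad A x₀ x ^ 3)))) x₀ x ?_ ?_
  · unfold rad at *
    rw [this]
    set g := rad A x₀ x
    field_simp
    ring
  · have : ∀ᶠ s in 𝓝 (‖x - x₀‖ ^ 2), 0 < A ^ 2 + s := by
      have : ContinuousAt (fun s : ℝ => A ^ 2 + s) (‖x - x₀‖ ^ 2) := by fun_prop
      exact this.eventually (lt_mem_nhds hq)
    filter_upwards [this] with s hs
    exact (h1 _).comp s (hsq s hs)
  · have ha : HasDerivAt (fun s => φ' (Real.sqrt (A ^ 2 + s))) (φ'' * (1 / (2 * rad A x₀ x)))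
        (‖x - x₀‖ ^ 2) := HasDerivAt.comp (‖x - x₀‖ ^ 2) (h₂ := φ') h2 (hsq _ hq)
    have hb : HasDerivAt (fun s => 1 / (2 * Real.sqrt (A ^ 2 + s)))
        (- (1 / (4 * rad A x₀ x ^ 3))) (‖x - x₀‖ ^ 2) := by
      have := ((hsq _ hq).const_mul 2).inv (by unfold rad at hg; positivity)
      simp only [one_div] at this ⊢
      refine this.congr_deriv ?_
      change -(2 * (2 * rad A x₀ x)⁻¹) / (2 * rad A x₀ x) ^ 2 = -(4 * rad A x₀ x ^ 3)⁻¹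
      field_simp
      ring
    exact ha.mul hb

lemma lap_planar {d : ℕ} {φ φ' : ℝ → ℝ} {φ'' : ℝ} {e : Euc d} (he : ‖e‖ = 1) (c : ℝ) (x : Euc d)
    (h1 : ∀ s, HasDerivAt φ (φ' s) s) (h2 : HasDerivAt φ' φ'' (⟪x, e⟫ + c)) :
    lap (fun y => φ (⟪y, e⟫ + c)) x = φ'' := by
  have hl : ∀ y, HasFDerivAt (fun y : Euc d => ⟪y, e⟫ + c) (ip e) y := fun y => by
    have := (ip e).hasFDerivAt (x := y)
    have h3 : (fun y : Euc d => ⟪y, e⟫ + c) = fun y => ip e y + c := by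
      ext y; simp [real_inner_comm]
    rw [h3]
    exact this.add_const c
  rw [lap_eq_of_hasFDerivAt (A := fun y => φ' (⟪y, e⟫ + c) • ip e)
    (A' := (φ'' • ip e).smulRight (ip e))]
  · have hn : ‖e‖ ^ 2 = ∑ i, (e i) ^ 2 := by
      rw [EuclideanSpace.norm_sq_eq]; simp
    rw [he] at hn
    simp [EuclideanSpace.inner_single_right]
    calc _ = φ'' * ∑ i, (e i) ^ 2 := by
          rw [Finset.mul_sum]; exact Finset.sum_congr rfl fun i _ => by ring
      _ = φ'' := by rw [← hn]; ring
  · exact Eventually.of_forall fun y => (h1 _).comp_hasFDerivAt y (hl y)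
  · exact HasFDerivAt.smul_const (h2.comp_hasFDerivAt (f := fun y : Euc d => ⟪y, e⟫ + c) x (hl x)) (ip e)

/-! ### Comparison -/

lemma deriv_nonneg_of_left_max {z : ℝ → ℝ} {z' t τ : ℝ} (hτ : τ < t) (h : HasDerivAt z z' t)
    (hm : ∀ s ∈ Ioc τ t, z s ≤ z t) : 0 ≤ z' := by
  have h1 : Tendsto (slope z t) (𝓝[<] t) (𝓝 z') :=
    (hasDerivAt_iff_tendsto_slope.1 h).mono_left
      (nhdsWithin_mono _ (fun s hs => ne_of_lt hs))
  refine ge_of_tendsto h1 ?_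
  have : Ioo τ t ∈ 𝓝[<] t := Ioo_mem_nhdsLT hτ
  filter_upwards [this] with s hs
  rw [slope_def_field]
  have := hm s ⟨hs.1, hs.2.le⟩
  exact div_nonneg_of_nonpos (by linarith) (by linarith [hs.2])

theorem compLem {d : ℕ} (w : ℝ → Euc d → ℝ) (T B K : ℝ)
    (hB : ∀ t ∈ Ioc 0 T, ∀ x, w t x ≤ B)
    (hc : ContinuousOn (fun p : ℝ × Euc d => w p.1 p.2) (Ioc 0 T ×ˢ univ))
    (hsub : ∀ t ∈ Ioc 0 T, ∀ x, 0 < w t x → ContDiffAt ℝ 2 (w t) x ∧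
      ∃ w', HasDerivAt (fun s => w s x) w' t ∧ w' ≤ lap (w t) x + K * w t x)
    (hstart : ∀ x₀, ∀ ε > 0, ∀ᶠ p in (𝓝[>] (0:ℝ)) ×ˢ 𝓝 x₀, w p.1 p.2 ≤ ε) :
    ∀ t ∈ Ioc 0 T, ∀ x, w t x ≤ 0 := by
  intro t₁ ht₁ x₁
  by_contra hpos
  push Not at hpos
  obtain ⟨ε, hε, hεz⟩ : ∃ ε > 0, ε * (1 + ‖x₁‖ ^ 2 + (2 * d + 1) * t₁) <
      Real.exp (-K * t₁) * w t₁ x₁ := by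
    have h1 : 0 < Real.exp (-K * t₁) * w t₁ x₁ := by positivity
    have h2 : 0 < 1 + ‖x₁‖ ^ 2 + (2 * d + 1) * t₁ := by have := ht₁.1; positivity
    refine ⟨Real.exp (-K * t₁) * w t₁ x₁ / (1 + ‖x₁‖ ^ 2 + (2 * d + 1) * t₁) / 2, by positivity, ?_⟩
    rw [div_div, div_mul_eq_mul_div, div_lt_iff₀ (by positivity)]
    nlinarith
  let z : ℝ → Euc d → ℝ := fun t x =>
    Real.exp (-K * t) * w t x - ε * (1 + ‖x‖ ^ 2 + (2 * d + 1) * t)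
  have hz₁ : 0 < z t₁ x₁ := by simp only [z]; linarith
  set B' := Real.exp (|K| * t₁) * |B| with hB'
  have hexp : ∀ t ∈ Ioc 0 t₁, Real.exp (-K * t) ≤ Real.exp (|K| * t₁) := fun t ht => by
    apply Real.exp_le_exp.2
    calc -K * t ≤ |K| * t := by nlinarith [neg_abs_le K, ht.1]
      _ ≤ |K| * t₁ := by nlinarith [abs_nonneg K, ht.2]
  have hexpw : ∀ t ∈ Ioc 0 t₁, ∀ x, Real.exp (-K * t) * w t x ≤ B' := fun t ht x => by
    have h1 := hB t ⟨ht.1, ht.2.trans ht₁.2⟩ x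
    calc _ ≤ Real.exp (-K * t) * |B| :=
          mul_le_mul_of_nonneg_left (h1.trans (le_abs_self B)) (Real.exp_pos _).le
      _ ≤ _ := mul_le_mul_of_nonneg_right (hexp t ht) (abs_nonneg B)
  obtain ⟨ρ, hρ, hρB⟩ : ∃ ρ : ℝ, 0 < ρ ∧ B' ≤ ε * ρ ^ 2 := by
    refine ⟨B' / ε + 1, by positivity, ?_⟩
    have h0 : 0 ≤ B' / ε := by positivity
    have : ε * (B' / ε) = B' := by field_simp
    nlinarith [mul_nonneg hε.le h0, mul_nonneg hε.le (mul_nonneg h0 h0)]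
  have hout : ∀ t ∈ Ioc 0 t₁, ∀ x, ρ < ‖x‖ → z t x ≤ 0 := fun t ht x hx => by
    have h1 := hexpw t ht x
    have h2 : ρ ^ 2 ≤ ‖x‖ ^ 2 := by gcongr
    have h3 : 0 ≤ (2 * d + 1) * t := by have := ht.1; positivity
    simp only [z]
    nlinarith
  -- near initial time
  obtain ⟨τ, hτ, hτz⟩ : ∃ τ > 0, ∀ t ∈ Ioo 0 τ, t ≤ t₁ → ∀ x, ‖x‖ ≤ ρ → z t x ≤ 0 := by
    set ε' := ε / Real.exp (|K| * t₁)
    have hε' : 0 < ε' := by positivity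
    have key : ∀ x ∈ closedBall (0:Euc d) ρ, ∃ U ∈ 𝓝 x, ∃ τ > 0, ∀ t ∈ Ioo 0 τ, ∀ y ∈ U, w t y ≤ ε' := by
      intro x _
      obtain ⟨A, hA, U, hU, hAU⟩ := Filter.mem_prod_iff.1 (hstart x ε' hε')
      obtain ⟨τ, hτ, hτA⟩ := mem_nhdsGT_iff_exists_Ioo_subset.1 hA
      exact ⟨U, hU, τ, hτ, fun t ht y hy => hAU (Set.mk_mem_prod (hτA ht) hy)⟩
    have hcomp : IsCompact (closedBall (0:Euc d) ρ) := isCompact_closedBall _ _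
    have : ∃ τ > 0, ∀ t ∈ Ioo 0 τ, ∀ x ∈ closedBall (0:Euc d) ρ, w t x ≤ ε' := by
      refine hcomp.induction_on (p := fun S => ∃ τ > 0, ∀ t ∈ Ioo 0 τ, ∀ x ∈ S, w t x ≤ ε') ?_ ?_ ?_ ?_
      · exact ⟨1, one_pos, by simp⟩
      · rintro s t hst ⟨τ, hτ, h⟩
        exact ⟨τ, hτ, fun r hr x hx => h r hr x (hst hx)⟩
      · rintro s t ⟨τ, hτ, h⟩ ⟨τ', hτ', h'⟩
        refine ⟨min τ τ', lt_min hτ hτ', fun r hr x hx => ?_⟩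
        rcases hx with hx | hx
        · exact h r ⟨hr.1, hr.2.trans_le (min_le_left _ _)⟩ x hx
        · exact h' r ⟨hr.1, hr.2.trans_le (min_le_right _ _)⟩ x hx
      · intro x hx
        obtain ⟨U, hU, τ, hτ, h⟩ := key x hx
        exact ⟨U, mem_nhdsWithin_of_mem_nhds hU, τ, hτ, h⟩
    obtain ⟨τ, hτ, h⟩ := this
    refine ⟨τ, hτ, fun t ht htt x hx => ?_⟩
    have h1 := h t ht x (by simpa using hx)
    have h2 : Real.exp (-K * t) * w t x ≤ ε := by
      calc _ ≤ Real.exp (-K * t) * ε' := by gcongr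
        _ ≤ Real.exp (|K| * t₁) * ε' := by
          apply mul_le_mul_of_nonneg_right (hexp t ⟨ht.1, htt⟩) hε'.le
        _ = ε := by simp only [ε']; field_simp
    have h3 : 0 ≤ (2 * d + 1) * t := by have := ht.1; positivity
    have h4 : 0 ≤ ‖x‖ ^ 2 := by positivity
    simp only [z]
    nlinarith
  have hx₁ρ : ‖x₁‖ ≤ ρ := by
    by_contra h
    push Not at h
    linarith [hout t₁ ⟨ht₁.1, le_rfl⟩ x₁ h]
  have hτt₁ : τ ≤ t₁ := by
    by_contra h
    push Not at h
    linarith [hτz t₁ ⟨ht₁.1, h⟩ le_rfl x₁ hx₁ρ]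
  have hcz : ContinuousOn (fun p : ℝ × Euc d => z p.1 p.2) (Icc τ t₁ ×ˢ closedBall 0 ρ) := by
    have : ContinuousOn (fun p : ℝ × Euc d => w p.1 p.2) (Icc τ t₁ ×ˢ closedBall 0 ρ) :=
      hc.mono (Set.prod_mono (fun t ht => ⟨hτ.trans_le ht.1, ht.2.trans ht₁.2⟩) (subset_univ _))
    simp only [z]
    fun_prop
  obtain ⟨⟨t, x⟩, ⟨htm, hxm⟩, hmax⟩ := ((isCompact_Icc).prod (isCompact_closedBall (0:Euc d) ρ)).exists_isMaxOn
    ⟨(t₁, x₁), ⟨⟨hτt₁, le_rfl⟩, by simpa using hx₁ρ⟩⟩ hcz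
  have hzpos : 0 < z t x := lt_of_lt_of_le hz₁ (hmax (a := (t₁, x₁)) ⟨⟨hτt₁, le_rfl⟩, by simpa using hx₁ρ⟩)
  have hglob : ∀ s ∈ Ioc 0 t₁, ∀ y, z s y ≤ z t x := by
    intro s hs y
    by_cases hy : ρ < ‖y‖
    · exact (hout s hs y hy).trans hzpos.le
    push Not at hy
    by_cases hsτ : s < τ
    · exact (hτz s ⟨hs.1, hsτ⟩ hs.2 y hy).trans hzpos.le
    push Not at hsτ
    exact hmax (a := (s, y)) ⟨⟨hsτ, hs.2⟩, by simpa using hy⟩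
  simp only at htm hxm
  have ht0 : 0 < t := hτ.trans_le htm.1
  have hwpos : 0 < w t x := by
    by_contra h
    push Not at h
    have : Real.exp (-K * t) * w t x ≤ 0 := mul_nonpos_of_nonneg_of_nonpos (Real.exp_pos _).le h
    have h3 : 0 ≤ (2 * d + 1) * t := by positivity
    have h4 : 0 ≤ ‖x‖ ^ 2 := by positivity
    simp only [z] at hzpos
    nlinarith
  obtain ⟨hC2, w', hw', hle⟩ := hsub t ⟨ht0, htm.2.trans ht₁.2⟩ x hwpos
  have hlm : IsLocalMax (z t) x := Eventually.of_forall fun y => hglob t ⟨ht0, htm.2⟩ y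
  have hq : ContDiffAt ℝ 2 (fun y : Euc d => ε * (1 + ‖y - 0‖ ^ 2 + (2 * d + 1) * t)) x := by
    refine contDiffAt_const.mul ((contDiffAt_const.add ?_).add contDiffAt_const)
    exact ((contDiff_id.sub contDiff_const).norm_sq ℝ).contDiffAt
  have hzt : z t = fun y => (fun y => Real.exp (-K * t) * w t y) y -
      (fun y : Euc d => ε * (1 + ‖y - 0‖ ^ 2 + (2 * d + 1) * t)) y := by
    ext y; simp [z]
  have hw2 : ContDiffAt ℝ 2 (fun y => Real.exp (-K * t) * w t y) x := contDiffAt_const.mul hC2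
  have hlapq : lap (fun y : Euc d => ε * (1 + ‖y - 0‖ ^ 2 + (2 * d + 1) * t)) x = ε * (2 * d) := by
    have h := lap_radial (d := d) (H := fun s => ε * (1 + s + (2 * d + 1) * t)) (H' := fun _ => ε) (H'' := 0)
      0 x (Eventually.of_forall fun s => by
        have := ((((hasDerivAt_id s).const_add 1).add_const ((2 * d + 1) * t)).const_mul ε)
        simpa using this) (hasDerivAt_const _ _)
    rw [h]; ring
  have hlap : lap (z t) x = Real.exp (-K * t) * lap (w t) x - ε * (2 * d) := by
    rw [hzt, lap_sub hw2 hq, hlapq, lap_const_mul _ hC2]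
  have hlap0 : lap (z t) x ≤ 0 := by
    refine lap_le_zero_of_isLocalMax ?_ hlm
    rw [hzt]; exact hw2.sub hq
  have hzd : HasDerivAt (fun s => z s x)
      ((Real.exp (-K * t) * (-K)) * w t x + Real.exp (-K * t) * w' - ε * (2 * d + 1)) t := by
    have h1 : HasDerivAt (fun s => Real.exp (-K * s)) (Real.exp (-K * t) * (-K)) t := by
      have := ((hasDerivAt_id t).const_mul (-K)).exp
      simpa using this
    have h2 : HasDerivAt (fun s : ℝ => ε * (1 + ‖x‖ ^ 2 + (2 * d + 1) * s)) (ε * (2 * d + 1)) t := by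
      have := (((hasDerivAt_id t).const_mul (2 * (d:ℝ) + 1)).const_add (1 + ‖x‖ ^ 2)).const_mul ε
      simpa using this
    exact (h1.mul hw').sub h2
  have hd0 := deriv_nonneg_of_left_max ht0 hzd (fun s hs => hglob s ⟨hs.1, hs.2.trans htm.2⟩ x)
  have hE := Real.exp_pos (-K * t)
  have h5 := mul_le_mul_of_nonneg_left hle hE.le
  rw [hlap] at hlap0
  nlinarith
end

section
open MeasureTheory Metric Set Filter
open scoped Topology RealInnerProductSpace NNReal Pointwise
set_option linter.unusedVariables false

/-! ### Gaussian kernels -/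

lemma gauss_integrable {d : ℕ} {b : ℝ} (hb : 0 < b) :
    Integrable (fun z : Euc d => Real.exp (-b * ‖z‖ ^ 2)) := by
  have := GaussianFourier.integrable_cexp_neg_mul_sq_norm_add (V := Euc d) (b := (b:ℂ)) (by simpa using hb) 0 0
  have h2 := this.norm
  refine h2.congr (Eventually.of_forall fun z => ?_)
  simp only [Complex.norm_exp]
  congr 1
  simp
  left
  norm_cast

/-- A kernel with Gaussian decay. -/
structure GB {d : ℕ} {W : Type*} [NormedAddCommGroup W] (C : ℝ) (k : Euc d → W) : Prop where
  cont : Continuous k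
  nonneg : 0 ≤ C
  bd : ∀ z, ‖k z‖ ≤ C * Real.exp (-(1/8) * ‖z‖ ^ 2)

lemma GB.integrable {d : ℕ} {W : Type*} [NormedAddCommGroup W] {C : ℝ} {k : Euc d → W} (h : GB C k) :
    Integrable k := by
  refine ((gauss_integrable (d := d) (b := 1/8) (by norm_num)).const_mul C).mono' h.cont.aestronglyMeasurable
    (Eventually.of_forall h.bd)

/-- normalized Gaussian -/
def gm {d : ℕ} (z : Euc d) : ℝ := ((Real.sqrt (4 * Real.pi))⁻¹) ^ d * Real.exp (-(1/4) * ‖z‖ ^ 2)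

lemma gm_pos {d : ℕ} (z : Euc d) : 0 < gm z := by unfold gm; positivity

lemma gm_integral {d : ℕ} : ∫ z : Euc d, gm z = 1 := by
  unfold gm
  rw [integral_const_mul, GaussianFourier.integral_rexp_neg_mul_sq_norm (by norm_num)]
  have h : (0:ℝ) < 4 * Real.pi := by positivity
  have h1 : Real.pi / (1/4) = 4 * Real.pi := by ring
  rw [h1, finrank_euclideanSpace, Fintype.card_fin, inv_pow]
  have : Real.sqrt (4 * Real.pi) ^ d = (4 * Real.pi) ^ ((d:ℝ) / 2) := by
    rw [Real.sqrt_eq_rpow, ← Real.rpow_natCast, ← Real.rpow_mul h.le]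
    congr 1; ring
  rw [this]
  exact inv_mul_cancel₀ (by positivity)

def gk1 {d : ℕ} (z : Euc d) : Euc d →L[ℝ] ℝ := (-(gm z / 2)) • ip z

def gk2 {d : ℕ} (z : Euc d) : Euc d →L[ℝ] (Euc d →L[ℝ] ℝ) :=
  (gm z / 4) • (ip z).smulRight (ip z) - (gm z / 2) • ip

def gtr {d : ℕ} (z : Euc d) : ℝ := gm z * (‖z‖ ^ 2 / 4 - d / 2)

lemma gm_hasFDerivAt {d : ℕ} (z : Euc d) : HasFDerivAt gm (gk1 z) z := by
  have h := hasFDerivAt_normsq 0 z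
  simp only [sub_zero] at h
  have h2 := ((h.const_mul (-(1/4))).exp).const_mul (((Real.sqrt (4 * Real.pi))⁻¹) ^ d)
  refine HasFDerivAt.congr_fderiv h2 ?_
  ext w
  simp [gk1, gm]
  ring

lemma gk1_hasFDerivAt {d : ℕ} (z : Euc d) : HasFDerivAt gk1 (gk2 z) z := by
  have h1 : HasFDerivAt (fun z : Euc d => (-(gm z / 2))) (-((2:ℝ)⁻¹ • gk1 z)) z := by
    have := ((gm_hasFDerivAt z).const_mul (2:ℝ)⁻¹).neg
    refine (this.congr_of_eventuallyEq (Eventually.of_forall fun y => ?_))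
    simp; ring
  have h2 : HasFDerivAt (fun z : Euc d => ip z) (ip : Euc d →L[ℝ] _) z := ip.hasFDerivAt
  refine HasFDerivAt.congr_fderiv (h1.smul h2) ?_
  ext v w
  simp [gk1, gk2]
  ring

lemma gk2_trace {d : ℕ} (z : Euc d) :
    ∑ i, gk2 z (EuclideanSpace.single i 1) (EuclideanSpace.single i 1) = gtr z := by
  have hn : ‖z‖ ^ 2 = ∑ i, (z i) ^ 2 := by
      rw [EuclideanSpace.norm_sq_eq]; simp
  have h3 : ∀ i : Fin d, gk2 z (EuclideanSpace.single i 1) (EuclideanSpace.single i 1) =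
        gm z / 4 * (z i) ^ 2 - gm z / 2 := fun i => by
      have h1 : gk2 z (EuclideanSpace.single i 1) (EuclideanSpace.single i 1) =
        gm z / 4 * (z i * z i) - gm z / 2 * (ip (EuclideanSpace.single i 1 : Euc d) (EuclideanSpace.single i 1)) := by
        simp only [gk2, ← ip_single z i]; rfl
      rw [h1, ip_single]
      have : (EuclideanSpace.single i 1 : Euc d) i = 1 := by simp
      rw [this]
      ring
  rw [Finset.sum_congr rfl fun i _ => h3 i, Finset.sum_sub_distrib, ← Finset.mul_sum, ← hn]
  simp [gtr]
  ring

lemma gm_continuous {d : ℕ} : Continuous (gm : Euc d → ℝ) := by unfold gm; fun_prop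

lemma gk1_continuous {d : ℕ} : Continuous (gk1 : Euc d → _) := by
  unfold gk1
  have := gm_continuous (d := d)
  fun_prop

set_option maxSynthPendingDepth 3 in
lemma gk2_continuous {d : ℕ} : Continuous (gk2 : Euc d → _) := by
  unfold gk2
  have := gm_continuous (d := d)
  have h : Continuous (fun z : Euc d => (ContinuousLinearMap.smulRightL ℝ (Euc d) (Euc d →L[ℝ] ℝ) (ip z)) (ip z)) := by
    fun_prop
  have h' : Continuous (fun z : Euc d => (ip z).smulRight (ip z)) := h
  have h1 : Continuous (fun z : Euc d => gm z / 4) := by fun_prop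
  have h2 : Continuous (fun z : Euc d => gm z / 2) := by fun_prop
  exact (h1.smul h').sub (h2.smul continuous_const)

lemma gtr_continuous {d : ℕ} : Continuous (gtr : Euc d → ℝ) := by
  unfold gtr
  have := gm_continuous (d := d)
  fun_prop

lemma gm_le_aux {d : ℕ} (z : Euc d) : gm z * (1 + ‖z‖ ^ 2 / 8) ≤
    ((Real.sqrt (4 * Real.pi))⁻¹) ^ d * Real.exp (-(1/8) * ‖z‖ ^ 2) := by
  have h1 : 1 + ‖z‖ ^ 2 / 8 ≤ Real.exp ((1/8) * ‖z‖ ^ 2) := by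
    have := Real.add_one_le_exp ((1/8) * ‖z‖ ^ 2)
    linarith
  have h2 : Real.exp (-(1/8) * ‖z‖ ^ 2) = Real.exp (-(1/4) * ‖z‖ ^ 2) * Real.exp ((1/8) * ‖z‖ ^ 2) := by
    rw [← Real.exp_add]; congr 1; ring
  unfold gm
  rw [h2, ← mul_assoc]
  exact mul_le_mul_of_nonneg_left h1 (by positivity)

def kC (d : ℕ) : ℝ := ((Real.sqrt (4 * Real.pi))⁻¹) ^ d * (d + 8)

lemma kC_bd {d : ℕ} {a : ℝ} (z : Euc d) (h : a ≤ gm z * (1 + ‖z‖ ^ 2 / 8) * (d + 8)) :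
    a ≤ kC d * Real.exp (-(1/8) * ‖z‖ ^ 2) := by
  refine h.trans ?_
  have := mul_le_mul_of_nonneg_right (gm_le_aux z) (show (0:ℝ) ≤ d + 8 by positivity)
  refine this.trans (le_of_eq ?_)
  unfold kC; ring

lemma kC_nonneg (d : ℕ) : 0 ≤ kC d := by unfold kC; positivity

lemma gm_GB {d : ℕ} : GB (kC d) (gm : Euc d → ℝ) := ⟨gm_continuous, kC_nonneg d, fun z => kC_bd z (by
  have h := gm_pos z
  rw [Real.norm_of_nonneg h.le, mul_assoc]
  refine le_mul_of_one_le_right h.le ?_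
  nlinarith [sq_nonneg ‖z‖, (Nat.cast_nonneg d : (0:ℝ) ≤ d), mul_nonneg (sq_nonneg ‖z‖) (Nat.cast_nonneg d : (0:ℝ) ≤ d)])⟩

lemma gk1_GB {d : ℕ} : GB (kC d) (gk1 : Euc d → _) := ⟨gk1_continuous, kC_nonneg d, fun z => kC_bd z (by
  have h := gm_pos z
  unfold gk1
  rw [norm_smul, norm_neg, Real.norm_of_nonneg (by positivity)]
  have h2 := ip_norm z
  calc gm z / 2 * ‖ip z‖ ≤ gm z / 2 * ‖z‖ := by gcongr
    _ = gm z * (‖z‖ / 2) := by ring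
    _ ≤ gm z * ((1 + ‖z‖ ^ 2 / 8) * (d + 8)) := by
      gcongr
      nlinarith [sq_nonneg (‖z‖ - 1), (Nat.cast_nonneg d : (0:ℝ) ≤ d), mul_nonneg (sq_nonneg ‖z‖) (Nat.cast_nonneg d : (0:ℝ) ≤ d)]
    _ = _ := by ring)⟩

lemma ip_opnorm {d : ℕ} : ‖(ip : Euc d →L[ℝ] (Euc d →L[ℝ] ℝ))‖ ≤ 1 :=
  ContinuousLinearMap.opNorm_le_bound _ zero_le_one fun y => by
    simpa using ip_norm y

set_option maxSynthPendingDepth 3 in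
lemma gk2_GB {d : ℕ} : GB (kC d) (gk2 : Euc d → _) := ⟨gk2_continuous, kC_nonneg d, fun z => kC_bd z (by
  have h := gm_pos z
  unfold gk2
  have h2 := ip_norm z
  have h3 := ip_opnorm (d := d)
  refine (norm_sub_le (E := Euc d →L[ℝ] (Euc d →L[ℝ] ℝ)) _ _).trans ?_
  rw [norm_smul, norm_smul, Real.norm_of_nonneg (by positivity), Real.norm_of_nonneg (by positivity),
    ContinuousLinearMap.norm_smulRight_apply]
  calc gm z / 4 * (‖ip z‖ * ‖ip z‖) + gm z / 2 * ‖(ip : Euc d →L[ℝ] (Euc d →L[ℝ] ℝ))‖ ≤ gm z / 4 * (‖z‖ * ‖z‖) + gm z / 2 * 1 := by gcongr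
    _ = gm z * (‖z‖ ^ 2 / 4 + 1 / 2) := by ring
    _ ≤ gm z * ((1 + ‖z‖ ^ 2 / 8) * (d + 8)) := by
      gcongr
      nlinarith [sq_nonneg (‖z‖), (Nat.cast_nonneg d : (0:ℝ) ≤ d), mul_nonneg (sq_nonneg ‖z‖) (Nat.cast_nonneg d : (0:ℝ) ≤ d)]
    _ = _ := by ring)⟩

lemma gtr_GB {d : ℕ} : GB (kC d) (gtr : Euc d → _) := ⟨gtr_continuous, kC_nonneg d, fun z => kC_bd z (by
  have h := gm_pos z
  unfold gtr
  rw [norm_mul, Real.norm_of_nonneg h.le, mul_assoc]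
  gcongr
  rw [Real.norm_eq_abs, abs_le]
  constructor <;> nlinarith [sq_nonneg (‖z‖), (Nat.cast_nonneg d : (0:ℝ) ≤ d), mul_nonneg (sq_nonneg ‖z‖) (Nat.cast_nonneg d : (0:ℝ) ≤ d)])⟩
end

section
open MeasureTheory Metric Set Filter
open scoped Topology RealInnerProductSpace NNReal Pointwise
set_option linter.unusedVariables false

section
variable {d : ℕ} {W : Type*} [NormedAddCommGroup W] [NormedSpace ℝ W]

/-- Rescaled convolution operator. -/
def Ak (k : Euc d → W) (τ : ℝ) (φ : Euc d → ℝ) (x : Euc d) : W :=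
  ∫ z, φ (x - Real.sqrt τ • z) • k z

lemma Ak_y (k : Euc d → W) {τ : ℝ} (hτ : 0 < τ) (φ : Euc d → ℝ) (x : Euc d) :
    Ak k τ φ x = ((Real.sqrt τ)⁻¹ ^ d) • ∫ y, φ y • k ((Real.sqrt τ)⁻¹ • (x - y)) := by
  have hs : 0 < Real.sqrt τ := Real.sqrt_pos.2 hτ
  have h1 := integral_sub_left_eq_self (fun w => φ (x - w) • k ((Real.sqrt τ)⁻¹ • w)) volume x
  simp only [sub_sub_cancel] at h1
  rw [h1]
  have h2 := Measure.integral_comp_smul volume (fun w => φ (x - w) • k ((Real.sqrt τ)⁻¹ • w)) (Real.sqrt τ)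
  have h3 : ∀ z : Euc d, (Real.sqrt τ)⁻¹ • Real.sqrt τ • z = z := fun z => by
    rw [smul_smul, inv_mul_cancel₀ hs.ne', one_smul]
  simp only [h3] at h2
  unfold Ak
  rw [h2, finrank_euclideanSpace, Fintype.card_fin, abs_of_nonneg (by positivity), inv_pow]

lemma exp_dom {c₀ c : ℝ} (hc₀ : 0 < c₀) (hc : c₀ / 2 ≤ c) {x x' : Euc d} (hx : ‖x' - x‖ ≤ 1) (y : Euc d) :
    Real.exp (-(1/8) * ‖c • (x' - y)‖ ^ 2) ≤
      Real.exp (c₀ ^ 2 / 32) * Real.exp (-(c₀ ^ 2 / 64) * ‖x - y‖ ^ 2) := by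
  rw [← Real.exp_add]
  apply Real.exp_le_exp.2
  rw [norm_smul, mul_pow, Real.norm_eq_abs, sq_abs]
  have h1 : ‖x - y‖ ≤ 1 + ‖x' - y‖ := by
    calc ‖x - y‖ = ‖(x' - y) - (x' - x)‖ := by congr 1; abel
      _ ≤ ‖x' - y‖ + ‖x' - x‖ := norm_sub_le _ _
      _ ≤ _ := by linarith
  have h2 : ‖x - y‖ ^ 2 ≤ 2 * (1 + ‖x' - y‖ ^ 2) := by
    have : ‖x - y‖ ^ 2 ≤ (1 + ‖x' - y‖) ^ 2 := by gcongr
    nlinarith [sq_nonneg (1 - ‖x' - y‖)]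
  have h3 : c₀ ^ 2 / 4 ≤ c ^ 2 := by nlinarith
  have h4 : c₀ ^ 2 / 4 * ‖x' - y‖ ^ 2 ≤ c ^ 2 * ‖x' - y‖ ^ 2 := by gcongr
  nlinarith [sq_nonneg c₀]

lemma dom_integrable {c₀ : ℝ} (hc₀ : 0 < c₀) (x : Euc d) :
    Integrable (fun y : Euc d => Real.exp (c₀ ^ 2 / 32) * Real.exp (-(c₀ ^ 2 / 64) * ‖x - y‖ ^ 2)) := by
  refine Integrable.const_mul ?_ _
  exact (gauss_integrable (d := d) (b := c₀ ^ 2 / 64) (by positivity)).comp_sub_left x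

lemma integrand_meas {k : Euc d → W} (hk : Continuous k) {φ : Euc d → ℝ} (hφ : Measurable φ) (c : ℝ) (x : Euc d) :
    AEStronglyMeasurable (fun y => φ y • k (c • (x - y))) volume :=
  hφ.aestronglyMeasurable.smul (Continuous.aestronglyMeasurable (by fun_prop))

lemma integrand_integrable {C B : ℝ} {k : Euc d → W} (hk : GB C k) {φ : Euc d → ℝ} (hφ : Measurable φ)
    (hb : ∀ x, |φ x| ≤ B) {c : ℝ} (hc : 0 < c) (x : Euc d) :
    Integrable (fun y => φ y • k (c • (x - y))) volume := by
  refine ((dom_integrable hc x).const_mul (B * C)).mono' (integrand_meas hk.cont hφ c x)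
    (Eventually.of_forall fun y => ?_)
  rw [norm_smul, mul_assoc]
  have hB : 0 ≤ B := (abs_nonneg _).trans (hb x)
  have h1 := hk.bd (c • (x - y))
  have h2 := exp_dom (c := c) hc (by linarith) (show ‖x - x‖ ≤ 1 by simp) y
  calc _ ≤ B * (C * Real.exp (-(1/8) * ‖c • (x - y)‖ ^ 2)) :=
        mul_le_mul (hb y) h1 (norm_nonneg _) hB
    _ ≤ _ := by have := hk.nonneg; gcongr

lemma Ak_fderiv_aux {C C' B : ℝ} {k : Euc d → W} {k' : Euc d → (Euc d →L[ℝ] W)} (hk : GB C k) (hk' : GB C' k')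
    (hd : ∀ z, HasFDerivAt k (k' z) z) {φ : Euc d → ℝ} (hφ : Measurable φ)
    (hb : ∀ x, |φ x| ≤ B) {c : ℝ} (hc : 0 < c) (x : Euc d) :
    HasFDerivAt (fun x => ∫ y, φ y • k (c • (x - y))) (∫ y, φ y • (c • k' (c • (x - y)))) x := by
  have hB : 0 ≤ B := (abs_nonneg _).trans (hb x)
  refine hasFDerivAt_integral_of_dominated_of_fderiv_le (s := ball x 1) (F' := fun x y => φ y • (c • k' (c • (x - y))))
    (bound := fun y => B * c * C' * (Real.exp (c ^ 2 / 32) * Real.exp (-(c ^ 2 / 64) * ‖x - y‖ ^ 2))) (ball_mem_nhds x one_pos) ?_ ?_ ?_ ?_ ?_ ?_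
  · exact Eventually.of_forall fun x => integrand_meas hk.cont hφ c x
  · exact integrand_integrable hk hφ hb hc x
  · exact integrand_meas (k := fun z => c • k' z) (hk'.cont.const_smul c) hφ c x
  · refine Eventually.of_forall fun y x' hx' => ?_
    rw [norm_smul, norm_smul, Real.norm_of_nonneg hc.le]
    have h1 := hk'.bd (c • (x' - y))
    have h2 := exp_dom (c := c) hc (by linarith) (show ‖x' - x‖ ≤ 1 by simpa [dist_eq_norm] using (mem_ball.1 hx').le) y
    have hC' := hk'.nonneg
    calc _ ≤ B * (c * (C' * Real.exp (-(1/8) * ‖c • (x' - y)‖ ^ 2))) :=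
          mul_le_mul (hb y) (by gcongr) (by positivity) hB
      _ ≤ B * (c * (C' * (Real.exp (c ^ 2 / 32) * Real.exp (-(c ^ 2 / 64) * ‖x - y‖ ^ 2)))) := by
          gcongr
      _ = _ := by ring
  · exact (dom_integrable hc x).const_mul _
  · refine Eventually.of_forall fun y x' hx' => ?_
    have h1 : HasFDerivAt (fun x : Euc d => c • (x - y)) (c • ContinuousLinearMap.id ℝ (Euc d)) x' :=
      ((hasFDerivAt_id x').sub_const y).const_smul c
    have h2 := ((hd (c • (x' - y))).comp x' h1).const_smul (φ y)
    refine HasFDerivAt.congr_fderiv h2 ?_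
    ext v
    simp

lemma Ak_hasFDerivAt {C C' B : ℝ} {k : Euc d → W} {k' : Euc d → (Euc d →L[ℝ] W)} (hk : GB C k) (hk' : GB C' k')
    (hd : ∀ z, HasFDerivAt k (k' z) z) {φ : Euc d → ℝ} (hφ : Measurable φ)
    (hb : ∀ x, |φ x| ≤ B) {τ : ℝ} (hτ : 0 < τ) (x : Euc d) :
    HasFDerivAt (Ak k τ φ) ((Real.sqrt τ)⁻¹ • Ak k' τ φ x) x := by
  have hc : 0 < (Real.sqrt τ)⁻¹ := inv_pos.2 (Real.sqrt_pos.2 hτ)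
  have h1 := (Ak_fderiv_aux hk hk' hd hφ hb hc x).const_smul ((Real.sqrt τ)⁻¹ ^ d)
  have h2 : Ak k τ φ = fun x => ((Real.sqrt τ)⁻¹ ^ d) • ∫ y, φ y • k ((Real.sqrt τ)⁻¹ • (x - y)) :=
    funext fun x => Ak_y k hτ φ x
  rw [h2]
  refine HasFDerivAt.congr_fderiv h1 ?_
  rw [Ak_y k' hτ φ x, smul_comm, ← integral_smul (𝕜 := ℝ) ((Real.sqrt τ)⁻¹)]
  congr 2
  ext y : 1
  rw [smul_comm]

/-- continuity in `(τ, x)` for measurable data -/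
lemma Ak_continuousAt {C B : ℝ} {k : Euc d → W} (hk : GB C k) {φ : Euc d → ℝ} (hφ : Measurable φ)
    (hb : ∀ x, |φ x| ≤ B) {τ : ℝ} (hτ : 0 < τ) (x : Euc d) :
    ContinuousAt (fun p : ℝ × Euc d => Ak k p.1 φ p.2) (τ, x) := by
  have hB : 0 ≤ B := (abs_nonneg _).trans (hb x)
  have hsq : 0 < Real.sqrt τ := Real.sqrt_pos.2 hτ
  set c₀ := (Real.sqrt τ)⁻¹ with hc₀
  have hc : 0 < c₀ := inv_pos.2 hsq
  have hcc : ContinuousAt (fun p : ℝ × Euc d => (Real.sqrt p.1)⁻¹) (τ, x) := by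
    refine ContinuousAt.inv₀ (by fun_prop) ?_
    exact hsq.ne'
  have hev : (fun p : ℝ × Euc d => Ak k p.1 φ p.2) =ᶠ[𝓝 (τ, x)] fun p =>
      ((Real.sqrt p.1)⁻¹ ^ d) • ∫ y, φ y • k ((Real.sqrt p.1)⁻¹ • (p.2 - y)) := by
    have : ∀ᶠ p : ℝ × Euc d in 𝓝 (τ, x), 0 < p.1 :=
      continuousAt_fst.eventually (lt_mem_nhds hτ)
    filter_upwards [this] with p hp using Ak_y k hp φ p.2
  refine ContinuousAt.congr ?_ hev.symm
  refine ContinuousAt.smul (hcc.pow d) ?_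
  refine continuousAt_of_dominated (bound := fun y => B * C * (Real.exp (c₀ ^ 2 / 32) * Real.exp (-(c₀ ^ 2 / 64) * ‖x - y‖ ^ 2))) ?_ ?_ ?_ ?_
  · exact Eventually.of_forall fun p => integrand_meas hk.cont hφ _ _
  · have e1 : ∀ᶠ p : ℝ × Euc d in 𝓝 (τ, x), c₀ / 2 < (Real.sqrt p.1)⁻¹ :=
      hcc.eventually (lt_mem_nhds (by simp only [← hc₀]; linarith))
    have e2 : ∀ᶠ p : ℝ × Euc d in 𝓝 (τ, x), p.2 ∈ ball x 1 :=
      continuousAt_snd.eventually (ball_mem_nhds x one_pos)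
    filter_upwards [e1, e2] with p h1 h2
    refine Eventually.of_forall fun y => ?_
    rw [norm_smul]
    have h3 := exp_dom hc h1.le (show ‖p.2 - x‖ ≤ 1 by simpa [dist_eq_norm] using (mem_ball.1 h2).le) y
    have hC' := hk.nonneg
    calc _ ≤ B * (C * Real.exp (-(1/8) * ‖(Real.sqrt p.1)⁻¹ • (p.2 - y)‖ ^ 2)) :=
          mul_le_mul (hb y) (hk.bd _) (by positivity) hB
      _ ≤ B * (C * (Real.exp (c₀ ^ 2 / 32) * Real.exp (-(c₀ ^ 2 / 64) * ‖x - y‖ ^ 2))) := by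
          gcongr
      _ = _ := by ring
  · exact (dom_integrable hc x).const_mul _
  · refine Eventually.of_forall fun y => ?_
    have : ContinuousAt (fun p : ℝ × Euc d => (Real.sqrt p.1)⁻¹ • (p.2 - y)) (τ, x) :=
      hcc.smul (by fun_prop)
    exact (hk.cont.continuousAt.comp this).const_smul (φ y)

end

lemma Pt_hasDerivAt {d : ℕ} {B : ℝ} {φ : Euc d → ℝ} (hφ : Measurable φ)
    (hb : ∀ x, |φ x| ≤ B) {τ : ℝ} (hτ : 0 < τ) (x : Euc d) :
    HasDerivAt (fun τ => Ak gm τ φ x) (τ⁻¹ * Ak gtr τ φ x) τ := by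
  have hB : 0 ≤ B := (abs_nonneg _).trans (hb x)
  have hsq : 0 < Real.sqrt τ := Real.sqrt_pos.2 hτ
  set c₀ := (Real.sqrt τ)⁻¹ with hc₀
  have hc : 0 < c₀ := inv_pos.2 hsq
  have key : HasDerivAt (fun c : ℝ => ∫ y, φ y * (c ^ d * gm (c • (x - y))))
      (∫ y, φ y * (-2 * c₀⁻¹ * c₀ ^ d * gtr (c₀ • (x - y)))) c₀ := by
    refine (hasDerivAt_integral_of_dominated_loc_of_deriv_le (s := ball c₀ (c₀/2))
      (F' := fun c y => φ y * (-2 * c⁻¹ * c ^ d * gtr (c • (x - y))))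
      (bound := fun y => B * (2 * (2 * c₀⁻¹) * (2 * c₀) ^ d * kC d) * (Real.exp (c₀ ^ 2 / 32) * Real.exp (-(c₀ ^ 2 / 64) * ‖x - y‖ ^ 2)))
      (ball_mem_nhds _ (by positivity)) ?_ ?_ ?_ ?_ ?_ ?_).2
    · refine Eventually.of_forall fun c => hφ.aestronglyMeasurable.mul (Continuous.aestronglyMeasurable ?_)
      have := gm_continuous (d := d)
      fun_prop
    · have := (integrand_integrable gm_GB hφ hb hc x).const_mul (c₀ ^ d)
      refine this.congr (Eventually.of_forall fun y => ?_)
      simp only [smul_eq_mul]; ring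
    · refine hφ.aestronglyMeasurable.mul (Continuous.aestronglyMeasurable ?_)
      have := gtr_continuous (d := d)
      fun_prop
    · refine Eventually.of_forall fun y c hcb => ?_
      rw [mem_ball, Real.dist_eq, abs_lt] at hcb
      have hc1 : c₀ / 2 ≤ c := by linarith
      have hc2 : c ≤ 2 * c₀ := by linarith
      have hcp : 0 < c := by linarith
      have hci : c⁻¹ ≤ 2 * c₀⁻¹ := by
        rw [inv_le_comm₀ hcp (by positivity)]
        have : (2 * c₀⁻¹)⁻¹ = c₀ / 2 := by rw [mul_inv, inv_inv]; ring
        rw [this]; exact hc1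
      have h3 := exp_dom hc hc1 (show ‖x - x‖ ≤ 1 by simp) y
      have hC' := kC_nonneg d
      rw [norm_mul, norm_mul, norm_mul, norm_mul, norm_neg, Real.norm_ofNat, norm_inv, norm_pow, Real.norm_of_nonneg hcp.le]
      calc _ ≤ B * ((2 * (2 * c₀⁻¹) * (2 * c₀) ^ d) * (kC d * Real.exp (-(1/8) * ‖c • (x - y)‖ ^ 2))) := by
            refine mul_le_mul (hb y) ?_ (by positivity) hB
            refine mul_le_mul ?_ (gtr_GB.bd _) (by positivity) (by positivity)
            gcongr
        _ ≤ B * ((2 * (2 * c₀⁻¹) * (2 * c₀) ^ d) * (kC d * (Real.exp (c₀ ^ 2 / 32) * Real.exp (-(c₀ ^ 2 / 64) * ‖x - y‖ ^ 2)))) := by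
            gcongr
        _ = _ := by ring
    · exact (dom_integrable hc x).const_mul _
    · refine Eventually.of_forall fun y c hcb => ?_
      rw [mem_ball, Real.dist_eq, abs_lt] at hcb
      have hcp : 0 < c := by linarith
      have hgm : ∀ c : ℝ, gm (c • (x - y)) = ((Real.sqrt (4 * Real.pi))⁻¹) ^ d * Real.exp (-(1/4) * (c ^ 2 * ‖x - y‖ ^ 2)) := fun c => by
        unfold gm
        rw [norm_smul, mul_pow, Real.norm_eq_abs, sq_abs]
      have h1 : HasDerivAt (fun c : ℝ => gm (c • (x - y))) (gm (c • (x - y)) * (-(1/2) * c * ‖x - y‖ ^ 2)) c := by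
        simp only [hgm]
        have := (((((hasDerivAt_id c).pow 2).mul_const (‖x - y‖ ^ 2)).const_mul (-(1/4))).exp).const_mul (((Real.sqrt (4 * Real.pi))⁻¹) ^ d)
        refine this.congr_deriv ?_
        simp
        ring
      have h2 := (((hasDerivAt_pow d c).mul h1)).const_mul (φ y)
      refine h2.congr_deriv ?_
      congr 1
      unfold gtr
      rw [norm_smul, mul_pow, Real.norm_eq_abs, sq_abs]
      rcases Nat.eq_zero_or_pos d with h0 | h0
      · subst h0
        simp
        field_simp
        ring
      · obtain ⟨n, rfl⟩ := Nat.exists_eq_succ_of_ne_zero h0.ne'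
        simp only [Nat.succ_eq_add_one, Nat.add_sub_cancel]
        field_simp
        ring
  have hcd : HasDerivAt (fun τ : ℝ => (Real.sqrt τ)⁻¹) (-(c₀ / (2 * τ))) τ := by
    have := (Real.hasDerivAt_sqrt hτ.ne').inv hsq.ne'
    refine this.congr_deriv ?_
    rw [hc₀]
    have h4 : Real.sqrt τ ^ 2 = τ := Real.sq_sqrt hτ.le
    rw [h4]
    field_simp
  have h5 := HasDerivAt.comp τ (h₂ := fun c : ℝ => ∫ y, φ y * (c ^ d * gm (c • (x - y)))) key hcd
  have hev : (fun τ => Ak gm τ φ x) =ᶠ[𝓝 τ] ((fun c : ℝ => ∫ y, φ y * (c ^ d * gm (c • (x - y)))) ∘ fun τ : ℝ => (Real.sqrt τ)⁻¹) := by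
    filter_upwards [lt_mem_nhds hτ] with s hs
    rw [Ak_y gm hs, Function.comp, smul_eq_mul, ← integral_const_mul]
    congr 1
    ext y
    simp only [smul_eq_mul]; ring
  refine (h5.congr_of_eventuallyEq hev).congr_deriv ?_
  rw [Ak_y gtr hτ, ← hc₀, ← integral_mul_const, smul_eq_mul, ← integral_const_mul, ← integral_const_mul]
  congr 1
  ext y
  simp only [smul_eq_mul]
  field_simp
end

section
open MeasureTheory Metric Set Filter
open scoped Topology RealInnerProductSpace NNReal Pointwise
set_option linter.unusedVariables false

section
variable {d : ℕ} {W : Type*} [NormedAddCommGroup W] [NormedSpace ℝ W]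

def gI (d : ℕ) : ℝ := ∫ z : Euc d, Real.exp (-(1/8) * ‖z‖ ^ 2)
def gI1 (d : ℕ) : ℝ := ∫ z : Euc d, ‖z‖ * Real.exp (-(1/8) * ‖z‖ ^ 2)

lemma gI_nonneg : 0 ≤ gI d := integral_nonneg fun z => (Real.exp_pos _).le
lemma gI1_nonneg : 0 ≤ gI1 d := integral_nonneg fun z => by positivity

lemma gI1_integrable : Integrable (fun z : Euc d => ‖z‖ * Real.exp (-(1/8) * ‖z‖ ^ 2)) := by
  refine ((gauss_integrable (d := d) (b := 1/16) (by norm_num)).const_mul 16).mono'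
    (Continuous.aestronglyMeasurable (by fun_prop)) (Eventually.of_forall fun z => ?_)
  rw [Real.norm_of_nonneg (by positivity)]
  have h2 : Real.exp (-(1/16) * ‖z‖ ^ 2) = Real.exp (-(1/8) * ‖z‖ ^ 2) * Real.exp ((1/16) * ‖z‖ ^ 2) := by
    rw [← Real.exp_add]; congr 1; ring
  have h3 := Real.add_one_le_exp ((1/16) * ‖z‖ ^ 2)
  have h4 : ‖z‖ ≤ 16 * Real.exp ((1/16) * ‖z‖ ^ 2) := by nlinarith [sq_nonneg (‖z‖ - 1)]
  rw [h2]
  nlinarith [Real.exp_pos (-(1/8) * ‖z‖ ^ 2)]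

lemma Ak_integrable {C B : ℝ} {k : Euc d → W} (hk : GB C k) {φ : Euc d → ℝ} (hφ : Measurable φ)
    (hb : ∀ x, |φ x| ≤ B) (τ : ℝ) (x : Euc d) : Integrable (fun z => φ (x - Real.sqrt τ • z) • k z) := by
  have hB : 0 ≤ B := (abs_nonneg _).trans (hb x)
  refine ((gauss_integrable (d := d) (b := 1/8) (by norm_num)).const_mul (B * C)).mono' ?_
    (Eventually.of_forall fun z => ?_)
  · refine AEStronglyMeasurable.smul ?_ hk.cont.aestronglyMeasurable
    exact (hφ.comp (by fun_prop)).aestronglyMeasurable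
  · rw [norm_smul, mul_assoc]
    exact mul_le_mul (hb _) (hk.bd z) (norm_nonneg _) hB

lemma Ak_norm_le {C B : ℝ} {k : Euc d → W} (hk : GB C k) {φ : Euc d → ℝ}
    (hb : ∀ x, |φ x| ≤ B) (τ : ℝ) (x : Euc d) : ‖Ak k τ φ x‖ ≤ B * C * gI d := by
  have hB : 0 ≤ B := (abs_nonneg _).trans (hb x)
  unfold Ak gI
  rw [← integral_const_mul]
  refine norm_integral_le_of_norm_le ((gauss_integrable (d := d) (b := 1/8) (by norm_num)).const_mul (B * C)) (Eventually.of_forall fun z => ?_)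
  rw [norm_smul, mul_assoc]
  exact mul_le_mul (hb _) (hk.bd z) (norm_nonneg _) hB

lemma Ak_lip_le {C B L : ℝ} {k : Euc d → W} [CompleteSpace W] (hk : GB C k) (h0 : ∫ z, k z = 0) {φ : Euc d → ℝ} (hφ : Measurable φ)
    (hb : ∀ x, |φ x| ≤ B) (hL : 0 ≤ L) (hlip : ∀ x y, |φ x - φ y| ≤ L * ‖x - y‖) (τ : ℝ) (x : Euc d) :
    ‖Ak k τ φ x‖ ≤ L * Real.sqrt τ * C * gI1 d := by
  have h1 : Ak k τ φ x = ∫ z, (φ (x - Real.sqrt τ • z) - φ x) • k z := by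
    have hi2 : Integrable (fun z => φ x • k z) := hk.integrable.smul (φ x)
    simp only [sub_smul]
    rw [integral_sub (Ak_integrable hk hφ hb τ x) hi2, integral_smul, h0]
    simp [Ak]
  rw [h1]
  unfold gI1
  rw [← integral_const_mul]
  refine norm_integral_le_of_norm_le (gI1_integrable.const_mul _) (Eventually.of_forall fun z => ?_)
  rw [norm_smul]
  have h2 := hlip (x - Real.sqrt τ • z) x
  have h3 : ‖x - Real.sqrt τ • z - x‖ = Real.sqrt τ * ‖z‖ := by
    rw [sub_sub_cancel_left, norm_neg, norm_smul, Real.norm_of_nonneg (Real.sqrt_nonneg _)]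
  rw [h3] at h2
  calc _ ≤ (L * (Real.sqrt τ * ‖z‖)) * (C * Real.exp (-(1/8) * ‖z‖ ^ 2)) :=
        mul_le_mul h2 (hk.bd z) (norm_nonneg _) (by positivity)
    _ = _ := by ring

/-- source terms -/
structure SrcB (h : ℝ → Euc d → ℝ) (M : ℝ) : Prop where
  cont : ContinuousOn (fun p : ℝ × Euc d => h p.1 p.2) (Ioi 0 ×ˢ univ)
  bd : ∀ s x, 0 < s → |h s x| ≤ M

lemma SrcB.contAt {h : ℝ → Euc d → ℝ} {M : ℝ} (hh : SrcB h M) {s : ℝ} (hs : 0 < s) (x : Euc d) :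
    ContinuousAt (fun p : ℝ × Euc d => h p.1 p.2) (s, x) :=
  hh.cont.continuousAt (prod_mem_nhds (Ioi_mem_nhds hs) univ_mem)

lemma SrcB.contx {h : ℝ → Euc d → ℝ} {M : ℝ} (hh : SrcB h M) {s : ℝ} (hs : 0 < s) : Continuous (h s) := by
  rw [continuous_iff_continuousAt]
  intro x
  exact ContinuousAt.comp (f := fun x => (s, x)) (g := fun p : ℝ × Euc d => h p.1 p.2) (hh.contAt hs x) (by fun_prop)

lemma AkC {C M : ℝ} {k : Euc d → W} (hk : GB C k) {h : ℝ → Euc d → ℝ} (hh : SrcB h M) (σ : ℝ) {s : ℝ} (hs : 0 < s) (x : Euc d) :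
    ContinuousAt (fun p : ℝ × ℝ × Euc d => Ak k p.1 (h p.2.1) p.2.2) (σ, s, x) := by
  unfold Ak
  have hM : 0 ≤ M := (abs_nonneg _).trans (hh.bd s x hs)
  have hev : ∀ᶠ p : ℝ × ℝ × Euc d in 𝓝 (σ, s, x), 0 < p.2.1 :=
    (continuousAt_fst.comp continuousAt_snd).eventually (lt_mem_nhds hs)
  refine continuousAt_of_dominated (bound := fun z => (M * C) * Real.exp (-(1/8) * ‖z‖ ^ 2)) ?_ ?_ ?_ ?_
  · filter_upwards [hev] with p hp
    refine AEStronglyMeasurable.smul ?_ hk.cont.aestronglyMeasurable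
    have := hh.contx hp
    exact Continuous.aestronglyMeasurable (by fun_prop)
  · filter_upwards [hev] with p hp
    refine Eventually.of_forall fun z => ?_
    rw [norm_smul, mul_assoc]
    exact mul_le_mul (hh.bd _ _ hp) (hk.bd z) (norm_nonneg _) hM
  · exact (gauss_integrable (d := d) (b := 1/8) (by norm_num)).const_mul (M * C)
  · refine Eventually.of_forall fun z => ?_
    refine ContinuousAt.smul ?_ continuousAt_const
    refine ContinuousAt.comp (f := fun p : ℝ × ℝ × Euc d => (p.2.1, p.2.2 - Real.sqrt p.1 • z)) (g := fun p : ℝ × Euc d => h p.1 p.2) (hh.contAt hs _) (by fun_prop)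

end

lemma Ak_gm_one {d : ℕ} (τ : ℝ) (x : Euc d) : Ak gm τ (fun _ => 1) x = 1 := by
  simp [Ak, gm_integral]

lemma gk1_mean {d : ℕ} : ∫ z : Euc d, gk1 z = 0 := by
  have h := Ak_hasFDerivAt (d := d) gm_GB gk1_GB gm_hasFDerivAt (φ := fun _ => 1) measurable_const (B := 1) (by simp) one_pos 0
  have h2 : (Ak gm 1 (fun _ => 1) : Euc d → ℝ) = fun _ => 1 := funext fun x => Ak_gm_one 1 x
  rw [h2] at h
  have := h.unique (hasFDerivAt_const 1 0)
  simpa [Ak] using this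

lemma gk2_mean {d : ℕ} : ∫ z : Euc d, gk2 z = 0 := by
  have h := Ak_hasFDerivAt (d := d) gk1_GB gk2_GB gk1_hasFDerivAt (φ := fun _ => 1) measurable_const (B := 1) (by simp) one_pos 0
  have h2 : (Ak gk1 1 (fun _ => 1) : Euc d → _) = fun _ => 0 := funext fun x => by
    simp [Ak, gk1_mean]
  rw [h2] at h
  have := h.unique (hasFDerivAt_const 0 0)
  simpa [Ak] using this

lemma gtr_mean {d : ℕ} : ∫ z : Euc d, gtr z = 0 := by
  have h := Pt_hasDerivAt (d := d) (φ := fun _ => 1) measurable_const (B := 1) (by simp) one_pos 0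
  have h2 : (fun τ => Ak gm τ (fun _ => 1) (0 : Euc d)) = fun _ => 1 := funext fun x => Ak_gm_one x 0
  rw [h2] at h
  have := h.unique (hasDerivAt_const 1 1)
  simpa [Ak] using this

lemma Ak_trace {d : ℕ} {B : ℝ} {φ : Euc d → ℝ} (hφ : Measurable φ)
    (hb : ∀ x, |φ x| ≤ B) (τ : ℝ) (x : Euc d) :
    ∑ i, (Ak gk2 τ φ x) (EuclideanSpace.single i 1) (EuclideanSpace.single i 1) = Ak gtr τ φ x := by
  have h1 : ∀ i : Fin d, (Ak gk2 τ φ x) (EuclideanSpace.single i 1) (EuclideanSpace.single i 1) =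
      ∫ z, φ (x - Real.sqrt τ • z) * gk2 z (EuclideanSpace.single i 1) (EuclideanSpace.single i 1) := fun i => by
    unfold Ak
    have hi := Ak_integrable gk2_GB hφ hb τ x
    rw [ContinuousLinearMap.integral_apply hi, ContinuousLinearMap.integral_apply (hi.apply_continuousLinearMap _)]
    rfl
  rw [Finset.sum_congr rfl fun i _ => h1 i, ← integral_finsetSum]
  · unfold Ak
    congr 1
    ext z
    rw [← Finset.mul_sum, gk2_trace, smul_eq_mul]
  · intro i _
    exact ((Ak_integrable gk2_GB hφ hb τ x).apply_continuousLinearMap _).apply_continuousLinearMap _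
end

section
open MeasureTheory Metric Set Filter
open scoped Topology RealInnerProductSpace NNReal Pointwise
set_option linter.unusedVariables false
set_option linter.unusedSectionVars false

lemma invsqrt_intble (r : ℝ) : IntegrableOn (fun s : ℝ => (Real.sqrt s)⁻¹) (Ioo 0 r) := by
  have h := intervalIntegral.intervalIntegrable_rpow' (a := 0) (b := r) (r := -(1/2)) (by norm_num)
  rcases le_or_gt r 0 with hr | hr
  · rw [Ioo_eq_empty (by simpa using hr)]; exact integrableOn_empty
  rw [intervalIntegrable_iff_integrableOn_Ioo_of_le hr.le] at h
  refine h.congr_fun (fun s hs => ?_) measurableSet_Ioo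
  simp only
  rw [Real.rpow_neg hs.1.le, Real.sqrt_eq_rpow]

lemma invsqrt_intble' (r : ℝ) : IntegrableOn (fun s : ℝ => (Real.sqrt (r - s))⁻¹) (Ioo 0 r) := by
  rcases le_or_gt r 0 with hr | hr
  · rw [Ioo_eq_empty (by simpa using hr)]; exact integrableOn_empty
  have h := invsqrt_intble r
  rw [← intervalIntegrable_iff_integrableOn_Ioo_of_le hr.le] at h ⊢
  have := (h.comp_sub_left r).symm
  simpa using this

lemma wt_le {r s : ℝ} (h0 : 0 < s) (h1 : s < r) :
    (Real.sqrt (r - s) * Real.sqrt s)⁻¹ ≤ (Real.sqrt r)⁻¹ * ((Real.sqrt s)⁻¹ + (Real.sqrt (r - s))⁻¹) := by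
  have ha : 0 < Real.sqrt s := Real.sqrt_pos.2 h0
  have hb : 0 < Real.sqrt (r - s) := Real.sqrt_pos.2 (by linarith)
  have hr : 0 < Real.sqrt r := Real.sqrt_pos.2 (by linarith)
  have hle : Real.sqrt r ≤ Real.sqrt (r - s) + Real.sqrt s := by
    rw [Real.sqrt_le_left (by positivity)]
    nlinarith [Real.mul_self_sqrt h0.le, Real.mul_self_sqrt (show 0 ≤ r - s by linarith)]
  have : (Real.sqrt r)⁻¹ * ((Real.sqrt s)⁻¹ + (Real.sqrt (r - s))⁻¹) =
     ((Real.sqrt (r - s) + Real.sqrt s) / Real.sqrt r) * (Real.sqrt (r - s) * Real.sqrt s)⁻¹ := by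
    field_simp
  rw [this]
  refine le_mul_of_one_le_left (by positivity) ?_
  rwa [le_div_iff₀ hr, one_mul]

lemma wt_intble (r : ℝ) : IntegrableOn (fun s : ℝ => (Real.sqrt (r - s) * Real.sqrt s)⁻¹) (Ioo 0 r) := by
  refine Integrable.mono' (((invsqrt_intble r).add (invsqrt_intble' r)).const_mul (Real.sqrt r)⁻¹) ?_ ?_
  · refine Measurable.aestronglyMeasurable (by fun_prop)
  · refine (ae_restrict_iff' measurableSet_Ioo).2 (Eventually.of_forall fun s hs => ?_)
    rw [Real.norm_of_nonneg (by positivity)]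
    exact wt_le hs.1 hs.2

/-- weight on the unit interval -/
def wt (ρ : ℝ) : ℝ := (Real.sqrt ρ * Real.sqrt (1 - ρ))⁻¹
lemma wt_int1 : IntegrableOn wt (Ioo 0 1) := by
  refine (wt_intble 1).congr_fun (fun s hs => ?_) measurableSet_Ioo
  simp [wt, mul_comm]
def W0 : ℝ := ∫ ρ in Ioo (0:ℝ) 1, wt ρ
lemma W0_nonneg : 0 ≤ W0 := integral_nonneg fun ρ => by unfold wt; positivity

section
variable {d : ℕ} {W : Type*} [NormedAddCommGroup W] [NormedSpace ℝ W]

structure Adm (C : ℝ) (G : ℝ → ℝ → Euc d → W) : Prop where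
  Cn : 0 ≤ C
  cont : ∀ σ s x, 0 < σ → 0 < s → ContinuousAt (fun p : ℝ × ℝ × Euc d => G p.1 p.2.1 p.2.2) (σ, s, x)
  bd : ∀ σ s x, 0 < σ → 0 < s → ‖G σ s x‖ ≤ C * (1 + σ + s) * (Real.sqrt σ * Real.sqrt s)⁻¹

def Jd (G : ℝ → ℝ → Euc d → W) (t : ℝ) (x : Euc d) : W :=
  t • ∫ ρ in Ioo (0:ℝ) 1, G (t * ρ) (t * (1 - ρ)) x

lemma Adm.norm {C : ℝ} {G : ℝ → ℝ → Euc d → W} (h : Adm C G) : Adm C (fun σ s x => ‖G σ s x‖) :=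
  ⟨h.Cn, fun σ s x h1 h2 => (h.cont σ s x h1 h2).norm, fun σ s x h1 h2 => by
    simpa using h.bd σ s x h1 h2⟩

lemma Adm.bdρ {C : ℝ} {G : ℝ → ℝ → Euc d → W} (h : Adm C G) {t ρ : ℝ} (ht : 0 < t) (hρ : ρ ∈ Ioo (0:ℝ) 1) (x : Euc d) :
    ‖G (t * ρ) (t * (1 - ρ)) x‖ ≤ C * (1 + t) * t⁻¹ * wt ρ := by
  have h1 : 0 < 1 - ρ := by linarith [hρ.2]
  refine (h.bd _ _ x (mul_pos ht hρ.1) (mul_pos ht h1)).trans_eq ?_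
  unfold wt
  rw [Real.sqrt_mul ht.le, Real.sqrt_mul ht.le]
  have : Real.sqrt t * Real.sqrt ρ * (Real.sqrt t * Real.sqrt (1 - ρ)) = t * (Real.sqrt ρ * Real.sqrt (1 - ρ)) := by
    linear_combination (Real.sqrt ρ * Real.sqrt (1 - ρ)) * (Real.mul_self_sqrt ht.le)
  rw [this, mul_inv]; ring

lemma Adm.contρ {C : ℝ} {G : ℝ → ℝ → Euc d → W} (h : Adm C G) {t : ℝ} (ht : 0 < t) (x : Euc d) :
    ContinuousOn (fun ρ => G (t * ρ) (t * (1 - ρ)) x) (Ioo 0 1) := fun ρ hρ => by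
  have h1 : 0 < 1 - ρ := by linarith [hρ.2]
  refine (ContinuousAt.comp (f := fun ρ : ℝ => (t * ρ, t * (1 - ρ), x)) (g := fun p : ℝ × ℝ × Euc d => G p.1 p.2.1 p.2.2)
    (h.cont _ _ x (mul_pos ht hρ.1) (mul_pos ht h1)) (by fun_prop)).continuousWithinAt

lemma Adm.intρ {C : ℝ} {G : ℝ → ℝ → Euc d → W} (h : Adm C G) {t : ℝ} (ht : 0 < t) (x : Euc d) :
    IntegrableOn (fun ρ => G (t * ρ) (t * (1 - ρ)) x) (Ioo 0 1) := by
  refine Integrable.mono' (wt_int1.const_mul (C * (1 + t) * t⁻¹)) ((h.contρ ht x).aestronglyMeasurable measurableSet_Ioo) ?_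
  exact (ae_restrict_iff' measurableSet_Ioo).2 (Eventually.of_forall fun s hs => h.bdρ ht hs x)

lemma Jd_norm_le {C : ℝ} {G : ℝ → ℝ → Euc d → W} (h : Adm C G) {t : ℝ} (ht : 0 < t) (x : Euc d) :
    ‖Jd G t x‖ ≤ C * (1 + t) * W0 := by
  unfold Jd
  rw [norm_smul, Real.norm_of_nonneg ht.le]
  have : ‖∫ ρ in Ioo (0:ℝ) 1, G (t * ρ) (t * (1 - ρ)) x‖ ≤ ∫ ρ in Ioo (0:ℝ) 1, C * (1 + t) * t⁻¹ * wt ρ := by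
    refine norm_integral_le_of_norm_le (wt_int1.const_mul (C * (1 + t) * t⁻¹)) ?_
    exact (ae_restrict_iff' measurableSet_Ioo).2 (Eventually.of_forall fun s hs => h.bdρ ht hs x)
  rw [integral_const_mul] at this
  calc _ ≤ t * (C * (1 + t) * t⁻¹ * W0) := mul_le_mul_of_nonneg_left this ht.le
    _ = _ := by field_simp

lemma Jd_cont {C : ℝ} {G : ℝ → ℝ → Euc d → W} (h : Adm C G) {t : ℝ} (ht : 0 < t) (x : Euc d) :
    ContinuousAt (fun p : ℝ × Euc d => Jd G p.1 p.2) (t, x) := by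
  unfold Jd
  refine ContinuousAt.smul (by fun_prop) ?_
  have hev : ∀ᶠ p : ℝ × Euc d in 𝓝 (t, x), p.1 ∈ Ioo (t/2) (2*t) :=
    continuousAt_fst.eventually (Ioo_mem_nhds (by simp; linarith) (by simp; linarith))
  refine continuousAt_of_dominated (bound := fun ρ => C * (1 + 2 * t) * (t/2)⁻¹ * wt ρ) ?_ ?_ ?_ ?_
  · filter_upwards [hev] with p hp
    exact (h.contρ (by linarith [hp.1]) p.2).aestronglyMeasurable measurableSet_Ioo
  · filter_upwards [hev] with p hp
    refine (ae_restrict_iff' measurableSet_Ioo).2 (Eventually.of_forall fun s hs => ?_)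
    refine (h.bdρ (by linarith [hp.1]) hs p.2).trans ?_
    have hC := h.Cn
    have h1 := hp.1
    have h2 := hp.2
    have : 0 < p.1 := by linarith
    refine mul_le_mul_of_nonneg_right ?_ (by unfold wt; positivity)
    gcongr
  · exact wt_int1.const_mul _
  · refine (ae_restrict_iff' measurableSet_Ioo).2 (Eventually.of_forall fun ρ hρ => ?_)
    have h1 : 0 < 1 - ρ := by linarith [hρ.2]
    exact ContinuousAt.comp (f := fun p : ℝ × Euc d => (p.1 * ρ, p.1 * (1 - ρ), p.2)) (g := fun p : ℝ × ℝ × Euc d => G p.1 p.2.1 p.2.2)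
      (h.cont _ _ x (mul_pos ht hρ.1) (mul_pos ht h1)) (by fun_prop)

lemma Jd_fderiv {C C' : ℝ} {G : ℝ → ℝ → Euc d → W} {G' : ℝ → ℝ → Euc d → Euc d →L[ℝ] W} (h : Adm C G) (h' : Adm C' G')
    (hd : ∀ σ s x, 0 < σ → 0 < s → HasFDerivAt (G σ s) (G' σ s x) x) {t : ℝ} (ht : 0 < t) (x : Euc d) :
    HasFDerivAt (Jd G t) (Jd G' t x) x := by
  unfold Jd
  refine HasFDerivAt.const_smul ?_ t
  refine hasFDerivAt_integral_of_dominated_of_fderiv_le (𝕜 := ℝ) (F := fun y ρ => G (t * ρ) (t * (1 - ρ)) y) (F' := fun y ρ => G' (t * ρ) (t * (1 - ρ)) y) (s := univ) (bound := fun ρ => C' * (1 + t) * t⁻¹ * wt ρ) univ_mem ?_ ?_ ?_ ?_ ?_ ?_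
  · exact Eventually.of_forall fun y => (h.contρ ht y).aestronglyMeasurable measurableSet_Ioo
  · exact h.intρ ht x
  · exact (h'.contρ ht x).aestronglyMeasurable measurableSet_Ioo
  · exact (ae_restrict_iff' measurableSet_Ioo).2 (Eventually.of_forall fun s hs y _ => h'.bdρ ht hs y)
  · exact wt_int1.const_mul _
  · refine (ae_restrict_iff' measurableSet_Ioo).2 (Eventually.of_forall fun ρ hρ y _ => ?_)
    have h1 : 0 < 1 - ρ := by linarith [hρ.2]
    exact hd _ _ y (mul_pos ht hρ.1) (mul_pos ht h1)

lemma Jd_eq (G : ℝ → ℝ → Euc d → W) {t : ℝ} (ht : 0 < t) (x : Euc d) :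
    Jd G t x = ∫ s in Ioo 0 t, G (t - s) s x := by
  have := intervalIntegral.smul_integral_comp_sub_mul (fun s => G (t - s) s x) t t (a := 0) (b := 1)
  rw [intervalIntegral.integral_of_le zero_le_one, intervalIntegral.integral_of_le (by simp [ht.le]), integral_Ioc_eq_integral_Ioo,
    integral_Ioc_eq_integral_Ioo] at this
  simp only [mul_one, sub_self, mul_zero, sub_zero] at this
  rw [← this]
  unfold Jd
  congr 2
  ext ρ
  congr 1 <;> ring

lemma Adm.ints {C : ℝ} {G : ℝ → ℝ → Euc d → W} (h : Adm C G) (t : ℝ) (x : Euc d) :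
    IntegrableOn (fun s => G (t - s) s x) (Ioo 0 t) := by
  refine Integrable.mono' ((wt_intble t).const_mul (C * (1 + t))) ?_ ?_
  · refine ContinuousOn.aestronglyMeasurable (fun s hs => ?_) measurableSet_Ioo
    exact (ContinuousAt.comp (f := fun s : ℝ => (t - s, s, x)) (g := fun p : ℝ × ℝ × Euc d => G p.1 p.2.1 p.2.2)
      (h.cont _ _ x (by linarith [hs.2]) hs.1) (by fun_prop)).continuousWithinAt
  · refine (ae_restrict_iff' measurableSet_Ioo).2 (Eventually.of_forall fun s hs => ?_)
    refine (h.bd (t - s) s x (by linarith [hs.2]) hs.1).trans_eq ?_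
    congr 2; ring
end
end

section
open MeasureTheory Metric Set Filter
open scoped Topology RealInnerProductSpace NNReal Pointwise
set_option linter.unusedVariables false
set_option linter.unusedSectionVars false

section
variable {d : ℕ}

lemma tri_integrable {C : ℝ} {G : ℝ → ℝ → Euc d → ℝ} (h : Adm C G) (t : ℝ) (x : Euc d) :
    Integrable (fun p : ℝ × ℝ => ({p : ℝ × ℝ | 0 < p.1 ∧ p.1 < p.2 ∧ p.2 < t}.indicator fun p => G (p.2 - p.1) p.1 x) p)
      (volume.prod volume) := by
  set T : Set (ℝ × ℝ) := {p : ℝ × ℝ | 0 < p.1 ∧ p.1 < p.2 ∧ p.2 < t}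
  have hTo : IsOpen T := by
    have h1 : IsOpen {p : ℝ × ℝ | 0 < p.1} := isOpen_lt continuous_const continuous_fst
    have h2 : IsOpen {p : ℝ × ℝ | p.1 < p.2} := isOpen_lt continuous_fst continuous_snd
    have h3 : IsOpen {p : ℝ × ℝ | p.2 < t} := isOpen_lt continuous_snd continuous_const
    exact h1.inter (h2.inter h3)
  have hm : AEStronglyMeasurable (T.indicator fun p : ℝ × ℝ => G (p.2 - p.1) p.1 x) (volume.prod volume) := by
    rw [aestronglyMeasurable_indicator_iff hTo.measurableSet]
    refine ContinuousOn.aestronglyMeasurable (fun p hp => ?_) hTo.measurableSet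
    exact (ContinuousAt.comp (f := fun p : ℝ × ℝ => (p.2 - p.1, p.1, x)) (g := fun p : ℝ × ℝ × Euc d => G p.1 p.2.1 p.2.2)
      (h.cont _ _ x (by linarith [hp.2.1]) hp.1) (by fun_prop)).continuousWithinAt
  have hs : ∀ r : ℝ, (fun s => T.indicator (fun p : ℝ × ℝ => G (p.2 - p.1) p.1 x) (s, r)) =
      if r < t then (Ioo 0 r).indicator (fun s => G (r - s) s x) else 0 := by
    intro r
    ext s
    split_ifs with hr
    · by_cases hs : s ∈ Ioo 0 r
      · rw [indicator_of_mem hs, indicator_of_mem (show (s, r) ∈ T from ⟨hs.1, hs.2, hr⟩)]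
      · rw [indicator_of_notMem hs, indicator_of_notMem (fun h => hs ⟨h.1, h.2.1⟩)]
    · rw [indicator_of_notMem (fun h => hr h.2.2)]; rfl
  rw [integrable_prod_iff' hm]
  constructor
  · refine Eventually.of_forall fun r => ?_
    rw [hs r]
    split_ifs with hr
    · exact (integrable_indicator_iff measurableSet_Ioo).2 (h.ints r x)
    · exact integrable_zero _ _ _
  · have hb : ∀ r : ℝ, ‖∫ s, ‖T.indicator (fun p : ℝ × ℝ => G (p.2 - p.1) p.1 x) (s, r)‖‖ ≤ (Ioo 0 t).indicator (fun _ => C * (1 + t) * W0) r := by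
      intro r
      rw [Real.norm_of_nonneg (integral_nonneg fun _ => norm_nonneg _)]
      by_cases hr : r ∈ Ioo 0 t
      · rw [indicator_of_mem hr]
        have e1 : (fun s => ‖T.indicator (fun p : ℝ × ℝ => G (p.2 - p.1) p.1 x) (s, r)‖) = (Ioo 0 r).indicator (fun s => ‖G (r - s) s x‖) := by
          ext s
          have := congrFun (hs r) s
          rw [if_pos hr.2] at this
          rw [this, norm_indicator_eq_indicator_norm]
        rw [e1, integral_indicator measurableSet_Ioo, ← Jd_eq (fun σ s x => ‖G σ s x‖) hr.1]
        refine (le_abs_self _).trans ((Jd_norm_le h.norm hr.1 x).trans ?_)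
        have := h.Cn
        have := W0_nonneg
        have := hr.2
        gcongr
      · rw [indicator_of_notMem hr]
        have e1 : (fun s => ‖T.indicator (fun p : ℝ × ℝ => G (p.2 - p.1) p.1 x) (s, r)‖) = fun s => 0 := by
          ext s
          rw [indicator_of_notMem, norm_zero]
          exact fun h => hr ⟨h.1.trans h.2.1, h.2.2⟩
        rw [e1]; simp
    refine Integrable.mono' (g := (Ioo 0 t).indicator (fun _ => C * (1 + t) * W0)) ?_ ?_ (Eventually.of_forall hb)
    · rw [integrable_indicator_iff measurableSet_Ioo]
      exact integrableOn_const (by simp)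
    · exact hm.norm.prod_swap.integral_prod_right'

lemma Jd_int {C0 C M : ℝ} {G0 Gt : ℝ → ℝ → Euc d → ℝ} {h : ℝ → Euc d → ℝ} (x : Euc d) (a0 : Adm C0 G0) (at' : Adm C Gt)
    (hh : SrcB h M) (hd : ∀ σ s, 0 < σ → 0 < s → HasDerivAt (fun σ => G0 σ s x) (Gt σ s x) σ)
    (hc : ∀ s, 0 < s → ContinuousAt (fun σ => G0 σ s x) 0) (hz : ∀ s, 0 < s → G0 0 s x = h s x) {t : ℝ} (ht : 0 < t) :
    Jd G0 t x = ∫ r in Ioo 0 t, (h r x + Jd Gt r x) := by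
  have hM : 0 ≤ M := (abs_nonneg _).trans (hh.bd 1 x one_pos)
  have hT := tri_integrable at' t x
  set T : Set (ℝ × ℝ) := {p : ℝ × ℝ | 0 < p.1 ∧ p.1 < p.2 ∧ p.2 < t} with hTdef
  have hsw := integral_integral_swap (f := fun s r => T.indicator (fun p : ℝ × ℝ => Gt (p.2 - p.1) p.1 x) (s, r)) hT
  have hih : IntegrableOn (fun r => h r x) (Ioo 0 t) := by
    refine Integrable.mono' (g := fun _ => M) (integrableOn_const (by simp)) ?_ ?_
    · refine ContinuousOn.aestronglyMeasurable (fun s hs => ?_) measurableSet_Ioo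
      exact (ContinuousAt.comp (f := fun s : ℝ => (s, x)) (g := fun p : ℝ × Euc d => h p.1 p.2) (hh.contAt hs.1 x) (by fun_prop)).continuousWithinAt
    · exact (ae_restrict_iff' measurableSet_Ioo).2 (Eventually.of_forall fun s hs => hh.bd s x hs.1)
  have hR : ∀ r, (∫ s, T.indicator (fun p : ℝ × ℝ => Gt (p.2 - p.1) p.1 x) (s, r)) = (Ioo 0 t).indicator (fun r => Jd Gt r x) r := by
    intro r
    by_cases hr : r ∈ Ioo 0 t
    · rw [indicator_of_mem hr, Jd_eq _ hr.1, ← integral_indicator measurableSet_Ioo]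
      congr 1; ext s
      by_cases hs : s ∈ Ioo 0 r
      · rw [indicator_of_mem hs, indicator_of_mem (show (s, r) ∈ T from ⟨hs.1, hs.2, hr.2⟩)]
      · rw [indicator_of_notMem hs, indicator_of_notMem (fun h => hs ⟨h.1, h.2.1⟩)]
    · rw [indicator_of_notMem hr]
      have : ∀ s, T.indicator (fun p : ℝ × ℝ => Gt (p.2 - p.1) p.1 x) (s, r) = 0 := fun s => by
        rw [indicator_of_notMem]; exact fun h => hr ⟨h.1.trans h.2.1, h.2.2⟩
      simp [this]
  have hL : ∀ s, (∫ r, T.indicator (fun p : ℝ × ℝ => Gt (p.2 - p.1) p.1 x) (s, r)) = (Ioo 0 t).indicator (fun s => G0 (t - s) s x - h s x) s := by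
    intro s
    by_cases hs : s ∈ Ioo 0 t
    · rw [indicator_of_mem hs, ← hz s hs.1]
      have e1 : (fun r => T.indicator (fun p : ℝ × ℝ => Gt (p.2 - p.1) p.1 x) (s, r)) = (Ioo s t).indicator (fun r => Gt (r - s) s x) := by
        ext r
        by_cases hr : r ∈ Ioo s t
        · rw [indicator_of_mem hr, indicator_of_mem (show (s, r) ∈ T from ⟨hs.1, hr.1, hr.2⟩)]
        · rw [indicator_of_notMem hr, indicator_of_notMem (fun h => hr ⟨h.2.1, h.2.2⟩)]
      rw [e1, integral_indicator measurableSet_Ioo, ← integral_Ioc_eq_integral_Ioo, ← intervalIntegral.integral_of_le hs.2.le]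
      have := intervalIntegral.integral_eq_sub_of_hasDerivAt_of_le (f := fun r => G0 (r - s) s x) (f' := fun r => Gt (r - s) s x) hs.2.le ?_ ?_ ?_
      · rw [this]; simp
      · intro r hr
        rcases eq_or_lt_of_le hr.1 with h | h
        · refine ContinuousAt.continuousWithinAt ?_
          refine ContinuousAt.comp (f := fun r : ℝ => r - s) (g := fun σ => G0 σ s x) ?_ (by fun_prop)
          rw [← h, sub_self]; exact hc s hs.1
        · have := (hd (r - s) s (by linarith) hs.1).continuousAt
          exact (ContinuousAt.comp (f := fun r : ℝ => r - s) (g := fun σ => G0 σ s x) this (by fun_prop)).continuousWithinAt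
      · intro r hr
        have := hd (r - s) s (by linarith [hr.1]) hs.1
        simpa using this.comp_sub_const r s
      · rw [intervalIntegrable_iff_integrableOn_Ioo_of_le hs.2.le]
        have hi := invsqrt_intble (t - s)
        have hi2 : IntegrableOn (fun r => (Real.sqrt (r - s))⁻¹) (Ioo s t) := by
          rw [← intervalIntegrable_iff_integrableOn_Ioo_of_le hs.2.le]
          rw [← intervalIntegrable_iff_integrableOn_Ioo_of_le (by linarith [hs.2])] at hi
          simpa using hi.comp_sub_right s
        refine Integrable.mono' (hi2.const_mul (C * (1 + t) * (Real.sqrt s)⁻¹)) ?_ ?_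
        · refine ContinuousOn.aestronglyMeasurable (fun r hr => ?_) measurableSet_Ioo
          exact (ContinuousAt.comp (f := fun r : ℝ => (r - s, s, x)) (g := fun p : ℝ × ℝ × Euc d => Gt p.1 p.2.1 p.2.2)
            (at'.cont _ _ x (by linarith [hr.1]) hs.1) (by fun_prop)).continuousWithinAt
        · refine (ae_restrict_iff' measurableSet_Ioo).2 (Eventually.of_forall fun r hr => ?_)
          refine (at'.bd (r - s) s x (by linarith [hr.1]) hs.1).trans ?_
          have e2 : C * (1 + t) * (Real.sqrt s)⁻¹ * (Real.sqrt (r - s))⁻¹ = C * (1 + t) * (Real.sqrt (r - s) * Real.sqrt s)⁻¹ := by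
            rw [mul_inv]; ring
          rw [e2]
          have hr2 := hr.2
          have := at'.Cn
          refine mul_le_mul_of_nonneg_right (mul_le_mul_of_nonneg_left (by linarith) this) (by positivity)
    · rw [indicator_of_notMem hs]
      have : ∀ r, T.indicator (fun p : ℝ × ℝ => Gt (p.2 - p.1) p.1 x) (s, r) = 0 := fun r => by
        rw [indicator_of_notMem]; exact fun h => hs ⟨h.1, h.2.1.trans h.2.2⟩
      simp [this]
  simp only [hR, hL] at hsw
  rw [integral_indicator measurableSet_Ioo, integral_indicator measurableSet_Ioo, integral_sub (a0.ints t x) hih, ← Jd_eq _ ht] at hsw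
  have hiJ : IntegrableOn (fun r => Jd Gt r x) (Ioo 0 t) := by
    refine Integrable.mono' (g := fun _ => C * (1 + t) * W0) (integrableOn_const (by simp)) ?_ ?_
    · refine ContinuousOn.aestronglyMeasurable (fun s hs => ?_) measurableSet_Ioo
      exact (ContinuousAt.comp (f := fun s : ℝ => (s, x)) (g := fun p : ℝ × Euc d => Jd Gt p.1 p.2) (Jd_cont at' hs.1 x) (by fun_prop)).continuousWithinAt
    · refine (ae_restrict_iff' measurableSet_Ioo).2 (Eventually.of_forall fun s hs => (Jd_norm_le at' hs.1 x).trans ?_)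
      have := at'.Cn
      have := W0_nonneg
      have := hs.2
      gcongr
  rw [integral_add hih hiJ]
  linarith

lemma Jd_hasDerivAt {C0 C M : ℝ} {G0 Gt : ℝ → ℝ → Euc d → ℝ} {h : ℝ → Euc d → ℝ} (x : Euc d) (a0 : Adm C0 G0) (at' : Adm C Gt)
    (hh : SrcB h M) (hd : ∀ σ s, 0 < σ → 0 < s → HasDerivAt (fun σ => G0 σ s x) (Gt σ s x) σ)
    (hc : ∀ s, 0 < s → ContinuousAt (fun σ => G0 σ s x) 0) (hz : ∀ s, 0 < s → G0 0 s x = h s x) {t : ℝ} (ht : 0 < t) :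
    HasDerivAt (fun t => Jd G0 t x) (h t x + Jd Gt t x) t := by
  set q : ℝ → ℝ := fun r => h r x + Jd Gt r x
  have hM : 0 ≤ M := (abs_nonneg _).trans (hh.bd 1 x one_pos)
  have hqc : ∀ r, 0 < r → ContinuousAt q r := fun r hr =>
    (ContinuousAt.comp (f := fun s : ℝ => (s, x)) (g := fun p : ℝ × Euc d => h p.1 p.2) (hh.contAt hr x) (by fun_prop)).add
    (ContinuousAt.comp (f := fun s : ℝ => (s, x)) (g := fun p : ℝ × Euc d => Jd Gt p.1 p.2) (Jd_cont at' hr x) (by fun_prop))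
  have hqi : IntervalIntegrable q volume 0 t := by
    rw [intervalIntegrable_iff_integrableOn_Ioo_of_le ht.le]
    refine Integrable.mono' (g := fun _ => M + C * (1 + t) * W0) (integrableOn_const (by simp)) ?_ ?_
    · exact ContinuousOn.aestronglyMeasurable (fun s hs => (hqc s hs.1).continuousWithinAt) measurableSet_Ioo
    · refine (ae_restrict_iff' measurableSet_Ioo).2 (Eventually.of_forall fun s hs => (norm_add_le _ _).trans
        (add_le_add (hh.bd s x hs.1) ((Jd_norm_le at' hs.1 x).trans ?_)))
      have := at'.Cn
      have := W0_nonneg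
      have := hs.2
      gcongr
  have hco : ContinuousOn q (Ioi 0) := fun r hr => (hqc r hr).continuousWithinAt
  have := intervalIntegral.integral_hasDerivAt_right hqi
    (hco.stronglyMeasurableAtFilter isOpen_Ioi t ht) (hqc t ht)
  refine this.congr_of_eventuallyEq ?_
  filter_upwards [lt_mem_nhds ht] with r hr
  rw [Jd_int x a0 at' hh hd hc hz hr, intervalIntegral.integral_of_le hr.le, integral_Ioc_eq_integral_Ioo]
end
end

section
open MeasureTheory Metric Set Filter
open scoped Topology RealInnerProductSpace NNReal Pointwise
set_option linter.unusedVariables false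
set_option linter.unusedSectionVars false

section
variable {d : ℕ}

lemma contDiff2_of {φ : Euc d → ℝ} {A : Euc d → Euc d →L[ℝ] ℝ} {A' : Euc d → Euc d →L[ℝ] Euc d →L[ℝ] ℝ}
    (h1 : ∀ x, HasFDerivAt φ (A x) x) (h2 : ∀ x, HasFDerivAt A (A' x) x) (hc : Continuous A') : ContDiff ℝ 2 φ := by
  have e1 : fderiv ℝ φ = A := funext fun x => (h1 x).fderiv
  have e2 : fderiv ℝ A = A' := funext fun x => (h2 x).fderiv
  have hA : ContDiff ℝ 1 A := by
    rw [contDiff_one_iff_fderiv, e2]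
    exact ⟨fun x => (h2 x).differentiableAt, hc⟩
  rw [show (2 : WithTop ℕ∞) = 1 + 1 from (one_add_one_eq_two).symm, contDiff_succ_iff_fderiv, e1]
  exact ⟨fun x => (h1 x).differentiableAt, by simp, hA⟩

section
variable {W : Type*} [NormedAddCommGroup W] [NormedSpace ℝ W]

lemma contAt_add_smul {X : Type*} [TopologicalSpace X] {a b : X → W} {x : X} (c : ℝ) (ha : ContinuousAt a x) (hb : ContinuousAt b x) :
    ContinuousAt (fun y => c • a y + b y) x := (ha.const_smul c).add hb

lemma sqrt_aux {σ s : ℝ} (hσ : 0 < σ) (hs : 0 < s) :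
   1 ≤ (1 + σ + s) * (Real.sqrt σ * Real.sqrt s)⁻¹ ∧ (Real.sqrt σ)⁻¹ ≤ (1 + σ + s) * (Real.sqrt σ * Real.sqrt s)⁻¹ := by
  have ha : 0 < Real.sqrt s := Real.sqrt_pos.2 hs
  have hb : 0 < Real.sqrt σ := Real.sqrt_pos.2 hσ
  have h1 := Real.mul_self_sqrt hs.le
  have h2 := Real.mul_self_sqrt hσ.le
  constructor
  · rw [← div_eq_mul_inv, le_div_iff₀ (by positivity)]
    nlinarith [sq_nonneg (Real.sqrt s - Real.sqrt σ)]
  · rw [← div_eq_mul_inv, le_div_iff₀ (by positivity)]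
    rw [← mul_assoc, inv_mul_cancel₀ hb.ne', one_mul]
    nlinarith [sq_nonneg (Real.sqrt s - 1)]

lemma adm0 {C M : ℝ} {k : Euc d → W} (hk : GB C k) (hC : 0 ≤ C) {h : ℝ → Euc d → ℝ} (hM : 0 ≤ M) (hh : SrcB h M) :
    Adm (M * C * gI d) (fun σ s x => Ak k σ (h s) x) := by
  have := gI_nonneg (d := d)
  refine ⟨by positivity, fun σ s x hσ hs => AkC hk hh σ hs x, fun σ s x hσ hs => ?_⟩
  refine (Ak_norm_le hk (fun x => hh.bd s x hs) σ x).trans ?_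
  rw [mul_assoc (M * C * gI d)]
  exact le_mul_of_one_le_right (by positivity) (sqrt_aux hσ hs).1

lemma adm1 {C M : ℝ} {k : Euc d → W} (hk : GB C k) (hC : 0 ≤ C) {h : ℝ → Euc d → ℝ} (hM : 0 ≤ M) (hh : SrcB h M) :
    Adm (M * C * gI d) (fun σ s x => (Real.sqrt σ)⁻¹ • Ak k σ (h s) x) := by
  have := gI_nonneg (d := d)
  refine ⟨by positivity, fun σ s x hσ hs => ?_, fun σ s x hσ hs => ?_⟩
  · refine ContinuousAt.smul ?_ (AkC hk hh σ hs x)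
    refine ContinuousAt.inv₀ (by fun_prop) (Real.sqrt_pos.2 hσ).ne'
  · rw [norm_smul, Real.norm_of_nonneg (by positivity), mul_comm, mul_assoc (M * C * gI d)]
    exact mul_le_mul (Ak_norm_le hk (fun x => hh.bd s x hs) σ x) (sqrt_aux hσ hs).2 (by positivity) (by positivity)

lemma adm2 [CompleteSpace W] {C M L : ℝ} {k : Euc d → W} (hk : GB C k) (hC : 0 ≤ C) (h0 : ∫ z, k z = 0) {h : ℝ → Euc d → ℝ} (hL : 0 ≤ L) (hh : SrcB h M)
    (hl : ∀ s x y, 0 < s → |h s x - h s y| ≤ L * (1 + s) * (Real.sqrt s)⁻¹ * ‖x - y‖) :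
    Adm (L * C * gI1 d) (fun σ s x => σ⁻¹ • Ak k σ (h s) x) := by
  have := gI1_nonneg (d := d)
  refine ⟨by positivity, fun σ s x hσ hs => ?_, fun σ s x hσ hs => ?_⟩
  · refine ContinuousAt.smul ?_ (AkC hk hh σ hs x)
    refine ContinuousAt.inv₀ (by fun_prop) hσ.ne'
  · rw [norm_smul, Real.norm_of_nonneg (by positivity)]
    have h1 := Ak_lip_le hk h0 (hh.contx hs).measurable (fun x => hh.bd s x hs) (L := L * (1 + s) * (Real.sqrt s)⁻¹) (by positivity)
      (fun x y => hl s x y hs) σ x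
    have hb : 0 < Real.sqrt σ := Real.sqrt_pos.2 hσ
    have h2 : σ⁻¹ * Real.sqrt σ = (Real.sqrt σ)⁻¹ := by
      have := Real.mul_self_sqrt hσ.le
      field_simp; nlinarith
    calc _ ≤ σ⁻¹ * (L * (1 + s) * (Real.sqrt s)⁻¹ * Real.sqrt σ * C * gI1 d) := by gcongr
      _ = (L * C * gI1 d) * (1 + s) * ((σ⁻¹ * Real.sqrt σ) * (Real.sqrt s)⁻¹) := by ring
      _ = (L * C * gI1 d) * (1 + s) * (Real.sqrt σ * Real.sqrt s)⁻¹ := by rw [h2, mul_inv]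
      _ ≤ _ := by
        refine mul_le_mul_of_nonneg_right (mul_le_mul_of_nonneg_left (by linarith) (by positivity)) (by positivity)

lemma PVk_cont [CompleteSpace W] {C M L B : ℝ} {k : Euc d → W} (hk : GB C k) (hC : 0 ≤ C) (h0 : ∫ z, k z = 0)
    {g : Euc d → ℝ} {h : ℝ → Euc d → ℝ} (hg : Measurable g) (hb : ∀ x, |g x| ≤ B) (hL : 0 ≤ L) (hh : SrcB h M)
    (hl : ∀ s x y, 0 < s → |h s x - h s y| ≤ L * (1 + s) * (Real.sqrt s)⁻¹ * ‖x - y‖) {t : ℝ} (ht : 0 < t) :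
    Continuous (fun x => t⁻¹ • Ak k t g x + Jd (fun σ s x => σ⁻¹ • Ak k σ (h s) x) t x) := by
  rw [continuous_iff_continuousAt]
  intro x
  refine contAt_add_smul _ ?_ ?_
  · exact ContinuousAt.comp (f := fun x : Euc d => (t, x)) (g := fun p : ℝ × Euc d => Ak k p.1 g p.2) (Ak_continuousAt hk hg hb ht x) (by fun_prop)
  · exact ContinuousAt.comp (f := fun x : Euc d => (t, x)) (g := fun p : ℝ × Euc d => Jd (fun σ s x => σ⁻¹ • Ak k σ (h s) x) p.1 p.2)
      (Jd_cont (adm2 hk hC h0 hL hh hl) ht x) (by fun_prop)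
end

/-- the mild solution of the linear problem -/
def PV (g : Euc d → ℝ) (h : ℝ → Euc d → ℝ) (t : ℝ) (x : Euc d) : ℝ :=
  Ak gm t g x + Jd (fun σ s x => Ak gm σ (h s) x) t x

def PV1 (g : Euc d → ℝ) (h : ℝ → Euc d → ℝ) (t : ℝ) (x : Euc d) : Euc d →L[ℝ] ℝ :=
  (Real.sqrt t)⁻¹ • Ak gk1 t g x + Jd (fun σ s x => (Real.sqrt σ)⁻¹ • Ak gk1 σ (h s) x) t x

def PV2 (g : Euc d → ℝ) (h : ℝ → Euc d → ℝ) (t : ℝ) (x : Euc d) : Euc d →L[ℝ] Euc d →L[ℝ] ℝ :=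
  t⁻¹ • Ak gk2 t g x + Jd (fun σ s x => σ⁻¹ • Ak gk2 σ (h s) x) t x

lemma PV_fderiv {g : Euc d → ℝ} {h : ℝ → Euc d → ℝ} {M B : ℝ} (hg : Measurable g) (hb : ∀ x, |g x| ≤ B) (hM : 0 ≤ M) (hh : SrcB h M)
    {t : ℝ} (ht : 0 < t) (x : Euc d) : HasFDerivAt (PV g h t) (PV1 g h t x) x := by
  have h1 := Ak_hasFDerivAt gm_GB gk1_GB gm_hasFDerivAt hg hb ht x
  refine h1.add ?_
  refine Jd_fderiv (adm0 gm_GB (kC_nonneg _) hM hh) (adm1 gk1_GB (kC_nonneg _) hM hh) (fun σ s x hσ hs => ?_) ht x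
  exact Ak_hasFDerivAt gm_GB gk1_GB gm_hasFDerivAt (hh.contx hs).measurable (fun x => hh.bd s x hs) hσ x

lemma PV1_norm {g : Euc d → ℝ} {h : ℝ → Euc d → ℝ} {M B : ℝ} (hb : ∀ x, |g x| ≤ B) (hM : 0 ≤ M) (hh : SrcB h M)
    {t : ℝ} (ht : 0 < t) (x : Euc d) : ‖PV1 g h t x‖ ≤ (Real.sqrt t)⁻¹ * (B * kC d * gI d) + M * kC d * gI d * (1 + t) * W0 := by
  refine (norm_add_le _ _).trans (add_le_add ?_ (Jd_norm_le (adm1 gk1_GB (kC_nonneg _) hM hh) ht x))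
  rw [norm_smul, Real.norm_of_nonneg (by positivity)]
  exact mul_le_mul_of_nonneg_left (Ak_norm_le gk1_GB hb t x) (by positivity)

lemma PV_lip {g : Euc d → ℝ} {h : ℝ → Euc d → ℝ} {M B : ℝ} (hg : Measurable g) (hb : ∀ x, |g x| ≤ B) (hM : 0 ≤ M) (hh : SrcB h M)
    {t : ℝ} (ht : 0 < t) (x y : Euc d) : |PV g h t x - PV g h t y| ≤
      ((Real.sqrt t)⁻¹ * (B * kC d * gI d) + M * kC d * gI d * (1 + t) * W0) * ‖x - y‖ := by
  have := (convex_univ (𝕜 := ℝ) (E := Euc d)).norm_image_sub_le_of_norm_hasFDerivWithin_le (f := PV g h t) (f' := PV1 g h t)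
    (C := (Real.sqrt t)⁻¹ * (B * kC d * gI d) + M * kC d * gI d * (1 + t) * W0)
    (fun z _ => (PV_fderiv hg hb hM hh ht z).hasFDerivWithinAt) (fun z _ => PV1_norm hb hM hh ht z) (mem_univ y) (mem_univ x)
  exact this

lemma PV_cont {g : Euc d → ℝ} {h : ℝ → Euc d → ℝ} {M B : ℝ} (hg : Measurable g) (hb : ∀ x, |g x| ≤ B) (hM : 0 ≤ M) (hh : SrcB h M)
    {t : ℝ} (ht : 0 < t) (x : Euc d) : ContinuousAt (fun p : ℝ × Euc d => PV g h p.1 p.2) (t, x) :=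
  (Ak_continuousAt gm_GB hg hb ht x).add (Jd_cont (adm0 gm_GB (kC_nonneg _) hM hh) ht x)

lemma PV1_fderiv {g : Euc d → ℝ} {h : ℝ → Euc d → ℝ} {M B L : ℝ} (hg : Measurable g) (hb : ∀ x, |g x| ≤ B) (hM : 0 ≤ M) (hh : SrcB h M)
    (hL : 0 ≤ L) (hl : ∀ s x y, 0 < s → |h s x - h s y| ≤ L * (1 + s) * (Real.sqrt s)⁻¹ * ‖x - y‖)
    {t : ℝ} (ht : 0 < t) (x : Euc d) : HasFDerivAt (PV1 g h t) (PV2 g h t x) x := by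
  have key : ∀ {φ : Euc d → ℝ} {B' : ℝ} (hφ : Measurable φ) (hb' : ∀ x, |φ x| ≤ B') {τ : ℝ} (hτ : 0 < τ) (y : Euc d),
     HasFDerivAt (fun y => (Real.sqrt τ)⁻¹ • Ak gk1 τ φ y) (τ⁻¹ • Ak gk2 τ φ y) y := by
    intro φ B' hφ hb' τ hτ y
    have h1 := (Ak_hasFDerivAt gk1_GB gk2_GB gk1_hasFDerivAt hφ hb' hτ y).const_smul (Real.sqrt τ)⁻¹
    refine h1.congr_fderiv ?_
    rw [smul_smul, ← mul_inv, Real.mul_self_sqrt hτ.le]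
  refine (key hg hb ht x).add ?_
  refine Jd_fderiv (adm1 gk1_GB (kC_nonneg _) hM hh) (adm2 gk2_GB (kC_nonneg _) gk2_mean hL hh hl) (fun σ s x hσ hs => ?_) ht x
  exact key (hh.contx hs).measurable (fun x => hh.bd s x hs) hσ x

lemma PV2_cont {g : Euc d → ℝ} {h : ℝ → Euc d → ℝ} {M B L : ℝ} (hg : Measurable g) (hb : ∀ x, |g x| ≤ B) (hM : 0 ≤ M) (hh : SrcB h M)
    (hL : 0 ≤ L) (hl : ∀ s x y, 0 < s → |h s x - h s y| ≤ L * (1 + s) * (Real.sqrt s)⁻¹ * ‖x - y‖)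
    {t : ℝ} (ht : 0 < t) : Continuous (PV2 g h t) :=
  PVk_cont gk2_GB (kC_nonneg _) gk2_mean hg hb hL hh hl ht

lemma Jd_trace {h : ℝ → Euc d → ℝ} {M L : ℝ} (hM : 0 ≤ M) (hh : SrcB h M)
    (hL : 0 ≤ L) (hl : ∀ s x y, 0 < s → |h s x - h s y| ≤ L * (1 + s) * (Real.sqrt s)⁻¹ * ‖x - y‖)
    {t : ℝ} (ht : 0 < t) (x : Euc d) :
    ∑ i, (Jd (fun σ s x => σ⁻¹ • Ak gk2 σ (h s) x) t x) (EuclideanSpace.single i 1) (EuclideanSpace.single i 1) =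
      Jd (fun σ s x => σ⁻¹ • Ak gtr σ (h s) x) t x := by
  have hi := (adm2 gk2_GB (kC_nonneg _) gk2_mean hL hh hl).intρ ht x
  have h1 : ∀ i : Fin d, (Jd (fun σ s x => σ⁻¹ • Ak gk2 σ (h s) x) t x) (EuclideanSpace.single i 1) (EuclideanSpace.single i 1) =
      t * ∫ ρ in Ioo (0:ℝ) 1, ((t * ρ)⁻¹ • Ak gk2 (t * ρ) (h (t * (1 - ρ))) x) (EuclideanSpace.single i 1) (EuclideanSpace.single i 1) := fun i => by
    unfold Jd
    rw [_root_.smul_apply, _root_.smul_apply,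
      ContinuousLinearMap.integral_apply hi, ContinuousLinearMap.integral_apply (hi.apply_continuousLinearMap _)]
    rfl
  rw [Finset.sum_congr rfl fun i _ => h1 i, ← Finset.mul_sum, ← integral_finsetSum]
  · unfold Jd
    rw [smul_eq_mul]
    congr 1
    refine setIntegral_congr_fun measurableSet_Ioo fun ρ hρ => ?_
    have h1 : 0 < 1 - ρ := by linarith [hρ.2]
    simp only [_root_.smul_apply]
    rw [← Finset.smul_sum, Ak_trace (hh.contx (mul_pos ht h1)).measurable (fun x => hh.bd _ x (mul_pos ht h1))]
  · intro i _
    exact (hi.apply_continuousLinearMap _).apply_continuousLinearMap _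

theorem PV_sol {g : Euc d → ℝ} {h : ℝ → Euc d → ℝ} {M B L : ℝ} (hg : Measurable g) (hb : ∀ x, |g x| ≤ B) (hM : 0 ≤ M) (hh : SrcB h M)
    (hL : 0 ≤ L) (hl : ∀ s x y, 0 < s → |h s x - h s y| ≤ L * (1 + s) * (Real.sqrt s)⁻¹ * ‖x - y‖)
    {t : ℝ} (ht : 0 < t) : ContDiff ℝ 2 (PV g h t) ∧ ∀ x, HasDerivAt (fun s => PV g h s x) (lap (PV g h t) x + h t x) t := by
  have f1 := fun x => PV_fderiv hg hb hM hh ht x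
  have f2 := fun x => PV1_fderiv hg hb hM hh hL hl ht x
  refine ⟨contDiff2_of f1 f2 (PV2_cont hg hb hM hh hL hl ht), fun x => ?_⟩
  rw [lap_eq_of_hasFDerivAt (Eventually.of_forall f1) (f2 x)]
  have e1 : ∑ i, PV2 g h t x (EuclideanSpace.single i 1) (EuclideanSpace.single i 1) =
     t⁻¹ * Ak gtr t g x + Jd (fun σ s x => σ⁻¹ • Ak gtr σ (h s) x) t x := by
    rw [← Jd_trace hM hh hL hl ht x, ← Ak_trace hg hb, Finset.mul_sum, ← Finset.sum_add_distrib]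
    rfl
  rw [e1]
  have d1 := Pt_hasDerivAt hg hb ht x
  have d2 := Jd_hasDerivAt (G0 := fun σ s x => Ak gm σ (h s) x) (Gt := fun σ s x => σ⁻¹ • Ak gtr σ (h s) x) x (adm0 gm_GB (kC_nonneg _) hM hh)
    (adm2 gtr_GB (kC_nonneg _) gtr_mean hL hh hl) hh
    (fun σ s hσ hs => Pt_hasDerivAt (hh.contx hs).measurable (fun x => hh.bd s x hs) hσ x)
    (fun s hs => ContinuousAt.comp (f := fun σ : ℝ => (σ, s, x)) (g := fun p : ℝ × ℝ × Euc d => Ak gm p.1 (h p.2.1) p.2.2) (AkC gm_GB hh 0 hs x) (by fun_prop))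
    (fun s hs => by simp only [Ak, Real.sqrt_zero, zero_smul, sub_zero]; rw [integral_smul, gm_integral]; simp) ht
  refine (d1.add d2).congr_deriv ?_
  ring
end
end

section
open MeasureTheory Metric Set Filter
open scoped Topology RealInnerProductSpace NNReal Pointwise BoundedContinuousFunction
set_option linter.unusedVariables false
set_option linter.unusedSectionVars false

section
variable {d : ℕ}

/-- reaction hypotheses -/
structure Rx (F : Euc d → ℝ → ℝ) (M : ℝ) : Prop where
  Mn : 0 ≤ M
  lip : ∀ x x' : Euc d, ∀ u u' : ℝ, u ∈ Icc (0:ℝ) 1 → u' ∈ Icc (0:ℝ) 1 → |F x u - F x' u'| ≤ M * (‖x - x'‖ + |u - u'|)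
  nonneg : ∀ x u, u ∈ Icc (0:ℝ) 1 → 0 ≤ F x u
  z0 : ∀ x, F x 0 = 0
  z1 : ∀ x, F x 1 = 0

def cl (v : ℝ) : ℝ := max 0 (min v 1)
lemma cl_mem (v : ℝ) : cl v ∈ Icc (0:ℝ) 1 := ⟨le_max_left _ _, max_le zero_le_one (min_le_right _ _)⟩
lemma cl_lip (v w : ℝ) : |cl v - cl w| ≤ |v - w| := by
  unfold cl
  have h1 := abs_max_sub_max_le_abs (min v 1) (min w 1) 0
  have h2 := abs_min_sub_min_le_max v 1 w 1
  rw [max_comm 0, max_comm 0]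
  refine h1.trans (h2.trans ?_)
  simp
lemma cl_of_mem {v : ℝ} (h : v ∈ Icc (0:ℝ) 1) : cl v = v := by
  unfold cl; rw [min_eq_left h.2, max_eq_right h.1]
lemma cl_cont : Continuous cl := by unfold cl; fun_prop

lemma Rx.clip {F : Euc d → ℝ → ℝ} {M : ℝ} (hF : Rx F M) (x y : Euc d) (v w : ℝ) :
    |F x (cl v) - F y (cl w)| ≤ M * (‖x - y‖ + |v - w|) :=
  (hF.lip _ _ _ _ (cl_mem v) (cl_mem w)).trans (mul_le_mul_of_nonneg_left (by linarith [cl_lip v w]) hF.Mn)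

lemma Rx.bd {F : Euc d → ℝ → ℝ} {M : ℝ} (hF : Rx F M) (x : Euc d) {v : ℝ} (hv : v ∈ Icc (0:ℝ) 1) : |F x v| ≤ M := by
  have := hF.lip x x v 0 hv (by simp)
  rw [hF.z0] at this
  simp only [sub_zero, sub_self, norm_zero, zero_add, abs_of_nonneg hv.1] at this
  nlinarith [hF.Mn, hv.2, hv.1]

lemma Rx.ccont {F : Euc d → ℝ → ℝ} {M : ℝ} (hF : Rx F M) : Continuous (fun p : Euc d × ℝ => F p.1 (cl p.2)) := by
  rw [continuous_iff_continuousAt]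
  rintro ⟨x, v⟩
  rw [ContinuousAt, tendsto_iff_norm_sub_tendsto_zero]
  have h1 : Tendsto (fun p : Euc d × ℝ => M * (‖p.1 - x‖ + |p.2 - v|)) (𝓝 (x, v)) (𝓝 0) := by
    have : Continuous (fun p : Euc d × ℝ => M * (‖p.1 - x‖ + |p.2 - v|)) := by fun_prop
    have := this.tendsto (x, v)
    simpa using this
  exact squeeze_zero (fun _ => norm_nonneg _) (fun p => hF.clip _ _ _ _) h1

lemma Pt_abs_le {B : ℝ} {φ : Euc d → ℝ} (hb : ∀ x, |φ x| ≤ B) (τ : ℝ) (x : Euc d) : |Ak gm τ φ x| ≤ B := by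
  have h1 : ‖Ak gm τ φ x‖ ≤ ∫ z : Euc d, B * gm z := by
    unfold Ak
    refine norm_integral_le_of_norm_le (gm_GB.integrable.const_mul B) (Eventually.of_forall fun z => ?_)
    rw [norm_smul, Real.norm_of_nonneg (gm_pos z).le]
    exact mul_le_mul_of_nonneg_right (hb _) (gm_pos z).le
  rw [integral_const_mul, gm_integral, mul_one] at h1
  exact h1

lemma Pt_sub {B B' : ℝ} {φ ψ : Euc d → ℝ} (hφ : Measurable φ) (hψ : Measurable ψ) (hb : ∀ x, |φ x| ≤ B) (hb' : ∀ x, |ψ x| ≤ B') (τ : ℝ) (x : Euc d) :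
    Ak gm τ φ x - Ak gm τ ψ x = Ak gm τ (fun y => φ y - ψ y) x := by
  unfold Ak
  rw [← integral_sub (Ak_integrable gm_GB hφ hb τ x) (Ak_integrable gm_GB hψ hb' τ x)]
  simp only [sub_smul]

lemma Jd0_le {h : ℝ → Euc d → ℝ} {M : ℝ} (hM : 0 ≤ M) (hh : SrcB h M) {t : ℝ} (ht : 0 < t) (x : Euc d) :
    |Jd (fun σ s x => Ak gm σ (h s) x) t x| ≤ M * t := by
  rw [Jd_eq _ ht]
  have := norm_setIntegral_le_of_norm_le_const (μ := volume) (s := Ioo 0 t) (C := M) (f := fun s => Ak gm (t - s) (h s) x) (by simp)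
    (fun s hs => Pt_abs_le (fun x => hh.bd s x hs.1) _ _)
  simpa [ht.le] using this

lemma Jd0_diff {h h' : ℝ → Euc d → ℝ} {M : ℝ} (hM : 0 ≤ M) (hh : SrcB h M) (hh' : SrcB h' M) {D : ℝ → ℝ} {t : ℝ} (ht : 0 < t)
    (hD : IntegrableOn D (Ioo 0 t)) (hle : ∀ s ∈ Ioo 0 t, ∀ x, |h s x - h' s x| ≤ D s) (x : Euc d) :
    |Jd (fun σ s x => Ak gm σ (h s) x) t x - Jd (fun σ s x => Ak gm σ (h' s) x) t x| ≤ ∫ s in Ioo 0 t, D s := by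
  rw [Jd_eq _ ht, Jd_eq _ ht, ← integral_sub ((adm0 gm_GB (kC_nonneg _) hM hh).ints t x) ((adm0 gm_GB (kC_nonneg _) hM hh').ints t x), ← Real.norm_eq_abs]
  refine norm_integral_le_of_norm_le hD ((ae_restrict_iff' measurableSet_Ioo).2 (Eventually.of_forall fun s hs => ?_))
  rw [Pt_sub (hh.contx hs.1).measurable (hh'.contx hs.1).measurable (fun x => hh.bd s x hs.1) (fun x => hh'.bd s x hs.1), Real.norm_eq_abs]
  exact Pt_abs_le (hle s hs) _ _

def W1 : ℝ := ∫ ρ in Ioo (0:ℝ) 1, (Real.sqrt ρ)⁻¹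
lemma W1_nonneg : 0 ≤ W1 := integral_nonneg fun ρ => by positivity

lemma Jd1_le {h : ℝ → Euc d → ℝ} {M : ℝ} (hM : 0 ≤ M) (hh : SrcB h M) {t : ℝ} (ht : 0 < t) (x : Euc d) :
    ‖Jd (fun σ s x => (Real.sqrt σ)⁻¹ • Ak gk1 σ (h s) x) t x‖ ≤ M * kC d * gI d * W1 * Real.sqrt t := by
  unfold Jd
  rw [norm_smul, Real.norm_of_nonneg ht.le]
  have hi : IntegrableOn (fun ρ : ℝ => (Real.sqrt t)⁻¹ * (M * kC d * gI d) * (Real.sqrt ρ)⁻¹) (Ioo 0 1) := (invsqrt_intble 1).const_mul _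
  have := norm_integral_le_of_norm_le (f := fun ρ => (Real.sqrt (t * ρ))⁻¹ • Ak gk1 (t * ρ) (h (t * (1 - ρ))) x) hi
    ((ae_restrict_iff' measurableSet_Ioo).2 (Eventually.of_forall fun ρ hρ => by
      have h1 : 0 < 1 - ρ := by linarith [hρ.2]
      rw [norm_smul, Real.norm_of_nonneg (by positivity), Real.sqrt_mul ht.le, mul_inv]
      have := Ak_norm_le gk1_GB (fun x => hh.bd (t * (1 - ρ)) x (mul_pos ht h1)) (t * ρ) x
      calc _ ≤ (Real.sqrt t)⁻¹ * (Real.sqrt ρ)⁻¹ * (M * kC d * gI d) := by gcongr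
        _ = _ := by ring))
  rw [integral_const_mul] at this
  have hs : 0 < Real.sqrt t := Real.sqrt_pos.2 ht
  calc _ ≤ t * ((Real.sqrt t)⁻¹ * (M * kC d * gI d) * W1) := mul_le_mul_of_nonneg_left this ht.le
    _ = (t * (Real.sqrt t)⁻¹) * (M * kC d * gI d * W1) := by ring
    _ = Real.sqrt t * (M * kC d * gI d * W1) := by
      congr 1; field_simp; rw [Real.sq_sqrt ht.le]
    _ = _ := by ring

/-- Lipschitz constant at time `t` -/
def lipC (d : ℕ) (M t : ℝ) : ℝ := (Real.sqrt t)⁻¹ * (kC d * gI d) + M * kC d * gI d * W1 * Real.sqrt t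

lemma PV_lip' {g : Euc d → ℝ} {h : ℝ → Euc d → ℝ} {M : ℝ} (hg : Measurable g) (hb : ∀ x, |g x| ≤ 1) (hM : 0 ≤ M) (hh : SrcB h M)
    {t : ℝ} (ht : 0 < t) (x y : Euc d) : |PV g h t x - PV g h t y| ≤ lipC d M t * ‖x - y‖ := by
  refine (convex_univ (𝕜 := ℝ) (E := Euc d)).norm_image_sub_le_of_norm_hasFDerivWithin_le (f := PV g h t) (f' := PV1 g h t)
    (fun z _ => (PV_fderiv hg hb hM hh ht z).hasFDerivWithinAt) (fun z _ => ?_) (mem_univ y) (mem_univ x)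
  refine (norm_add_le _ _).trans (add_le_add ?_ (Jd1_le hM hh ht z))
  rw [norm_smul, Real.norm_of_nonneg (by positivity)]
  have := Ak_norm_le gk1_GB hb t z
  rw [one_mul] at this
  exact mul_le_mul_of_nonneg_left this (by positivity)

lemma Pt_lim {B : ℝ} {φ : Euc d → ℝ} (hφ : Measurable φ) (hb : ∀ x, |φ x| ≤ B) {x₀ : Euc d} (hc : ContinuousAt φ x₀) :
    Tendsto (fun p : ℝ × Euc d => Ak gm p.1 φ p.2) ((𝓝[>] (0:ℝ)) ×ˢ 𝓝 x₀) (𝓝 (φ x₀)) := by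
  have hB : 0 ≤ B := (abs_nonneg _).trans (hb x₀)
  have h1 : φ x₀ = ∫ z : Euc d, φ x₀ • gm z := by rw [integral_smul, gm_integral]; simp
  have h2 : Tendsto (fun p : ℝ × Euc d => Ak gm p.1 φ p.2) ((𝓝 (0:ℝ)) ×ˢ 𝓝 x₀) (𝓝 (φ x₀)) := by
    rw [h1]
    unfold Ak
    rw [← nhds_prod_eq]
    refine tendsto_integral_filter_of_dominated_convergence (fun z => B * gm z) ?_ ?_ (gm_GB.integrable.const_mul B) ?_
    · exact Eventually.of_forall fun p => (Ak_integrable gm_GB hφ hb _ _).aestronglyMeasurable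
    · refine Eventually.of_forall fun p => Eventually.of_forall fun z => ?_
      rw [norm_smul, Real.norm_of_nonneg (gm_pos z).le]
      exact mul_le_mul_of_nonneg_right (hb _) (gm_pos z).le
    · refine Eventually.of_forall fun z => Tendsto.smul_const ?_ _
      have h3 : Continuous (fun p : ℝ × Euc d => p.2 - Real.sqrt p.1 • z) := by fun_prop
      have h4 := h3.tendsto (0, x₀)
      simp only [Real.sqrt_zero, zero_smul, sub_zero] at h4
      exact hc.tendsto.comp h4
  exact h2.mono_left (Filter.prod_mono_left _ nhdsWithin_le_nhds)
end
end

section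
open MeasureTheory Metric Set Filter
open scoped Topology RealInnerProductSpace NNReal Pointwise BoundedContinuousFunction
set_option linter.unusedVariables false
set_option linter.unusedSectionVars false

section
variable {d : ℕ}

/-- the open upper half space -/
abbrev UX (d : ℕ) : Type := {p : ℝ × Euc d // 0 < p.1}

open Classical in
def uOf (K : ℝ) (b : UX d →ᵇ ℝ) (t : ℝ) (x : Euc d) : ℝ :=
  if ht : 0 < t then Real.exp (K * t) * b ⟨(t, x), ht⟩ else 0

lemma uOf_cont (K : ℝ) (b : UX d →ᵇ ℝ) : ContinuousOn (fun p : ℝ × Euc d => uOf K b p.1 p.2) (Ioi 0 ×ˢ univ) := by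
  have h1 : Continuous fun p : UX d => uOf K b p.1.1 p.1.2 := by
    have : (fun p : UX d => uOf K b p.1.1 p.1.2) = fun p : UX d => Real.exp (K * p.1.1) * b p := by
      ext p
      unfold uOf
      rw [dif_pos p.2]
    rw [this]
    exact Continuous.mul (by fun_prop) b.continuous
  have h2 : ContinuousOn (fun p : ℝ × Euc d => uOf K b p.1 p.2) {p : ℝ × Euc d | 0 < p.1} := by
    rw [continuousOn_iff_continuous_domRestrict]; exact h1
  exact h2.mono fun p hp => hp.1

lemma src_of {F : Euc d → ℝ → ℝ} {M : ℝ} (hF : Rx F M) {u : ℝ → Euc d → ℝ}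
    (hu : ContinuousOn (fun p : ℝ × Euc d => u p.1 p.2) (Ioi 0 ×ˢ univ)) : SrcB (fun s x => F x (cl (u s x))) M :=
  ⟨hF.ccont.comp_continuousOn (f := fun p : ℝ × Euc d => (p.2, u p.1 p.2)) (continuousOn_snd.prodMk hu), fun s x hs => hF.bd x (cl_mem _)⟩

theorem mild_exists {F : Euc d → ℝ → ℝ} {M : ℝ} (hF : Rx F M) {g : Euc d → ℝ} (hg : Measurable g) (hb : ∀ x, |g x| ≤ 1) :
    ∃ u : ℝ → Euc d → ℝ, ContinuousOn (fun p : ℝ × Euc d => u p.1 p.2) (Ioi 0 ×ˢ univ) ∧ (∀ t ≤ 0, u t = g) ∧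
      ∀ t, 0 < t → u t = PV g (fun s x => F x (cl (u s x))) t := by
  set K : ℝ := 2 * M + 1
  have hM := hF.Mn
  have hK : 0 < K := by positivity
  let H : (UX d →ᵇ ℝ) → ℝ → Euc d → ℝ := fun b s x => F x (cl (uOf K b s x))
  have hH : ∀ b, SrcB (H b) M := fun b => src_of hF (uOf_cont K b)
  let Ψ : (UX d →ᵇ ℝ) → (UX d →ᵇ ℝ) := fun b => BoundedContinuousFunction.ofNormedAddCommGroup
    (fun p : UX d => Real.exp (-(K * p.1.1)) * PV g (H b) p.1.1 p.1.2) (by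
      refine Continuous.mul (by fun_prop) ?_
      rw [continuous_iff_continuousAt]
      intro p
      exact ContinuousAt.comp (f := fun p : UX d => (p.1.1, p.1.2)) (g := fun p : ℝ × Euc d => PV g (H b) p.1 p.2) (PV_cont hg hb hM (hH b) p.2 p.1.2)
        (by fun_prop)) 1 (by
      intro p
      rw [norm_mul, Real.norm_of_nonneg (Real.exp_pos _).le, Real.exp_neg, inv_mul_le_iff₀ (Real.exp_pos _), mul_one]
      have h1 : |PV g (H b) p.1.1 p.1.2| ≤ 1 + M * p.1.1 :=
        (abs_add_le _ _).trans (add_le_add (Pt_abs_le hb _ _) (Jd0_le hM (hH b) p.2 _))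
      have h2 := Real.add_one_le_exp (K * p.1.1)
      have h3 := p.2
      have h4 : M * p.1.1 ≤ K * p.1.1 := by apply mul_le_mul_of_nonneg_right _ h3.le; simp only [K]; linarith
      rw [Real.norm_eq_abs]
      linarith)
  have hΨ : ∀ b b', dist (Ψ b) (Ψ b') ≤ (1/2 : ℝ) * dist b b' := by
    intro b b'
    rw [BoundedContinuousFunction.dist_le (by positivity)]
    intro p
    obtain ⟨⟨t, x⟩, ht⟩ := p
    replace ht : 0 < t := ht
    have hDi : Continuous fun s : ℝ => M * dist b b' * Real.exp (K * s) := by fun_prop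
    have h1 := Jd0_diff hM (hH b) (hH b') (D := fun s => M * dist b b' * Real.exp (K * s)) ht
      ((hDi.integrableOn_Icc (a := 0) (b := t)).mono_set Ioo_subset_Icc_self) (fun s hs y => by
        refine (hF.clip _ _ _ _).trans ?_
        rw [sub_self, norm_zero, zero_add, mul_assoc]
        refine mul_le_mul_of_nonneg_left ?_ hM
        have hs0 : 0 < s := hs.1
        unfold uOf
        rw [dif_pos hs0, dif_pos hs0, ← mul_sub, abs_mul, abs_of_pos (Real.exp_pos _), mul_comm]
        refine mul_le_mul_of_nonneg_right ?_ (Real.exp_pos _).le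
        exact BoundedContinuousFunction.dist_coe_le_dist (f := b) (g := b') _) x
    have h2 : ∫ s in Ioo 0 t, M * dist b b' * Real.exp (K * s) = M * dist b b' * ((Real.exp (K * t) - 1) / K) := by
      rw [integral_const_mul, ← integral_Ioc_eq_integral_Ioo, ← intervalIntegral.integral_of_le ht.le,
        intervalIntegral.integral_comp_mul_left (fun s => Real.exp s) hK.ne', integral_exp]
      simp; left; field_simp
    rw [h2] at h1
    have e1 : Ψ b ⟨(t, x), ht⟩ - Ψ b' ⟨(t, x), ht⟩ = Real.exp (-(K * t)) * (Jd (fun σ s x => Ak gm σ (H b s) x) t x - Jd (fun σ s x => Ak gm σ (H b' s) x) t x) := by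
      simp only [Ψ, BoundedContinuousFunction.coe_ofNormedAddCommGroup, PV]; ring
    rw [Real.dist_eq, e1, abs_mul, abs_of_pos (Real.exp_pos _), Real.exp_neg, inv_mul_le_iff₀ (Real.exp_pos _)]
    refine h1.trans ?_
    have h3 : M / K ≤ 1 / 2 := by rw [div_le_div_iff₀ hK (by norm_num)]; simp only [K]; linarith
    have h4 : M * dist b b' * ((Real.exp (K * t) - 1) / K) = (M / K) * (dist b b' * (Real.exp (K * t) - 1)) := by ring
    rw [h4]
    have h5 : 1 ≤ Real.exp (K * t) := Real.one_le_exp (by positivity)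
    calc _ ≤ (1/2) * (dist b b' * (Real.exp (K * t) - 1)) := mul_le_mul_of_nonneg_right h3 (mul_nonneg dist_nonneg (by linarith))
      _ ≤ (1/2) * (dist b b' * Real.exp (K * t)) := by gcongr; linarith
      _ = _ := by ring
  have hcon : ContractingWith (1/2 : ℝ≥0) Ψ := ⟨by
    rw [← NNReal.coe_lt_coe]; norm_num, LipschitzWith.of_dist_le_mul (by simpa using hΨ)⟩
  obtain ⟨b, hbf⟩ : ∃ b, Ψ b = b := ⟨_, hcon.fixedPoint_isFixedPt⟩
  have hfix : ∀ t, 0 < t → uOf K b t = PV g (H b) t := by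
    intro t ht
    ext x
    unfold uOf
    rw [dif_pos ht]
    conv_lhs => rw [← hbf]
    simp only [Ψ, BoundedContinuousFunction.coe_ofNormedAddCommGroup]
    rw [← mul_assoc, ← Real.exp_add]; simp
  refine ⟨fun t => if 0 < t then uOf K b t else g, ?_, fun t ht => if_neg (not_lt.2 ht), fun t ht => ?_⟩
  · refine (uOf_cont K b).congr fun p hp => ?_
    simp only
    rw [if_pos (show 0 < p.1 from hp.1)]
  · simp only
    rw [if_pos ht, hfix t ht]
    ext x
    unfold PV
    congr 1
    unfold Jd
    congr 1
    refine setIntegral_congr_fun measurableSet_Ioo fun ρ hρ => ?_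
    have h1 : 0 < t * (1 - ρ) := mul_pos ht (by linarith [hρ.2])
    simp only [H, if_pos h1]
end
end

section
open MeasureTheory Metric Set Filter
open scoped Topology RealInnerProductSpace NNReal Pointwise
set_option linter.unusedVariables false
set_option linter.unusedSectionVars false

section
variable {d : ℕ}

lemma PV_congr {g : Euc d → ℝ} {h h' : ℝ → Euc d → ℝ} (hh : ∀ s, 0 < s → h s = h' s) {t : ℝ} (ht : 0 < t) : PV g h t = PV g h' t := by
  ext x
  unfold PV
  congr 1
  unfold Jd
  congr 1
  refine setIntegral_congr_fun measurableSet_Ioo fun ρ hρ => ?_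
  have h1 : 0 < t * (1 - ρ) := mul_pos ht (by linarith [hρ.2])
  simp only [hh _ h1]

lemma Pt_le {B : ℝ} {φ : Euc d → ℝ} (hφ : Measurable φ) (hb : ∀ x, |φ x| ≤ B) {b : ℝ} (h : ∀ x, φ x ≤ b) (τ : ℝ) (x : Euc d) : Ak gm τ φ x ≤ b := by
  have h1 : Ak gm τ φ x ≤ ∫ z : Euc d, b * gm z := by
    refine integral_mono (Ak_integrable gm_GB hφ hb τ x) (gm_GB.integrable.const_mul b) fun z => ?_
    exact mul_le_mul_of_nonneg_right (h _) (gm_pos z).le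
  rwa [integral_const_mul, gm_integral, mul_one] at h1

lemma Pt_nonneg {φ : Euc d → ℝ} (h : ∀ x, 0 ≤ φ x) (τ : ℝ) (x : Euc d) : 0 ≤ Ak gm τ φ x :=
  integral_nonneg fun z => mul_nonneg (h _) (gm_pos z).le

theorem ET {F : Euc d → ℝ → ℝ} {M : ℝ} (hF : Rx F M) {g : Euc d → ℝ} (hg : Measurable g) (hg1 : ∀ x, g x ∈ Icc (0:ℝ) 1) :
    ∃ u : ℝ → Euc d → ℝ, IsSolR F g u ∧ (∀ t, 0 < t → u t = PV g (fun s x => F x (u s x)) t) ∧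
      ∀ t, 0 < t → ∀ x y, |u t x - u t y| ≤ lipC d M t * ‖x - y‖ := by
  have hb : ∀ x, |g x| ≤ 1 := fun x => by rw [abs_of_nonneg (hg1 x).1]; exact (hg1 x).2
  have hM := hF.Mn
  obtain ⟨u, huc, hu0, hup⟩ := mild_exists hF hg hb
  set h : ℝ → Euc d → ℝ := fun s x => F x (cl (u s x)) with hh
  have hs : SrcB h M := src_of hF huc
  have hlip : ∀ t, 0 < t → ∀ x y, |u t x - u t y| ≤ lipC d M t * ‖x - y‖ := fun t ht x y => by
    rw [hup t ht]; exact PV_lip' hg hb hM hs ht x y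
  have hk := kC_nonneg d
  have hi := gI_nonneg (d := d)
  have hw := W1_nonneg
  set L : ℝ := M * (1 + (kC d * gI d) + M * kC d * gI d * W1)
  have hl : ∀ s x y, 0 < s → |h s x - h s y| ≤ L * (1 + s) * (Real.sqrt s)⁻¹ * ‖x - y‖ := by
    intro s x y hs0
    refine (hF.clip _ _ _ _).trans ?_
    have h1 := hlip s hs0 x y
    have hq : 0 < Real.sqrt s := Real.sqrt_pos.2 hs0
    have hqq := Real.mul_self_sqrt hs0.le
    have e1 : Real.sqrt s ≤ (1 + s) * (Real.sqrt s)⁻¹ := by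
      rw [← div_eq_mul_inv, le_div_iff₀ hq]; linarith
    have e2 : 1 ≤ (1 + s) * (Real.sqrt s)⁻¹ := by
      rw [← div_eq_mul_inv, le_div_iff₀ hq]; nlinarith [sq_nonneg (Real.sqrt s - 1)]
    have e3 : (Real.sqrt s)⁻¹ ≤ (1 + s) * (Real.sqrt s)⁻¹ := le_mul_of_one_le_left (by positivity) (by linarith)
    have e4 : 1 + lipC d M s ≤ (1 + (kC d * gI d) + M * kC d * gI d * W1) * ((1 + s) * (Real.sqrt s)⁻¹) := by
      unfold lipC
      have a1 : (Real.sqrt s)⁻¹ * (kC d * gI d) ≤ (1 + s) * (Real.sqrt s)⁻¹ * (kC d * gI d) := mul_le_mul_of_nonneg_right e3 (by positivity)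
      have a2 : M * kC d * gI d * W1 * Real.sqrt s ≤ M * kC d * gI d * W1 * ((1 + s) * (Real.sqrt s)⁻¹) := mul_le_mul_of_nonneg_left e1 (by positivity)
      linarith
    calc M * (‖x - y‖ + |u s x - u s y|) ≤ M * ((1 + lipC d M s) * ‖x - y‖) := mul_le_mul_of_nonneg_left (by linarith) hM
      _ ≤ M * (((1 + (kC d * gI d) + M * kC d * gI d * W1) * ((1 + s) * (Real.sqrt s)⁻¹)) * ‖x - y‖) := by gcongr
      _ = _ := by simp only [L]; ring
  have hsol := fun t (ht : 0 < t) => PV_sol hg hb hM hs (by positivity : 0 ≤ L) hl ht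
  have hC2 : ∀ t, 0 < t → ContDiff ℝ 2 (u t) := fun t ht => by rw [hup t ht]; exact (hsol t ht).1
  have hder : ∀ t, 0 < t → ∀ x, HasDerivAt (fun s => u s x) (lap (u t) x + h t x) t := fun t ht x => by
    have := (hsol t ht).2 x
    rw [← hup t ht] at this
    refine this.congr_of_eventuallyEq ?_
    filter_upwards [lt_mem_nhds ht] with s hs
    rw [hup s hs]
  have hbu : ∀ t, 0 < t → ∀ x, u t x ≤ 1 + M * t ∧ -(M * t) ≤ u t x := fun t ht x => by
    rw [hup t ht]
    have h1 := abs_le.1 (Jd0_le hM hs ht x)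
    have h2 := Pt_le hg hb (fun x => (hg1 x).2) t x
    have h3 := Pt_nonneg (fun x => (hg1 x).1) t x
    unfold PV
    constructor <;> linarith [h1.1, h1.2]
  have hev : ∀ (x₀ : Euc d) (ε : ℝ), 0 < ε → ∀ᶠ p : ℝ × Euc d in (𝓝[>] (0:ℝ)) ×ˢ 𝓝 x₀, 0 < p.1 ∧ M * p.1 ≤ ε := by
    intro x₀ ε hε
    have h1 : ∀ᶠ t : ℝ in 𝓝[>] 0, 0 < t ∧ M * t ≤ ε := by
      refine (eventually_mem_nhdsWithin.mono fun t ht => ht).and (Filter.Eventually.filter_mono nhdsWithin_le_nhds ?_)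
      have : Tendsto (fun t : ℝ => M * t) (𝓝 0) (𝓝 (M * 0)) := (continuous_const.mul continuous_id).tendsto 0
      rw [mul_zero] at this
      exact (this.eventually (ge_mem_nhds hε))
    exact h1.prod_inl _
  have hle1 : ∀ t, 0 < t → ∀ x, u t x ≤ 1 := by
    intro T hT x
    have := compLem (fun t x => u t x - 1) T (M * T) 0 (fun t ht x => by
        have := (hbu t ht.1 x).1; have := mul_le_mul_of_nonneg_left ht.2 hM; linarith)
      ((huc.mono (prod_mono (fun t ht => ht.1) subset_rfl)).sub continuousOn_const)
      (fun t ht x hpos => ⟨(hC2 t ht.1).contDiffAt.sub contDiffAt_const, lap (u t) x, by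
        have h2 : h t x = 0 := by
          have : cl (u t x) = 1 := by unfold cl; rw [min_eq_right (by linarith), max_eq_right zero_le_one]
          simp only [hh, this]; exact hF.z1 x
        have := (hder t ht.1 x).sub_const 1
        rwa [h2, add_zero] at this, by
        have := lap_sub (hC2 t ht.1).contDiffAt (contDiffAt_const (c := (1:ℝ))) (x := x)
        rw [this, lap_const]; simp⟩)
      (fun x₀ ε hε => (hev x₀ ε hε).mono fun p hp => by have := (hbu p.1 hp.1 p.2).1; linarith [hp.2]) T ⟨hT, le_rfl⟩ x
    linarith
  have hge0 : ∀ t, 0 < t → ∀ x, 0 ≤ u t x := by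
    intro T hT x
    have := compLem (fun t x => 0 - u t x) T (M * T) 0 (fun t ht x => by
        have := (hbu t ht.1 x).2; have := mul_le_mul_of_nonneg_left ht.2 hM; linarith)
      (continuousOn_const.sub (huc.mono (prod_mono (fun t ht => ht.1) subset_rfl)))
      (fun t ht x hpos => ⟨contDiffAt_const.sub (hC2 t ht.1).contDiffAt, -lap (u t) x, by
        have h2 : h t x = 0 := by
          have : cl (u t x) = 0 := by unfold cl; rw [min_eq_left (by linarith), max_eq_left (by linarith)]
          simp only [hh, this]; exact hF.z0 x
        have := (hder t ht.1 x).const_sub 0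
        rwa [h2, add_zero] at this, by
        have := lap_sub (contDiffAt_const (c := (0:ℝ))) (hC2 t ht.1).contDiffAt (x := x)
        rw [this, lap_const]; simp⟩)
      (fun x₀ ε hε => (hev x₀ ε hε).mono fun p hp => by have := (hbu p.1 hp.1 p.2).2; linarith [hp.2]) T ⟨hT, le_rfl⟩ x
    linarith
  have hmem : ∀ t x, u t x ∈ Icc (0:ℝ) 1 := fun t x => by
    rcases le_or_gt t 0 with h0 | h0
    · rw [hu0 t h0]; exact hg1 x
    · exact ⟨hge0 t h0 x, hle1 t h0 x⟩
  have hhe : h = fun s x => F x (u s x) := by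
    ext s x; simp only [hh]; rw [cl_of_mem (hmem s x)]
  refine ⟨u, ⟨fun t x _ => hmem t x, huc, hC2, fun t x ht => ?_, fun x => by rw [hu0 0 le_rfl], fun x₀ hc => ?_⟩, fun t ht => ?_, hlip⟩
  · have := hder t ht x; rwa [hhe] at this
  · have h1 := Pt_lim hg hb hc
    rw [Metric.tendsto_nhds] at h1 ⊢
    intro ε hε
    filter_upwards [h1 (ε/2) (by positivity), hev x₀ (ε/4) (by positivity)] with p hp1 hp2
    rw [Real.dist_eq] at hp1 ⊢
    rw [hup p.1 hp2.1]
    have h3 := Jd0_le hM hs hp2.1 p.2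
    unfold PV
    have := abs_add_le (Ak gm p.1 g p.2 - g x₀) (Jd (fun σ s x => Ak gm σ (h s) x) p.1 p.2)
    have e : Ak gm p.1 g p.2 - g x₀ + Jd (fun σ s x => Ak gm σ (h s) x) p.1 p.2 = Ak gm p.1 g p.2 + Jd (fun σ s x => Ak gm σ (h s) x) p.1 p.2 - g x₀ := by ring
    rw [e] at this
    linarith [hp2.2]
  · rw [← hhe]; exact hup t ht

end
end

section
open MeasureTheory Metric Set Filter
open scoped Topology RealInnerProductSpace NNReal Pointwise
set_option linter.unusedVariables false
set_option linter.unusedSectionVars false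

section
variable {d : ℕ}

lemma IsSolR.contAt {F : Euc d → ℝ → ℝ} {g : Euc d → ℝ} {u : ℝ → Euc d → ℝ} (hu : IsSolR F g u) {t : ℝ} (ht : 0 < t) (x : Euc d) :
    ContinuousAt (fun p : ℝ × Euc d => u p.1 p.2) (t, x) :=
  hu.contOn.continuousAt (prod_mem_nhds (Ioi_mem_nhds ht) univ_mem)

lemma IsSolR.contx {F : Euc d → ℝ → ℝ} {g : Euc d → ℝ} {u : ℝ → Euc d → ℝ} (hu : IsSolR F g u) {t : ℝ} (ht : 0 < t) : Continuous (u t) :=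
  (hu.spatial t ht).continuous

lemma IsSolR.contt {F : Euc d → ℝ → ℝ} {g : Euc d → ℝ} {u : ℝ → Euc d → ℝ} (hu : IsSolR F g u) {t : ℝ} (ht : 0 < t) (x : Euc d) :
    ContinuousAt (fun s => u s x) t := (hu.eqn t x ht).continuousAt

lemma IsSolR.restart {F : Euc d → ℝ → ℝ} {g : Euc d → ℝ} {u : ℝ → Euc d → ℝ} (hu : IsSolR F g u) {t₀ : ℝ} (ht : 0 < t₀) :
    IsSolR F (u t₀) (fun s => u (t₀ + s)) := by
  refine ⟨fun t x h => hu.mem_Icc _ x (by linarith), ?_, fun t h => hu.spatial _ (by linarith), fun t x h => ?_, fun x => by simp, fun x₀ _ => ?_⟩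
  · intro p hp
    have hp1 : 0 < p.1 := hp.1
    exact (ContinuousAt.comp (f := fun p : ℝ × Euc d => (t₀ + p.1, p.2)) (g := fun p : ℝ × Euc d => u p.1 p.2)
      (hu.contAt (by linarith) _) (by fun_prop)).continuousWithinAt
  · exact (hu.eqn (t₀ + t) x (by linarith)).comp_const_add t₀ t
  · have h1 : ContinuousAt (fun p : ℝ × Euc d => u (t₀ + p.1) p.2) (0, x₀) :=
      ContinuousAt.comp (f := fun p : ℝ × Euc d => (t₀ + p.1, p.2)) (g := fun p : ℝ × Euc d => u p.1 p.2)
        (hu.contAt (by simpa using ht) _) (by fun_prop)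
    have h2 : Tendsto (fun p : ℝ × Euc d => u (t₀ + p.1) p.2) (𝓝 (0, x₀)) (𝓝 (u t₀ x₀)) := by simpa using h1.tendsto
    rw [nhds_prod_eq] at h2
    exact h2.mono_left (Filter.prod_mono_left _ nhdsWithin_le_nhds)

lemma ev_of_contAt {v : ℝ → Euc d → ℝ} {x₀ : Euc d} (h : ContinuousAt (fun p : ℝ × Euc d => v p.1 p.2) (0, x₀)) :
    Tendsto (fun p : ℝ × Euc d => v p.1 p.2) ((𝓝[>] (0:ℝ)) ×ˢ 𝓝 x₀) (𝓝 (v 0 x₀)) := by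
  have h2 := h.tendsto
  rw [nhds_prod_eq] at h2
  exact h2.mono_left (Filter.prod_mono_left _ nhdsWithin_le_nhds)

lemma ev_pos (x₀ : Euc d) : ∀ᶠ p : ℝ × Euc d in (𝓝[>] (0:ℝ)) ×ˢ 𝓝 x₀, 0 < p.1 :=
  (eventually_mem_nhdsWithin.mono fun t ht => ht : ∀ᶠ t : ℝ in 𝓝[>] (0:ℝ), 0 < t).prod_inl _

lemma init_ok {F : Euc d → ℝ → ℝ} {g : Euc d → ℝ} {u : ℝ → Euc d → ℝ} (hu : IsSolR F g u) {v : ℝ → Euc d → ℝ} {x₀ : Euc d}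
    (h : ContinuousAt (fun p : ℝ × Euc d => v p.1 p.2) (0, x₀)) (h0 : v 0 x₀ ≤ 0 ∨ (ContinuousAt g x₀ ∧ v 0 x₀ ≤ g x₀)) :
    ∀ ε > 0, ∀ᶠ p in (𝓝[>] (0:ℝ)) ×ˢ 𝓝 x₀, v p.1 p.2 - u p.1 p.2 ≤ ε := by
  intro ε hε
  have h1 := ev_of_contAt h
  rcases h0 with h0 | ⟨hc, h0⟩
  · filter_upwards [h1.eventually (ge_mem_nhds (show v 0 x₀ < ε by linarith)), ev_pos x₀] with p hp hp2
    have := (hu.mem_Icc p.1 p.2 hp2.le).1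
    linarith
  · have h2 := (h1.sub (hu.initLim x₀ hc))
    exact h2.eventually (ge_mem_nhds (show v 0 x₀ - g x₀ < ε by linarith))

lemma Rx.up {F : Euc d → ℝ → ℝ} {M : ℝ} (hF : Rx F M) (x : Euc d) {a b : ℝ} (ha : a ∈ Icc (0:ℝ) 1) (hb : b ∈ Icc (0:ℝ) 1) (hab : a ≤ b) :
    F x b - F x a ≤ M * (b - a) ∧ F x a - F x b ≤ M * (b - a) := by
  have := hF.lip x x b a hb ha
  rw [sub_self, norm_zero, zero_add, abs_of_nonneg (sub_nonneg.2 hab)] at this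
  have h2 := abs_le.1 this
  constructor <;> linarith [h2.1, h2.2]

/-- subsolutions stay below solutions -/
lemma sub_le {F : Euc d → ℝ → ℝ} {M : ℝ} (hF : Rx F M) {g : Euc d → ℝ} {u : ℝ → Euc d → ℝ} (hu : IsSolR F g u) (T : ℝ) {v : ℝ → Euc d → ℝ}
    (hv1 : ∀ t ∈ Ioc 0 T, ∀ x, v t x ≤ 1) (hvc : ContinuousOn (fun p : ℝ × Euc d => v p.1 p.2) (Ioc 0 T ×ˢ univ))
    (hv : ∀ t ∈ Ioc 0 T, ∀ x, 0 < v t x → ContDiffAt ℝ 2 (v t) x ∧ ∃ v', HasDerivAt (fun s => v s x) v' t ∧ v' ≤ lap (v t) x + F x (v t x))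
    (hi : ∀ x₀, ∀ ε > 0, ∀ᶠ p in (𝓝[>] (0:ℝ)) ×ˢ 𝓝 x₀, v p.1 p.2 - u p.1 p.2 ≤ ε) :
    ∀ t ∈ Ioc 0 T, ∀ x, v t x ≤ u t x := by
  intro t ht x
  have := compLem (fun t x => v t x - u t x) T 1 M (fun t ht x => by
      have := hv1 t ht x; have := (hu.mem_Icc t x ht.1.le).1; linarith)
    (hvc.sub (hu.contOn.mono (prod_mono (fun t ht => ht.1) subset_rfl)))
    (fun t ht x hpos => by
      have hum := hu.mem_Icc t x ht.1.le
      obtain ⟨h1, v', h2, h3⟩ := hv t ht x (by linarith [hum.1])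
      have h4 := (hu.spatial t ht.1).contDiffAt (x := x)
      refine ⟨h1.sub h4, _, h2.sub (hu.eqn t x ht.1), ?_⟩
      rw [lap_sub h1 h4]
      have := (hF.up x hum ⟨by linarith [hum.1], hv1 t ht x⟩ (by linarith : u t x ≤ v t x)).1
      linarith) hi t ht x
  linarith

/-- supersolutions stay above solutions -/
lemma super_ge {F : Euc d → ℝ → ℝ} {M : ℝ} (hF : Rx F M) {g : Euc d → ℝ} {u : ℝ → Euc d → ℝ} (hu : IsSolR F g u) (T : ℝ) {v : ℝ → Euc d → ℝ}
    (hv1 : ∀ t ∈ Ioc 0 T, ∀ x, 0 ≤ v t x) (hvc : ContinuousOn (fun p : ℝ × Euc d => v p.1 p.2) (Ioc 0 T ×ˢ univ))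
    (hv : ∀ t ∈ Ioc 0 T, ∀ x, v t x < 1 → ContDiffAt ℝ 2 (v t) x ∧ ∃ v', HasDerivAt (fun s => v s x) v' t ∧ lap (v t) x + F x (v t x) ≤ v')
    (hi : ∀ x₀, ∀ ε > 0, ∀ᶠ p in (𝓝[>] (0:ℝ)) ×ˢ 𝓝 x₀, u p.1 p.2 - v p.1 p.2 ≤ ε) :
    ∀ t ∈ Ioc 0 T, ∀ x, u t x ≤ v t x := by
  intro t ht x
  have := compLem (fun t x => u t x - v t x) T 1 M (fun t ht x => by
      have := hv1 t ht x; have := (hu.mem_Icc t x ht.1.le).2; linarith)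
    ((hu.contOn.mono (prod_mono (fun t ht => ht.1) subset_rfl)).sub hvc)
    (fun t ht x hpos => by
      have hum := hu.mem_Icc t x ht.1.le
      obtain ⟨h1, v', h2, h3⟩ := hv t ht x (by linarith [hum.2])
      have h4 := (hu.spatial t ht.1).contDiffAt (x := x)
      refine ⟨h4.sub h1, _, (hu.eqn t x ht.1).sub h2, ?_⟩
      rw [lap_sub h4 h1]
      have := (hF.up x ⟨hv1 t ht x, by linarith [hum.2]⟩ hum (by linarith : v t x ≤ u t x)).1
      linarith) hi t ht x
  linarith

lemma sol_cmp {F : Euc d → ℝ → ℝ} {M : ℝ} (hF : Rx F M) {g g' : Euc d → ℝ} {u v : ℝ → Euc d → ℝ} (hu : IsSolR F g u) (hv : IsSolR F g' v)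
    (hg : Continuous g) (hg' : Continuous g') (hle : ∀ x, g x ≤ g' x) {t : ℝ} (ht : 0 ≤ t) (x : Euc d) : u t x ≤ v t x := by
  rcases eq_or_lt_of_le ht with h | h
  · rw [← h, hu.at_zero, hv.at_zero]; exact hle x
  · refine sub_le hF hv t (v := u) (fun t ht x => (hu.mem_Icc t x ht.1.le).2) (hu.contOn.mono (prod_mono (fun t ht => ht.1) subset_rfl))
      (fun t ht x _ => ⟨(hu.spatial t ht.1).contDiffAt, _, hu.eqn t x ht.1, le_rfl⟩) (fun x₀ ε hε => ?_) t ⟨h, le_rfl⟩ x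
    have h2 := (hu.initLim x₀ hg.continuousAt).sub (hv.initLim x₀ hg'.continuousAt)
    exact h2.eventually (ge_mem_nhds (show g x₀ - g' x₀ < ε by linarith [hle x₀]))

lemma sol_unique {F : Euc d → ℝ → ℝ} {M : ℝ} (hF : Rx F M) {g : Euc d → ℝ} {u v : ℝ → Euc d → ℝ} (hu : IsSolR F g u) (hv : IsSolR F g v)
    (hg : Continuous g) {t : ℝ} (ht : 0 ≤ t) : u t = v t :=
  funext fun x => le_antisymm (sol_cmp hF hu hv hg hg (fun _ => le_rfl) ht x) (sol_cmp hF hv hu hg hg (fun _ => le_rfl) ht x)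

lemma sol_mild {F : Euc d → ℝ → ℝ} {M : ℝ} (hF : Rx F M) {g : Euc d → ℝ} {u : ℝ → Euc d → ℝ} (hu : IsSolR F g u) {t₀ t : ℝ} (ht₀ : 0 < t₀) (ht : 0 < t) :
    u (t₀ + t) = PV (u t₀) (fun s x => F x (u (t₀ + s) x)) t ∧ ∀ x y, |u (t₀ + t) x - u (t₀ + t) y| ≤ lipC d M t * ‖x - y‖ := by
  have hr := hu.restart ht₀
  have hc := hu.contx ht₀
  obtain ⟨v, hv, hm, hl⟩ := ET hF hc.measurable (fun x => hu.mem_Icc t₀ x ht₀.le)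
  have he : ∀ s, 0 ≤ s → u (t₀ + s) = v s := fun s hs => sol_unique hF hr hv hc hs
  rw [he t ht.le]
  refine ⟨?_, hl t ht⟩
  rw [hm t ht]
  refine PV_congr (fun s hs => ?_) ht
  rw [he s hs.le]

lemma sol_lip {F : Euc d → ℝ → ℝ} {M : ℝ} (hF : Rx F M) {g : Euc d → ℝ} {u : ℝ → Euc d → ℝ} (hu : IsSolR F g u) {t : ℝ} (ht : 1 < t) (x y : Euc d) :
    |u t x - u t y| ≤ lipC d M 1 * ‖x - y‖ := by
  have := (sol_mild hF hu (t₀ := t - 1) (t := 1) (by linarith) one_pos).2 x y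
  simpa using this

lemma lipC_nonneg {M : ℝ} (hM : 0 ≤ M) (t : ℝ) : 0 ≤ lipC d M t := by
  have hk := kC_nonneg d
  have hi := gI_nonneg (d := d)
  have hw := W1_nonneg
  unfold lipC; positivity

lemma Pt_sol {φ : Euc d → ℝ} {B : ℝ} (hφ : Measurable φ) (hb : ∀ x, |φ x| ≤ B) {t : ℝ} (ht : 0 < t) :
    ContDiff ℝ 2 (Ak gm t φ) ∧ (∀ x, HasDerivAt (fun s => Ak gm s φ x) (lap (Ak gm t φ) x) t) ∧
      ∀ x, ContinuousAt (fun p : ℝ × Euc d => Ak gm p.1 φ p.2) (t, x) := by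
  have hs : SrcB (d := d) (fun _ _ => 0) 0 := ⟨continuousOn_const, by simp⟩
  have e : ∀ s : ℝ, PV φ (fun _ _ => 0) s = Ak gm s φ := fun s => by
    ext x; simp [PV, Jd, Ak]
  have := PV_sol hφ hb le_rfl hs le_rfl (by simp) ht
  simp only [e, add_zero] at this
  exact ⟨this.1, this.2, fun x => Ak_continuousAt gm_GB hφ hb ht x⟩

lemma heat_ge {z : ℝ → Euc d → ℝ} {K B : ℝ} (hc : ContinuousOn (fun p : ℝ × Euc d => z p.1 p.2) (Ioi 0 ×ˢ univ))
    (hB : ∀ s x, 0 < s → |z s x| ≤ B)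
    (hd : ∀ s x, 0 < s → ContDiffAt ℝ 2 (z s) x ∧ ∃ z', HasDerivAt (fun s => z s x) z' s ∧ lap (z s) x + K * z s x ≤ z')
    {φ : Euc d → ℝ} (hφ : Continuous φ) (hφB : ∀ x, |φ x| ≤ B)
    (hlim : ∀ x₀, Tendsto (fun p : ℝ × Euc d => z p.1 p.2) ((𝓝[>] (0:ℝ)) ×ˢ 𝓝 x₀) (𝓝 (φ x₀))) {s : ℝ} (hs : 0 < s) (x : Euc d) :
    Real.exp (K * s) * Ak gm s φ x ≤ z s x := by
  have hB0 : 0 ≤ B := (abs_nonneg _).trans (hφB x)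
  have key := compLem (fun t x => Real.exp (K * t) * Ak gm t φ x - z t x) s (Real.exp (|K| * s) * B + B) K (fun t ht x => by
      have h1 := abs_le.1 (hB t x ht.1)
      have h2 := abs_le.1 (Pt_abs_le hφB t x)
      have h3 : Real.exp (K * t) * Ak gm t φ x ≤ Real.exp (|K| * s) * B := by
        have : Real.exp (K * t) ≤ Real.exp (|K| * s) := by
          apply Real.exp_le_exp.2
          exact mul_le_mul (le_abs_self K) ht.2 ht.1.le (abs_nonneg K)
        calc _ ≤ Real.exp (K * t) * B := mul_le_mul_of_nonneg_left h2.2 (Real.exp_pos _).le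
          _ ≤ _ := mul_le_mul_of_nonneg_right this hB0
      linarith [h1.1])
    (by
      refine ContinuousOn.sub (fun p hp => ?_) (hc.mono (prod_mono (fun t ht => ht.1) subset_rfl))
      have h3 := (Pt_sol hφ.measurable hφB hp.1.1).2.2 p.2
      have h4 : Continuous (fun p : ℝ × Euc d => Real.exp (K * p.1)) := by fun_prop
      exact (h4.continuousAt.mul h3).continuousWithinAt)
    (fun t ht x _ => by
      obtain ⟨h1, z', h2, h3⟩ := hd t x ht.1
      obtain ⟨p1, p2, p3⟩ := Pt_sol hφ.measurable hφB ht.1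
      have p1' := p1.contDiffAt (x := x)
      have he : HasDerivAt (fun s => Real.exp (K * s)) (Real.exp (K * t) * K) t := by
        simpa using ((hasDerivAt_id t).const_mul K).exp
      refine ⟨(contDiffAt_const.mul p1').sub h1, _, (he.mul (p2 x)).sub h2, ?_⟩
      rw [lap_sub (contDiffAt_const.mul p1') h1, lap_const_mul _ p1']
      linarith)
    (fun x₀ ε hε => by
      have h1 : Tendsto (fun p : ℝ × Euc d => Real.exp (K * p.1)) ((𝓝[>] (0:ℝ)) ×ˢ 𝓝 x₀) (𝓝 1) := by
        have := ev_of_contAt (v := fun t (_ : Euc d) => Real.exp (K * t)) (x₀ := x₀) (by fun_prop)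
        simpa using this
      have h2 := (h1.mul (Pt_lim hφ.measurable hφB (hφ.continuousAt (x := x₀)))).sub (hlim x₀)
      rw [one_mul, sub_self] at h2
      exact h2.eventually (ge_mem_nhds hε)) s ⟨hs, le_rfl⟩ x
  linarith

lemma heat_le {z : ℝ → Euc d → ℝ} {K B : ℝ} (hc : ContinuousOn (fun p : ℝ × Euc d => z p.1 p.2) (Ioi 0 ×ˢ univ))
    (hB : ∀ s x, 0 < s → |z s x| ≤ B)
    (hd : ∀ s x, 0 < s → ContDiffAt ℝ 2 (z s) x ∧ ∃ z', HasDerivAt (fun s => z s x) z' s ∧ z' ≤ lap (z s) x + K * z s x)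
    {φ : Euc d → ℝ} (hφ : Continuous φ) (hφB : ∀ x, |φ x| ≤ B)
    (hlim : ∀ x₀, Tendsto (fun p : ℝ × Euc d => z p.1 p.2) ((𝓝[>] (0:ℝ)) ×ˢ 𝓝 x₀) (𝓝 (φ x₀))) {s : ℝ} (hs : 0 < s) (x : Euc d) :
    z s x ≤ Real.exp (K * s) * Ak gm s φ x := by
  have := heat_ge (z := fun t x => - z t x) (K := K) (B := B) (φ := fun x => - φ x) hc.neg (by simpa using hB)
    (fun s x hs => by
      obtain ⟨h1, z', h2, h3⟩ := hd s x hs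
      refine ⟨h1.neg, -z', h2.neg, ?_⟩
      rw [lap_neg h1]; linarith) hφ.neg (by simpa using hφB) (fun x₀ => (hlim x₀).neg) hs x
  have e : Ak gm s (fun x => - φ x) x = - Ak gm s φ x := by
    simp [Ak, integral_neg]
  rw [e] at this
  linarith
end
end

section
open MeasureTheory Metric Set Filter
open scoped Topology RealInnerProductSpace NNReal Pointwise
set_option linter.unusedVariables false
set_option linter.unusedSectionVars false

lemma inv_deriv {G G' : ℝ → ℝ} {s t : Set ℝ} (hs : IsOpen s) (ht : IsOpen t) (hG : StrictAntiOn G s) (him : G '' s = t)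
    (hd : ∀ x ∈ s, HasDerivAt G (G' x) x) (h0 : ∀ x ∈ s, G' x ≠ 0) :
    ∃ Φ : ℝ → ℝ, (∀ y ∈ t, Φ y ∈ s ∧ G (Φ y) = y ∧ HasDerivAt Φ (G' (Φ y))⁻¹ y) ∧ (∀ x ∈ s, Φ (G x) = x) ∧ StrictAntiOn Φ t := by
  choose! Φ hΦ using fun y (hy : y ∈ t) => (by rw [← him] at hy; exact hy : ∃ x, x ∈ s ∧ G x = y)
  have hinv : ∀ x ∈ s, Φ (G x) = x := fun x hx => by
    have hm : G x ∈ t := him ▸ mem_image_of_mem _ hx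
    exact hG.injOn (hΦ _ hm).1 hx (hΦ _ hm).2
  have hanti : StrictAntiOn Φ t := fun y hy z hz hyz => by
    rw [← hG.lt_iff_gt (hΦ y hy).1 (hΦ z hz).1, (hΦ y hy).2, (hΦ z hz).2]; exact hyz
  refine ⟨Φ, fun y hy => ⟨(hΦ y hy).1, (hΦ y hy).2, ?_⟩, hinv, hanti⟩
  have hc : ContinuousAt Φ y := by
    have h1 : MonotoneOn (fun y => - Φ y) t := fun a ha b hb hab => neg_le_neg (hanti.antitoneOn ha hb hab)
    have h2 : (fun y => - Φ y) '' t = (fun x => -x) ⁻¹' s := by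
      ext x
      constructor
      · rintro ⟨y, hy, rfl⟩; simpa using (hΦ y hy).1
      · intro hx
        exact ⟨G (-x), him ▸ mem_image_of_mem _ hx, by simp [hinv _ hx]⟩
    have h3 := continuousAt_of_monotoneOn_of_image_mem_nhds h1 (ht.mem_nhds hy)
      (by rw [h2]; exact (hs.preimage continuous_neg).mem_nhds (by simpa using (hΦ y hy).1))
    have h4 := h3.neg
    have e : (-fun y => - Φ y) = Φ := by ext z; simp
    rw [← e]; exact h4
  exact HasDerivAt.of_local_left_inverse hc (hd _ (hΦ y hy).1) (h0 _ (hΦ y hy).1)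
    (by filter_upwards [ht.mem_nhds hy] with z hz using (hΦ z hz).2)

lemma ode_inv {p : ℝ → ℝ} {h a b L : ℝ} (h0h : 0 < h) (hah : a < h) (hb : 0 < b) (hL : 0 < L) (hpc : ContinuousOn p (Iio h))
    (hpos : ∀ U < h, 0 < p U) (hlow : ∀ U ≤ 0, p U = b) (hup : ∀ U, a ≤ U → U < h → p U ≤ L * (h - U)) :
    ∃ Φ : ℝ → ℝ, (∀ s, Φ s < h ∧ HasDerivAt Φ (-p (Φ s)) s) ∧ StrictAnti Φ ∧ Φ 0 = 0 ∧ ∀ U < h, ∃ S, ∀ s ≤ S, U ≤ Φ s := by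
  set G : ℝ → ℝ := fun U => ∫ V in (0:ℝ)..U, -(p V)⁻¹ with hGdef
  have hic : ContinuousOn (fun V => -(p V)⁻¹) (Iio h) := (hpc.inv₀ (fun U hU => (hpos U hU).ne')).neg
  have hd : ∀ U ∈ Iio h, HasDerivAt G (-(p U)⁻¹) U := by
    intro U hU
    have hsub : uIcc 0 U ⊆ Iio h := by
      intro V hV
      exact lt_of_le_of_lt hV.2 (max_lt h0h hU)
    refine intervalIntegral.integral_hasDerivAt_right ((hic.mono hsub).intervalIntegrable) ?_ (hic.continuousAt (Iio_mem_nhds hU))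
    exact hic.stronglyMeasurableAtFilter isOpen_Iio U hU
  have hneg : ∀ U ∈ Iio h, -(p U)⁻¹ < 0 := fun U hU => by
    have := inv_pos.2 (hpos U hU); linarith
  have hGc : ContinuousOn G (Iio h) := fun U hU => (hd U hU).continuousAt.continuousWithinAt
  have hanti : StrictAntiOn G (Iio h) := strictAntiOn_of_deriv_neg (convex_Iio h) hGc (fun U hU => by
    rw [interior_Iio] at hU
    rw [(hd U hU).deriv]; exact hneg U hU)
  have hG0 : G 0 = 0 := by simp [hGdef]
  have hGl : ∀ U ≤ 0, G U = -U / b := by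
    intro U hU
    have : G U = ∫ V in (0:ℝ)..U, -(b)⁻¹ := by
      refine intervalIntegral.integral_congr fun V hV => ?_
      rw [uIcc_of_ge hU] at hV
      show -(p V)⁻¹ = -b⁻¹
      rw [hlow V hV.2]
    rw [this]; simp; field_simp
  have hGu : ∀ U, a ≤ U → U < h → G U ≤ G a - (1/L) * (Real.log (h - a) - Real.log (h - U)) := by
    intro U haU hU
    have hk : AntitoneOn (fun U => G U - (1/L) * Real.log (h - U)) (Ico a h) := by
      have hdd : ∀ U ∈ Ico a h, HasDerivAt (fun U => G U - (1/L) * Real.log (h - U)) (-(p U)⁻¹ - (1/L) * ((-1)/(h-U))) U := by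
        intro U hU
        refine (hd U hU.2).sub (HasDerivAt.const_mul _ ?_)
        exact HasDerivAt.log ((hasDerivAt_id U).const_sub h) (by simpa using (sub_pos.2 hU.2).ne')
      refine antitoneOn_of_deriv_nonpos (convex_Ico a h) (fun U hU => (hdd U hU).continuousAt.continuousWithinAt)
        (fun U hU => ((hdd U (interior_subset hU)).differentiableAt.differentiableWithinAt)) (fun U hU => ?_)
      have hU := interior_subset hU
      rw [(hdd U hU).deriv]
      have h1 := hup U hU.1 hU.2
      have h2 := hpos U hU.2
      have h3 : 0 < h - U := sub_pos.2 hU.2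
      have h4 : (L * (h - U))⁻¹ ≤ (p U)⁻¹ := inv_anti₀ h2 h1
      have h5 : (1/L) * ((-1)/(h-U)) = - (L * (h-U))⁻¹ := by field_simp
      linarith
    have := hk ⟨le_rfl, hah⟩ ⟨haU, hU⟩ haU
    simp only at this
    linarith
  have him : G '' Iio h = univ := by
    refine eq_univ_of_forall fun y => ?_
    have hy1 : ∃ U₁ < h, y ≤ G U₁ := by
      refine ⟨min 0 (-(b * y)), lt_of_le_of_lt (min_le_left _ _) h0h, ?_⟩
      rw [hGl _ (min_le_left _ _), le_div_iff₀ hb]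
      have := min_le_right 0 (-(b*y)); linarith
    have hy2 : ∃ U₂ < h, G U₂ ≤ y := by
      set e := min (h - a) (Real.exp (L * (y - G a) + Real.log (h - a))) with he
      have hepos : 0 < e := lt_min (by linarith) (Real.exp_pos _)
      refine ⟨h - e, by linarith, (hGu _ (by linarith [min_le_left (h - a) (Real.exp (L * (y - G a) + Real.log (h - a)))]) (by linarith)).trans ?_⟩
      rw [sub_sub_cancel]
      have : Real.log e ≤ L * (y - G a) + Real.log (h - a) := by
        rw [Real.log_le_iff_le_exp hepos]; exact min_le_right _ _
      have h6 : (1/L) * (Real.log e - Real.log (h - a)) ≤ (1/L) * (L * (y - G a)) := mul_le_mul_of_nonneg_left (by linarith) (by positivity)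
      have h7 : (1/L) * (L * (y - G a)) = y - G a := by field_simp
      linarith
    obtain ⟨U₁, h1, h1'⟩ := hy1
    obtain ⟨U₂, h2, h2'⟩ := hy2
    have := (ordConnected_Iio (a := h)).isPreconnected.image _ hGc
    exact this.ordConnected.out (mem_image_of_mem _ h2) (mem_image_of_mem _ h1) ⟨h2', h1'⟩
  obtain ⟨Φ, hΦ, hinv, han⟩ := inv_deriv isOpen_Iio isOpen_univ hanti him hd (fun U hU => (hneg U hU).ne)
  refine ⟨Φ, fun s => ⟨(hΦ s trivial).1, ?_⟩, fun x y hxy => han trivial trivial hxy, ?_, fun U hU => ⟨G U, fun s hs => ?_⟩⟩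
  · have := (hΦ s trivial).2.2
    rwa [inv_neg, inv_inv] at this
  · have := hinv 0 h0h; rwa [hG0] at this
  · rw [← hinv U hU]; exact han.antitoneOn trivial trivial hs
end

section
open MeasureTheory Metric Set Filter
open scoped Topology RealInnerProductSpace NNReal Pointwise
set_option linter.unusedVariables false
set_option linter.unusedSectionVars false

structure F0 (f₀ : ℝ → ℝ) (θ₀ : ℝ) : Prop where
  th : θ₀ ∈ Ioo (0:ℝ) 1
  lip : ∃ L : ℝ≥0, LipschitzOnWith L f₀ (Icc 0 1)
  nonneg : ∀ u ∈ Icc (0:ℝ) 1, 0 ≤ f₀ u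
  low : ∀ u ∈ Icc (0:ℝ) θ₀, f₀ u = 0
  one : f₀ 1 = 0
  pos : ∀ u ∈ Ioo θ₀ 1, 0 < f₀ u

lemma F0.cont {f₀ : ℝ → ℝ} {θ₀ : ℝ} (h : F0 f₀ θ₀) : ContinuousOn f₀ (Icc 0 1) := by
  obtain ⟨L, hL⟩ := h.lip; exact hL.continuousOn

/-- the phase-plane representation of the front -/
lemma front_phase {f₀ : ℝ → ℝ} {θ₀ c₀ : ℝ} (h : F0 f₀ θ₀) (hc : 0 < c₀) (hf : IsTravelingFrontSpeed f₀ c₀) :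
    ∃ Q : ℝ → ℝ, (∀ U ∈ Ioo (0:ℝ) 1, 0 < Q U ∧ HasDerivAt Q (c₀ - f₀ U / Q U) U) ∧ (∀ U ∈ Ioc 0 θ₀, Q U = c₀ * U) ∧
      ∀ ε > 0, ∀ a < 1, ∃ U ∈ Ioo a 1, Q U < ε := by
  obtain ⟨U, U', hanti, hmem, hd, hd', hl, hr⟩ := hf
  have hnp : ∀ s, U' s ≤ 0 := fun s => by
    rw [← (hd s).deriv]; exact hanti.antitone.deriv_nonpos
  have hb : ∀ s, U s ≤ θ₀ → U' s = - (c₀ * U s) := by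
    intro s hs
    have hW : ∀ r ∈ Ici s, U' r + c₀ * U r = U' s + c₀ * U s := by
      intro r hr
      have hdW : ∀ r ∈ Ici s, HasDerivAt (fun r => U' r + c₀ * U r) 0 r := by
        intro r hr
        have := (hd' r).add ((hd r).const_mul c₀)
        rw [h.low (U r) ⟨(hmem r).1.le, (hanti.antitone hr).trans hs⟩] at this
        exact this.congr_deriv (by ring)
      exact ((convex_Ici s).is_const_of_fderivWithin_eq_zero (𝕜 := ℝ) (f := fun r => U' r + c₀ * U r)
        (fun r hr => (hdW r hr).differentiableAt.differentiableWithinAt)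
        (fun r hr => by
          rw [((hdW r hr).hasFDerivAt.hasFDerivWithinAt (s := Ici s)).fderivWithin (uniqueDiffOn_Ici s r hr)]
          ext; simp) hr self_mem_Ici)
    set C := U' s + c₀ * U s with hC
    rcases lt_trichotomy C 0 with hneg | hz | hpos
    · exfalso
      have hle : ∀ r, s ≤ r → U r - U s ≤ C * (r - s) := by
        intro r hr
        refine (convex_Ici s).image_sub_le_mul_sub_of_deriv_le (f := U) (fun x _ => (hd x).continuousAt.continuousWithinAt)
          (fun x _ => (hd x).differentiableAt.differentiableWithinAt) (fun x hx => ?_) s self_mem_Ici r hr hr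
        rw [(hd x).deriv]
        have := hW x (interior_subset hx)
        have := mul_pos hc (hmem x).1
        linarith
      have h1 := hle (s + 1 / (-C)) (by have : 0 < 1 / (-C) := one_div_pos.2 (by linarith); linarith)
      have h2 : C * (s + 1 / (-C) - s) = -1 := by
        have : C ≠ 0 := hneg.ne
        field_simp; ring
      have := (hmem (s + 1 / (-C))).1
      have := (hmem s).2
      linarith
    · linarith
    · exfalso
      have h1 : ∀ᶠ r in atTop, U r < C / c₀ := hr.eventually (gt_mem_nhds (by positivity))
      obtain ⟨r, h1, h2⟩ := (h1.and (eventually_ge_atTop s)).exists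
      have h3 := hW r h2
      rw [lt_div_iff₀ hc] at h1
      linarith [hnp r]
  have hneg : ∀ s, U' s < 0 := by
    intro s
    rcases le_or_gt (U s) θ₀ with hs | hs
    · rw [hb s hs]; have := mul_pos hc (hmem s).1; linarith
    · refine lt_of_le_of_ne (hnp s) fun h0 => ?_
      have h1 := hd' s
      have h2 := h.pos (U s) ⟨hs, (hmem s).2⟩
      rw [h0, mul_zero, neg_zero, zero_sub] at h1
      have hmax : IsLocalMax U' s := Eventually.of_forall fun r => by rw [h0]; exact hnp r
      have := hmax.hasDerivAt_eq_zero h1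
      linarith
  have hUc : Continuous U := continuous_iff_continuousAt.2 fun s => (hd s).continuousAt
  have him : U '' univ = Ioo 0 1 := by
    ext y
    constructor
    · rintro ⟨s, _, rfl⟩; exact hmem s
    · intro hy
      have h1 : ∀ᶠ r in atTop, U r < y := hr.eventually (gt_mem_nhds hy.1)
      have h2 : ∀ᶠ r in atBot, y < U r := hl.eventually (lt_mem_nhds hy.2)
      obtain ⟨r1, h1⟩ := h1.exists
      obtain ⟨r2, h2⟩ := h2.exists
      exact (isPreconnected_univ.image _ hUc.continuousOn).ordConnected.out (mem_image_of_mem _ (mem_univ r1)) (mem_image_of_mem _ (mem_univ r2)) ⟨h1.le, h2.le⟩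
  obtain ⟨E, hE, hinv, hEa⟩ := inv_deriv isOpen_univ isOpen_Ioo (fun x _ y _ hxy => hanti hxy) him (fun x _ => hd x) (fun x _ => (hneg x).ne)
  refine ⟨fun V => - U' (E V), fun V hV => ⟨by linarith [hneg (E V)], ?_⟩, fun V hV => ?_, ?_⟩
  · obtain ⟨_, h1, h2⟩ := hE V hV
    have := ((hd' (E V)).comp V h2).neg
    rw [h1] at this
    refine this.congr_deriv ?_
    have := (hneg (E V)).ne
    field_simp
    ring
  · obtain ⟨_, h1, h2⟩ := hE V ⟨hV.1, hV.2.trans_lt h.th.2⟩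
    simp only
    rw [hb (E V) (by rw [h1]; exact hV.2), h1]; ring
  · intro ε hε a ha
    by_contra hcon
    push Not at hcon
    have h2 : ∀ᶠ r in atBot, a < U r := hl.eventually (lt_mem_nhds ha)
    obtain ⟨S, hS⟩ := eventually_atBot.1 h2
    have hge : ∀ s ≤ S, ε ≤ - U' s := fun s hs => by
      have := hcon (U s) ⟨hS s hs, (hmem s).2⟩
      rwa [hinv s trivial] at this
    have hle : U S - U (S - 1/ε) ≤ (-ε) * (S - (S - 1/ε)) := by
      refine (convex_Iic S).image_sub_le_mul_sub_of_deriv_le (f := U) (fun x _ => (hd x).continuousAt.continuousWithinAt)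
          (fun x _ => (hd x).differentiableAt.differentiableWithinAt) (fun x hx => ?_) (S-1/ε) ?_ S self_mem_Iic ?_
      · rw [(hd x).deriv]; linarith [hge x (interior_subset (s := Iic S) hx)]
      · have : 0 < 1/ε := by positivity
        show S - 1/ε ≤ S
        linarith
      · have : 0 < 1/ε := by positivity
        linarith
    have h3 : (-ε) * (S - (S - 1/ε)) = -1 := by field_simp; ring
    have := (hmem (S-1/ε)).2
    have := (hmem S).1
    linarith

lemma cd2_of {Φ p q : ℝ → ℝ} {O : Set ℝ} (hO : IsOpen O) (h1 : ∀ s ∈ O, HasDerivAt Φ (-p s) s) (h2 : ∀ s ∈ O, HasDerivAt p (-q s) s)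
    (h3 : ContinuousOn q O) : ContDiffOn ℝ 2 Φ O := by
  have e : (2 : WithTop ℕ∞) = 1 + 1 := by norm_num
  rw [e, contDiffOn_succ_iff_deriv_of_isOpen hO]
  refine ⟨fun s hs => (h1 s hs).differentiableAt.differentiableWithinAt, by simp, ?_⟩
  have hp : ContDiffOn ℝ 1 (fun s => - p s) O := by
    have e : (1 : WithTop ℕ∞) = 0 + 1 := by norm_num
    rw [e, contDiffOn_succ_iff_deriv_of_isOpen hO]
    refine ⟨fun s hs => (h2 s hs).neg.differentiableAt.differentiableWithinAt, by simp, ?_⟩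
    rw [contDiffOn_zero]
    refine h3.congr fun s hs => ?_
    have := (h2 s hs).neg.deriv
    rw [neg_neg] at this
    exact this
  exact hp.congr fun s hs => (h1 s hs).deriv

/-- compactly supported planar subsolution profile -/
structure Prof (f₀ : ℝ → ℝ) (θ₀ c₂ ct h : ℝ) (Φ p q : ℝ → ℝ) : Prop where
  hc : c₂ < ct
  hh : h ∈ Ioo ((1+θ₀)/2) 1
  d1 : ∀ s, HasDerivAt Φ (-p s) s
  d2 : ∀ s, 0 < Φ s → HasDerivAt p (-q s) s ∧ ct * p s - f₀ (Φ s) ≤ q s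
  ppos : ∀ s, 0 < p s
  lt : ∀ s, Φ s < h
  anti : StrictAnti Φ
  zero : Φ 0 = 0
  lim : ∀ U < h, ∃ S, ∀ s ≤ S, U ≤ Φ s
  cd : ∀ s, 0 < Φ s → ContDiffAt ℝ 2 Φ s
  sink : ∃ S, ∀ s ≤ S, ct * p s ≤ f₀ (Φ s)

lemma prof_exists {f₀ : ℝ → ℝ} {θ₀ c₀ c₂ : ℝ} (h : F0 f₀ θ₀) (hc : 0 < c₀) (hf : IsTravelingFrontSpeed f₀ c₀) (hc0 : 0 ≤ c₂) (hc2 : c₂ < c₀) :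
    ∃ ct h Φ p q, Prof f₀ θ₀ c₂ ct h Φ p q := by
  obtain ⟨Q, hQ, hQl, hQ1⟩ := front_phase h hc hf
  have th := h.th
  have hQc : ContinuousOn Q (Ioo 0 1) := fun U hU => (hQ U hU).2.continuousAt.continuousWithinAt
  -- min of Q on [θ₀/2,(1+θ₀)/2]
  obtain ⟨m, hm0, hm⟩ : ∃ m > 0, ∀ U ∈ Icc (θ₀/2) ((1+θ₀)/2), m ≤ Q U := by
    obtain ⟨V, hV, hmin⟩ := isCompact_Icc.exists_isMinOn (nonempty_Icc.2 (by linarith [th.1]))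
      (hQc.mono (fun U hU => ⟨by linarith [hU.1, th.1], by linarith [hU.2, th.2]⟩ : Icc (θ₀/2) ((1+θ₀)/2) ⊆ Ioo 0 1))
    exact ⟨Q V, (hQ V ⟨by linarith [hV.1, th.1], by linarith [hV.2, th.2]⟩).1, fun U hU => hmin hU⟩
  obtain ⟨κ, hκ0, hκ1, hκ2⟩ : ∃ κ > 0, κ < c₀ - c₂ ∧ κ < m :=
    ⟨min (c₀ - c₂) m / 2, by have := lt_min (sub_pos.2 hc2) hm0; positivity,
      by have := lt_min (sub_pos.2 hc2) hm0; have := min_le_left (c₀ - c₂) m; linarith,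
      by have := lt_min (sub_pos.2 hc2) hm0; have := min_le_right (c₀ - c₂) m; linarith⟩
  set b := κ * θ₀ / 2 with hb
  have hb0 : 0 < b := by have := th.1; positivity
  set P : ℝ → ℝ := fun U => if U ≤ 0 then b else Q U - κ * U + b with hP
  have hPl : ∀ U ≤ 0, P U = b := fun U hU => by simp [hP, hU]
  have hPp : ∀ U, 0 < U → P U = Q U - κ * U + b := fun U hU => by simp [hP, not_le.2 hU]
  have hPd : ∀ U ∈ Ioo (0:ℝ) 1, HasDerivAt P (c₀ - f₀ U / Q U - κ) U := by
    intro U hU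
    have h1 := ((hQ U hU).2.sub ((hasDerivAt_id U).const_mul κ)).add_const b
    simp only [mul_one] at h1
    refine h1.congr_of_eventuallyEq ?_
    filter_upwards [lt_mem_nhds hU.1] with V hV
    rw [hPp V hV]; simp
  -- zero set
  obtain ⟨U₁, hU₁, hQU₁⟩ := hQ1 (κ * θ₀/2) (by have := th.1; positivity) ((1+θ₀)/2) (by linarith [th.2])
  have hlowpos : ∀ U, 0 < U → U ≤ (1+θ₀)/2 → 0 < P U := by
    intro U h0 h1
    rw [hPp U h0]
    rcases le_or_gt U (θ₀/2) with h2 | h2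
    · rw [hQl U ⟨h0, by linarith⟩]
      have : 0 < (c₀ - κ) * U := mul_pos (by linarith) h0
      nlinarith
    · have := hm U ⟨h2.le, h1⟩
      nlinarith [th.2]
  set Z := {U | U ∈ Icc ((1+θ₀)/2) U₁ ∧ P U ≤ 0} with hZ
  have hPc1 : ContinuousOn P (Ioo 0 1) := fun U hU => (hPd U hU).continuousAt.continuousWithinAt
  have hsub : Icc ((1+θ₀)/2) U₁ ⊆ Ioo 0 1 := fun U hU => ⟨by linarith [hU.1, th.1], by linarith [hU.2, hU₁.2]⟩
  have hZc : IsCompact Z := by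
    refine isCompact_Icc.of_isClosed_subset ?_ (fun U hU => hU.1) (s := Icc ((1+θ₀)/2) U₁)
    exact (hPc1.mono hsub).preimage_isClosed_of_isClosed isClosed_Icc isClosed_Iic
  have hZne : Z.Nonempty := by
    refine ⟨U₁, ⟨hU₁.1.le, le_rfl⟩, ?_⟩
    rw [hPp U₁ (by linarith [hU₁.1, th.1])]
    have : κ * θ₀ ≤ κ * U₁ := mul_le_mul_of_nonneg_left (by linarith [hU₁.1, th.2]) hκ0.le
    linarith
  obtain ⟨hh, hhZ, hhmin⟩ := hZc.exists_isLeast hZne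
  have hh1 : hh < 1 := by linarith [hhZ.1.2, hU₁.2]
  have hh0 : (1+θ₀)/2 < hh := by
    refine lt_of_le_of_ne hhZ.1.1 fun he => ?_
    have := hlowpos hh (by linarith [hhZ.1.1, th.1]) he.symm.le
    linarith [hhZ.2]
  have hpos : ∀ U < hh, 0 < P U := by
    intro U hU
    rcases le_or_gt U 0 with h0 | h0
    · rw [hPl U h0]; exact hb0
    rcases le_or_gt U ((1+θ₀)/2) with h1 | h1
    · exact hlowpos U h0 h1
    · by_contra hcon
      push Not at hcon
      have := hhmin ⟨⟨h1.le, hU.le.trans hhZ.1.2⟩, hcon⟩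
      linarith
  have hPh : P hh ≤ 0 := hhZ.2
  -- continuity on Iio hh
  have hPc : ContinuousOn P (Iio hh) := by
    intro U hU
    have hU : U < hh := hU
    refine ContinuousAt.continuousWithinAt ?_
    rcases lt_or_ge 0 U with h0 | h0
    · exact (hPd U ⟨h0, by linarith⟩).continuousAt
    · have hc3 : ContinuousAt (fun V => (c₀ - κ) * max V 0 + b) U := by fun_prop
      refine hc3.congr ?_
      filter_upwards [gt_mem_nhds (show U < θ₀ by linarith [th.1])] with V hV
      rcases le_or_gt V 0 with h4 | h4
      · rw [hPl V h4, max_eq_right h4]; ring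
      · rw [hPp V h4, max_eq_left h4.le, hQl V ⟨h4, hV.le⟩]; ring
  -- Lipschitz bound near hh
  obtain ⟨m₂, hm₂0, hm₂⟩ : ∃ m > 0, ∀ U ∈ Icc (θ₀/2) hh, m ≤ Q U := by
    have hs2 : Icc (θ₀/2) hh ⊆ Ioo 0 1 := fun U hU => ⟨by linarith [hU.1, th.1], by linarith [hU.2]⟩
    obtain ⟨V, hV, hmin⟩ := isCompact_Icc.exists_isMinOn (nonempty_Icc.2 (by linarith [th.1])) (hQc.mono hs2)
    exact ⟨Q V, (hQ V (hs2 hV)).1, fun U hU => hmin hU⟩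
  obtain ⟨Fm, hFm⟩ : ∃ Fm, ∀ U ∈ Icc (0:ℝ) 1, f₀ U ≤ Fm := by
    obtain ⟨C, hC⟩ := isCompact_Icc.bddAbove_image h.cont
    exact ⟨C, fun U hU => hC (mem_image_of_mem _ hU)⟩
  have hFm0 : 0 ≤ Fm := (h.nonneg 0 (by simp)).trans (hFm 0 (by simp))
  set L := κ + Fm / m₂ with hL
  have hL0 : 0 < L := by positivity
  have hup : ∀ U, θ₀/2 ≤ U → U < hh → P U ≤ L * (hh - U) := by
    intro U h0 h1
    have hs2 : Icc (θ₀/2) hh ⊆ Ioo 0 1 := fun U hU => ⟨by linarith [hU.1, th.1], by linarith [hU.2]⟩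
    have := (convex_Icc (θ₀/2) hh).mul_sub_le_image_sub_of_le_deriv (f := P) (C := -L) (hPc1.mono hs2)
      (fun x hx => (hPd x (hs2 (interior_subset hx))).differentiableAt.differentiableWithinAt)
      (fun x hx => by
        have hx := interior_subset hx
        rw [(hPd x (hs2 hx)).deriv]
        have h2 : f₀ x / Q x ≤ Fm / m₂ := div_le_div₀ hFm0 (hFm x (Ioo_subset_Icc_self (hs2 hx))) hm₂0 (hm₂ x hx)
        linarith) U ⟨h0, h1.le⟩ hh ⟨by linarith, le_rfl⟩ h1.le
    linarith
  obtain ⟨Φ, h1, h2, h3, h4⟩ := ode_inv (h := hh) (a := θ₀/2) (b := b) (L := L) (by linarith [th.1]) (by linarith [th.1]) hb0 hL0 hPc hpos hPl hup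
  have hΦc : Continuous Φ := continuous_iff_continuousAt.2 fun s => (h1 s).2.continuousAt
  have hpd : ∀ s, 0 < Φ s → HasDerivAt (fun s => P (Φ s)) (-(P (Φ s) * (c₀ - f₀ (Φ s) / Q (Φ s) - κ))) s := fun s hs => by
    have := (hPd (Φ s) ⟨hs, (h1 s).1.trans hh1⟩).comp s (h1 s).2
    exact this.congr_deriv (by ring)
  refine ⟨c₀ - κ, hh, Φ, fun s => P (Φ s), fun s => P (Φ s) * (c₀ - f₀ (Φ s) / Q (Φ s) - κ),
    ⟨by linarith, ⟨hh0, hh1⟩, fun s => (h1 s).2, fun s hs => ⟨?_, ?_⟩, fun s => hpos _ (h1 s).1, fun s => (h1 s).1, h2, h3, h4, ?_, ?_⟩⟩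
  · exact hpd s hs
  · set V := Φ s with hV
    have hVm : V ∈ Ioo (0:ℝ) 1 := ⟨hs, (h1 s).1.trans hh1⟩
    have hQp := (hQ V hVm).1
    have e : P V * (c₀ - f₀ V / Q V - κ) - ((c₀ - κ) * P V - f₀ V) = f₀ V * (κ * V - b) / Q V := by
      rw [hPp V hs]; field_simp; ring
    have : 0 ≤ f₀ V * (κ * V - b) / Q V := by
      refine div_nonneg ?_ hQp.le
      rcases le_or_gt V θ₀ with h5 | h5
      · rw [h.low V ⟨hs.le, h5⟩, zero_mul]
      · refine mul_nonneg (h.nonneg V ⟨hs.le, hVm.2.le⟩) ?_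
        have := mul_le_mul_of_nonneg_left h5.le hκ0.le
        have := mul_pos hκ0 th.1
        linarith
    linarith
  · intro s hs
    have hO : IsOpen {s | 0 < Φ s} := isOpen_lt continuous_const hΦc
    refine (cd2_of hO (fun s _ => (h1 s).2) (fun s hs => hpd s hs) ?_).contDiffAt (hO.mem_nhds hs)
    intro r hr
    have hr : 0 < Φ r := hr
    have hm : Φ r ∈ Ioo (0:ℝ) 1 := ⟨hr, (h1 r).1.trans hh1⟩
    have c1 : ContinuousAt P (Φ r) := (hPd _ hm).continuousAt
    have c2 : ContinuousAt Q (Φ r) := (hQ _ hm).2.continuousAt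
    have c3 : ContinuousAt f₀ (Φ r) := h.cont.continuousAt (Icc_mem_nhds hm.1 hm.2)
    have c4 : ContinuousAt (fun V => P V * (c₀ - f₀ V / Q V - κ)) (Φ r) :=
      c1.mul (((continuousAt_const).sub (c3.div c2 (hQ _ hm).1.ne')).sub continuousAt_const)
    exact (ContinuousAt.comp (f := Φ) c4 hΦc.continuousAt).continuousWithinAt
  · have hfh : 0 < f₀ hh := h.pos hh ⟨by linarith [th.2], hh1⟩
    have hfc : ContinuousAt f₀ hh := h.cont.continuousAt (Icc_mem_nhds (by linarith [th.1]) hh1)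
    have he1 : ∀ᶠ U in 𝓝 hh, f₀ hh / 2 < f₀ U := hfc.tendsto.eventually (lt_mem_nhds (by linarith))
    obtain ⟨δ, hδ, hδ2⟩ := Metric.eventually_nhds_iff.1 he1
    have hct : 0 < c₀ - κ := by linarith
    set η := min (δ/2) (min (hh - θ₀/2) (f₀ hh / 2 / ((c₀ - κ) * L))) with hη
    have hη0 : 0 < η := lt_min (by linarith) (lt_min (by linarith [th.1]) (by positivity))
    obtain ⟨S, hS⟩ := h4 (hh - η) (by linarith)
    refine ⟨S, fun s hs => ?_⟩
    have h5 := hS s hs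
    have h6 := (h1 s).1
    have e1 := min_le_left (δ/2) (min (hh - θ₀/2) (f₀ hh / 2 / ((c₀ - κ) * L)))
    have e2 := (min_le_right (δ/2) (min (hh - θ₀/2) (f₀ hh / 2 / ((c₀ - κ) * L))))
    have e3 := e2.trans (min_le_left _ _)
    have e4 := e2.trans (min_le_right _ _)
    have h7 := hup (Φ s) (by linarith) h6
    have h8 := hδ2 (y := Φ s) (by rw [Real.dist_eq, abs_lt]; constructor <;> linarith)
    have h9 : L * (hh - Φ s) ≤ L * (f₀ hh / 2 / ((c₀ - κ) * L)) := mul_le_mul_of_nonneg_left (by linarith) hL0.le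
    calc (c₀ - κ) * P (Φ s) ≤ (c₀ - κ) * (L * (f₀ hh / 2 / ((c₀ - κ) * L))) := mul_le_mul_of_nonneg_left (h7.trans h9) hct.le
      _ = f₀ hh / 2 := by field_simp
      _ ≤ _ := h8.le
end

section
open MeasureTheory Metric Set Filter
open scoped Topology RealInnerProductSpace NNReal Pointwise
set_option linter.unusedVariables false
set_option linter.unusedSectionVars false
variable {d : ℕ}

structure Ctx (f₀ : ℝ → ℝ) (M θ₀ θ ζ ξ : ℝ) (F : Euc d → ℝ → ℝ) : Prop extends Rx F M where
  f0_le : ∀ x u, u ∈ Icc (0:ℝ) 1 → f₀ u ≤ F x u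
  ign : ∀ x, ∀ u ∈ Icc (0:ℝ) θ, F x u = 0
  anti : ∀ x, AntitoneOn (F x) (Icc (1-θ) 1)
  per : ∀ x a b, a ∈ Icc (0:ℝ) 1 → ζ * a < F x a → a ≤ b → b ≤ θ₀ → ξ ≤ F x b

/-- ball growth -/
lemma lemG {f₀ : ℝ → ℝ} {M θ₀ θ ζ ξ : ℝ} (h0 : F0 f₀ θ₀) {η : ℝ} (hη : 0 < η) (hη1 : η < (1-θ₀)/2) :
    ∃ T > 0, ∃ R > 0, ∀ (F : Euc d → ℝ → ℝ), Ctx f₀ M θ₀ θ ζ ξ F → ∀ g u, IsSolR F g u → ∀ x₀ : Euc d,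
      (∀ y, ‖y - x₀‖ < R → (1+θ₀)/2 ≤ g y ∧ ContinuousAt g y) → 1 - η ≤ u T x₀ := by
  have th := h0.th
  set a := (1+3*θ₀)/4 with ha
  have hsub : Icc a (1-η/2) ⊆ Ioo θ₀ 1 := fun U hU => ⟨by linarith [hU.1, th.2], by linarith [hU.2]⟩
  obtain ⟨m, hm0, hm⟩ : ∃ m > 0, ∀ U ∈ Icc a (1-η/2), m ≤ f₀ U := by
    obtain ⟨V, hV, hmin⟩ := isCompact_Icc.exists_isMinOn (nonempty_Icc.2 (by linarith : a ≤ 1-η/2))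
      (h0.cont.mono (fun U hU => ⟨by linarith [(hsub hU).1, th.1], by linarith [(hsub hU).2]⟩ : Icc a (1-η/2) ⊆ Icc 0 1))
    exact ⟨f₀ V, h0.pos V (hsub hV), fun U hU => hmin hU⟩
  set T := (1-η/2-(1+θ₀)/2)/m with hT
  have hT0 : 0 < T := div_pos (by linarith) hm0
  have hmT : m * T = 1-η/2-(1+θ₀)/2 := by rw [hT]; field_simp
  set B := 1 + d + 4*m/(1-θ₀) with hB
  have hθ1 : 0 < 1 - θ₀ := by linarith [th.2]
  have hB0 : 0 < B := by positivity
  set R := B * T + 1 + |Real.log (η/2)| with hR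
  have hR0 : 0 < R := by positivity
  refine ⟨T, hT0, R, hR0, fun F hF g u hu x₀ hg => ?_⟩
  set v : ℝ → Euc d → ℝ := fun t x => ((1+θ₀)/2 + m * t) - Real.exp (rad 1 x₀ x + (B * t - R)) with hv
  have hrc := rad_continuous (d := d) one_pos x₀
  have hvc : Continuous (fun p : ℝ × Euc d => v p.1 p.2) := by
    simp only [hv]; fun_prop
  have hmt : ∀ t ∈ Ioc 0 T, m * t ≤ 1-η/2-(1+θ₀)/2 := fun t ht => by
    rw [← hmT]; exact mul_le_mul_of_nonneg_left ht.2 hm0.le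
  have key := sub_le hF.toRx hu T (v := v) (fun t ht x => by
      have := hmt t ht
      have := Real.exp_pos (rad 1 x₀ x + (B * t - R))
      simp only [hv]; linarith) hvc.continuousOn
    (fun t ht x hpos => by
      set E := Real.exp (rad 1 x₀ x + (B * t - R)) with hE
      have hE0 : 0 < E := Real.exp_pos _
      have hcd : ContDiffAt ℝ 2 (fun x => Real.exp (rad 1 x₀ x + (B * t - R))) x :=
        (((rad_contDiff one_pos x₀).add contDiff_const).exp).contDiffAt
      refine ⟨contDiffAt_const.sub hcd, m - B * E, ?_, ?_⟩
      · have h1 : HasDerivAt (fun s : ℝ => (1+θ₀)/2 + m * s) m t := by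
          simpa using ((hasDerivAt_id t).const_mul m).const_add ((1+θ₀)/2)
        have h2 : HasDerivAt (fun s : ℝ => rad 1 x₀ x + (B * s - R)) B t := by
          simpa using (((hasDerivAt_id t).const_mul B).sub_const R).const_add (rad 1 x₀ x)
        exact (h1.sub h2.exp).congr_deriv (by rw [← hE]; ring)
      · have hlap : lap (v t) x = - lap (fun x => Real.exp (rad 1 x₀ x + (B * t - R))) x := by
          simp only [hv]
          rw [lap_sub contDiffAt_const hcd, lap_const]; ring
        have hφ : ∀ s, HasDerivAt (fun s => Real.exp (s + (B*t-R))) (Real.exp (s + (B*t-R))) s := fun s => by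
          simpa using ((hasDerivAt_id s).add_const (B*t-R)).exp
        rw [hlap, lap_rad one_pos x₀ x hφ (hφ _), ← hE]
        have hr0 := rad_pos (d := d) one_pos x₀ x
        have hr1 := A_le_rad (d := d) one_pos x₀ x
        have hr2 := rad_sq 1 x₀ x
        set r := rad 1 x₀ x
        have e1 : ‖x - x₀‖ ^ 2 / r ^ 2 ≤ 1 := by
          rw [div_le_one (by positivity), hr2]; linarith [sq_nonneg (1:ℝ)]
        have e2 : (d:ℝ) / r ≤ d := div_le_self (by positivity) hr1
        have e3 : 0 ≤ ‖x - x₀‖ ^ 2 / r ^ 3 := by positivity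
        have e4 : E * (‖x - x₀‖ ^ 2 / r ^ 2) + E * (d / r - ‖x - x₀‖ ^ 2 / r ^ 3) ≤ E * (1 + d) := by
          rw [← mul_add]; exact mul_le_mul_of_nonneg_left (by linarith) hE0.le
        have hvdef : v t x = ((1+θ₀)/2 + m * t) - E := rfl
        have hmt' := hmt t ht
        have hmt0 : 0 ≤ m * t := mul_nonneg hm0.le ht.1.le
        have hBE : B * E = E * (1 + d) + 4*m/(1-θ₀) * E := by rw [hB]; ring
        have hv01 : v t x ∈ Icc (0:ℝ) 1 := ⟨hpos.le, by linarith⟩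
        rcases le_or_gt a (v t x) with h3 | h3
        · have h5 := hm (v t x) ⟨h3, by linarith⟩
          have h6 := hF.f0_le x _ hv01
          have h7 : 0 ≤ 4*m/(1-θ₀) * E := by positivity
          linarith
        · have h5 := hF.nonneg x _ hv01
          have h6 : (1-θ₀)/4 ≤ E := by linarith
          have h7 : 4*m/(1-θ₀) * ((1-θ₀)/4) ≤ 4*m/(1-θ₀) * E := mul_le_mul_of_nonneg_left h6 (by positivity)
          have h8 : 4*m/(1-θ₀) * ((1-θ₀)/4) = m := by field_simp
          linarith)
    (fun y => init_ok hu hvc.continuousAt (by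
      by_cases hy : ‖y - x₀‖ < R
      · right
        refine ⟨(hg y hy).2, le_trans ?_ (hg y hy).1⟩
        have := Real.exp_pos (rad 1 x₀ y + (B * 0 - R))
        simp only [hv]; linarith
      · left
        have h1 : 1 ≤ Real.exp (rad 1 x₀ y + (B * 0 - R)) := Real.one_le_exp (by
          have := le_rad (d := d) one_pos x₀ y
          linarith)
        simp only [hv]; linarith [th.2])) T ⟨hT0, le_rfl⟩ x₀
  refine le_trans ?_ key
  simp only [hv]
  rw [rad_self one_pos, hmT]
  have : Real.exp (1 + (B * T - R)) ≤ η/2 := by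
    calc Real.exp (1 + (B * T - R)) ≤ Real.exp (Real.log (η/2)) := Real.exp_le_exp.2 (by
          have := neg_abs_le (Real.log (η/2)); linarith)
      _ = η/2 := Real.exp_log (by linarith)
  linarith

lemma planar_sub {f₀ : ℝ → ℝ} {M θ₀ θ ζ ξ : ℝ} {c₂ ct h : ℝ} {Φ p q : ℝ → ℝ} (hP : Prof f₀ θ₀ c₂ ct h Φ p q)
    {F : Euc d → ℝ → ℝ} (hF : Ctx f₀ M θ₀ θ ζ ξ F) {g : Euc d → ℝ} {u : ℝ → Euc d → ℝ} (hu : IsSolR F g u) (hg : Continuous g)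
    {e : Euc d} (he : ‖e‖ = 1) {a : ℝ} (hle : ∀ x, Φ (⟪x, e⟫ + a) ≤ g x) {t : ℝ} (ht : 0 ≤ t) (x : Euc d) :
    Φ (⟪x, e⟫ + (a - ct * t)) ≤ u t x := by
  have hΦc : Continuous Φ := continuous_iff_continuousAt.2 fun s => (hP.d1 s).continuousAt
  rcases eq_or_lt_of_le ht with h0 | h0
  · rw [← h0, hu.at_zero, mul_zero, sub_zero]; exact hle x
  have hvc : Continuous (fun p : ℝ × Euc d => Φ (⟪p.2, e⟫ + (a - ct * p.1))) := by fun_prop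
  refine sub_le hF.toRx hu t (v := fun t x => Φ (⟪x, e⟫ + (a - ct * t))) (fun t ht x => ((hP.lt _).trans hP.hh.2).le) hvc.continuousOn
    (fun t ht x hpos => ?_) (fun y => init_ok hu (v := fun t x => Φ (⟪x, e⟫ + (a - ct * t))) (x₀ := y) hvc.continuousAt (Or.inr ⟨hg.continuousAt, by simpa using hle y⟩)) t ⟨h0, le_rfl⟩ x
  have hcd := hP.cd _ hpos
  refine ⟨?_, ct * p (⟪x, e⟫ + (a - ct * t)), ?_, ?_⟩
  · exact ContDiffAt.comp (g := Φ) (f := fun x : Euc d => ⟪x, e⟫ + (a - ct * t)) x hcd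
      ((contDiff_id.inner ℝ contDiff_const).add contDiff_const).contDiffAt
  · have h2 : HasDerivAt (fun s : ℝ => ⟪x, e⟫ + (a - ct * s)) (-ct) t := by
      simpa using (((hasDerivAt_id t).const_mul ct).const_sub a).const_add ⟪x, e⟫
    exact ((hP.d1 _).comp t h2).congr_deriv (by ring)
  · have h2 := hP.d2 _ hpos
    have h3 : lap (fun x : Euc d => Φ (⟪x, e⟫ + (a - ct * t))) x = q (⟪x, e⟫ + (a - ct * t)) := by
      rw [lap_planar he (a - ct * t) x (φ' := fun s => - p s) hP.d1 h2.1.neg, neg_neg]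
    rw [h3]
    have := hF.f0_le x _ ⟨hpos.le, ((hP.lt _).trans hP.hh.2).le⟩
    linarith [h2.2]

lemma radial_sub {f₀ : ℝ → ℝ} {M θ₀ θ ζ ξ : ℝ} {c₂ ct h : ℝ} {Φ p q : ℝ → ℝ} (h0 : F0 f₀ θ₀) (hc2 : 0 < c₂) (hP : Prof f₀ θ₀ c₂ ct h Φ p q) :
    ∃ A > 0, ∃ R > 0, ∀ (F : Euc d → ℝ → ℝ), Ctx f₀ M θ₀ θ ζ ξ F → ∀ g u, IsSolR F g u → ∀ x₀ : Euc d,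
      (∀ y, ‖y - x₀‖ < R → h ≤ g y ∧ ContinuousAt g y) → ∀ t > 0, ∀ x, Φ (rad A x₀ x + (-(c₂ * t) - R)) ≤ u t x := by
  have hct : 0 < ct := hc2.trans hP.hc
  have hΦc : Continuous Φ := continuous_iff_continuousAt.2 fun s => (hP.d1 s).continuousAt
  obtain ⟨S, hS⟩ := hP.sink
  set κ := ct - c₂ with hκ
  have hκ0 : 0 < κ := sub_pos.2 hP.hc
  set A := 2 * (d + 1) / κ with hA
  have hA0 : 0 < A := by positivity
  have hdA : (d:ℝ) / A ≤ κ / 2 := by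
    rw [div_le_iff₀ hA0, hA]; field_simp; linarith
  set D := A * (1 + 2 * ct / κ) with hD
  have hD0 : 0 < D := by positivity
  set R := D + |S| + A with hR
  have hR0 : 0 < R := by positivity
  refine ⟨A, hA0, R, hR0, fun F hF g u hu x₀ hg t ht x => ?_⟩
  have hrc := rad_continuous (d := d) hA0 x₀
  have hvc : Continuous (fun p : ℝ × Euc d => Φ (rad A x₀ p.2 + (-(c₂ * p.1) - R))) := by fun_prop
  refine sub_le hF.toRx hu t (v := fun t x => Φ (rad A x₀ x + (-(c₂ * t) - R))) (fun t ht x => ((hP.lt _).trans hP.hh.2).le) hvc.continuousOn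
    (fun t ht x hpos => ?_) (fun y => init_ok hu (v := fun t x => Φ (rad A x₀ x + (-(c₂ * t) - R))) (x₀ := y) hvc.continuousAt ?_) t ⟨ht, le_rfl⟩ x
  · set s := rad A x₀ x + (-(c₂ * t) - R) with hs
    have hcd := hP.cd _ hpos
    refine ⟨?_, c₂ * p s, ?_, ?_⟩
    · exact ContDiffAt.comp (g := Φ) (f := fun x : Euc d => rad A x₀ x + (-(c₂ * t) - R)) x hcd
        ((rad_contDiff hA0 x₀).add contDiff_const).contDiffAt
    · have h2 : HasDerivAt (fun s : ℝ => rad A x₀ x + (-(c₂ * s) - R)) (-c₂) t := by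
        simpa using ((((hasDerivAt_id t).const_mul c₂).neg).sub_const R).const_add (rad A x₀ x)
      exact ((hP.d1 _).comp t h2).congr_deriv (by rw [← hs]; ring)
    · have h2 := hP.d2 _ hpos
      have hsh : ∀ r, HasDerivAt (fun r : ℝ => r + (-(c₂ * t) - R)) 1 r := fun r => (hasDerivAt_id r).add_const _
      have h3 := lap_rad hA0 x₀ x (φ := fun r => Φ (r + (-(c₂ * t) - R))) (φ' := fun r => - p (r + (-(c₂ * t) - R))) (φ'' := q s)
        (fun r => ((hP.d1 _).comp r (hsh r)).congr_deriv (by ring))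
        (by
          have := (h2.1.neg).comp (rad A x₀ x) (hsh _)
          exact this.congr_deriv (by ring))
      rw [h3, ← hs]
      have hfl := hF.f0_le x _ ⟨hpos.le, ((hP.lt _).trans hP.hh.2).le⟩
      have hf0 := h0.nonneg (Φ s) ⟨hpos.le, ((hP.lt _).trans hP.hh.2).le⟩
      have hr0 := rad_pos (d := d) hA0 x₀ x
      have hr1 := A_le_rad (d := d) hA0 x₀ x
      have hr2 := rad_sq A x₀ x
      have hp0 := hP.ppos s
      have hq := h2.2
      show c₂ * p s ≤ _ + F x (Φ s)
      set r := rad A x₀ x with hr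
      have e1 : ‖x - x₀‖ ^ 2 / r ^ 2 = 1 - A^2/r^2 := by
        rw [eq_sub_iff_add_eq, ← add_div, div_eq_one_iff_eq (by positivity)]; linarith
      have hα0 : 0 ≤ A^2/r^2 := by positivity
      have hα1 : 0 ≤ 1 - A^2/r^2 := by rw [← e1]; positivity
      have e2 : (d:ℝ) / r ≤ κ/2 := (div_le_div_of_nonneg_left (by positivity) hA0 hr1).trans hdA
      have e3 : 0 ≤ ‖x - x₀‖ ^ 2 / r ^ 3 := by positivity
      rw [e1]
      set α := A^2/r^2 with hα
      have e4 : (1-α) * (ct * p s - f₀ (Φ s)) ≤ q s * (1-α) := by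
        rw [mul_comm (q s)]; exact mul_le_mul_of_nonneg_left hq hα1
      have e5 : p s * (d / r - ‖x - x₀‖^2/r^3) ≤ p s * (κ/2) := mul_le_mul_of_nonneg_left (by linarith) hp0.le
      have e6 : α * (ct * p s - f₀ (Φ s)) ≤ κ/2 * p s := by
        rcases le_or_gt s S with h5 | h5
        · have := hS s h5
          have h6 : α * (ct * p s - f₀ (Φ s)) ≤ 0 := mul_nonpos_of_nonneg_of_nonpos hα0 (by linarith)
          have h7 : 0 ≤ κ/2 * p s := by positivity
          linarith
        · have h6 : D ≤ r := by
            have h7 : 0 < c₂ * t := mul_pos hc2 ht.1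
            have := neg_abs_le S
            have : 0 ≤ A := hA0.le
            linarith
          have h8 : α * ct ≤ κ/2 := by
            have h9 : A^2 * (2*ct/κ) ≤ r^2 := by
              have h10 : D^2 ≤ r^2 := by gcongr
              have h11 : A^2 * (2*ct/κ) ≤ D^2 := by
                have hy : 0 < 2*ct/κ := by positivity
                rw [hD, mul_pow]
                refine mul_le_mul_of_nonneg_left ?_ (by positivity)
                nlinarith
              linarith
            rw [hα, div_mul_eq_mul_div, div_le_iff₀ (by positivity)]
            have h12 : A^2*ct = κ/2 * (A^2 * (2*ct/κ)) := by field_simp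
            rw [h12]
            exact mul_le_mul_of_nonneg_left h9 (by positivity)
          have h13 : 0 ≤ α * f₀ (Φ s) := mul_nonneg hα0 hf0
          have h14 : α * ct * p s ≤ κ/2 * p s := mul_le_mul_of_nonneg_right h8 hp0.le
          linarith
      have e7 : (1-α) * (ct * p s - f₀ (Φ s)) = ct * p s - f₀ (Φ s) - α * (ct * p s - f₀ (Φ s)) := by ring
      have e8 : c₂ * p s = ct * p s - κ * p s := by rw [hκ]; ring
      linarith
  · by_cases hy : ‖y - x₀‖ < R
    · exact Or.inr ⟨(hg y hy).2, (hP.lt _).le.trans (hg y hy).1⟩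
    · left
      have h1 := le_rad hA0 x₀ y
      have h2 : Φ (rad A x₀ y + (-(c₂ * 0) - R)) ≤ Φ 0 := hP.anti.antitone (by linarith)
      rw [hP.zero] at h2
      exact h2
end

section
open MeasureTheory Metric Set Filter
open scoped Topology RealInnerProductSpace NNReal Pointwise
set_option linter.unusedVariables false
set_option linter.unusedSectionVars false
variable {d : ℕ}

lemma yker_int {B : ℝ} {φ : Euc d → ℝ} (hφ : Measurable φ) (hb : ∀ x, |φ x| ≤ B) {c : ℝ} (hc : c ≠ 0) (x : Euc d) :
    Integrable (fun y => φ y * gm (c • (x - y))) := by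
  have h1 : Integrable (fun y : Euc d => gm (c • (x - y))) :=
    ((gm_GB (d := d)).integrable.comp_smul hc).comp_sub_left x
  refine h1.bdd_mul (c := B) hφ.aestronglyMeasurable (Eventually.of_forall fun y => hb y)

def gcst (d : ℕ) : ℝ := ((Real.sqrt (4 * Real.pi))⁻¹) ^ d
lemma gcst_pos (d : ℕ) : 0 < gcst d := by unfold gcst; positivity
def vr (d : ℕ) (r : ℝ) : ℝ := volume.real (ball (0 : Euc d) r)
lemma vr_pos (d : ℕ) {r : ℝ} (hr : 0 < r) : 0 < vr d r := by
  unfold vr Measure.real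
  exact ENNReal.toReal_pos (measure_ball_pos _ _ hr).ne' measure_ball_lt_top.ne
lemma vr_eq (x : Euc d) (r : ℝ) : volume.real (ball x r) = vr d r := by
  unfold vr Measure.real; rw [Measure.addHaar_ball_center volume x r]

lemma Pt_ge_ball {B : ℝ} {φ : Euc d → ℝ} (hφ : Measurable φ) (hb : ∀ x, |φ x| ≤ B) (h0 : ∀ x, 0 ≤ φ x) {m : ℝ} (hm : 0 ≤ m) {x x' : Euc d} {r : ℝ}
    (hr : 0 < r) (hball : ∀ y, ‖y - x'‖ < r → m ≤ φ y) {τ : ℝ} (hτ : 0 < τ) {D : ℝ} (hD : ‖x - x'‖ ≤ D) :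
    m * ((Real.sqrt τ)⁻¹ ^ d * (gcst d * Real.exp (-(1/4) * ((D + r)^2 / τ))) * vr d r) ≤ Ak gm τ φ x := by
  have hs : 0 < Real.sqrt τ := Real.sqrt_pos.2 hτ
  rw [Ak_y gm hτ, smul_eq_mul]
  simp only [smul_eq_mul]
  set c := (Real.sqrt τ)⁻¹ with hc
  have hc0 : 0 < c := inv_pos.2 hs
  have hIntg := yker_int hφ hb hc0.ne' x
  have h1 : m * (gcst d * Real.exp (-(1/4) * ((D + r)^2 / τ))) * vr d r ≤ ∫ y, φ y * gm (c • (x - y)) := by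
    calc m * (gcst d * Real.exp (-(1/4) * ((D + r)^2 / τ))) * vr d r
        = ∫ y in ball x' r, m * (gcst d * Real.exp (-(1/4) * ((D + r)^2 / τ))) := by
          rw [setIntegral_const, vr_eq, smul_eq_mul]; ring
      _ ≤ ∫ y in ball x' r, φ y * gm (c • (x - y)) := by
          refine setIntegral_mono_on (integrableOn_const measure_ball_lt_top.ne) hIntg.integrableOn measurableSet_ball fun y hy => ?_
          rw [mem_ball, dist_eq_norm] at hy
          refine mul_le_mul (hball y hy) ?_ (by have := gcst_pos d; positivity) (h0 y)
          unfold gm gcst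
          refine mul_le_mul_of_nonneg_left (Real.exp_le_exp.2 ?_) (by positivity)
          rw [norm_smul, mul_pow, Real.norm_of_nonneg hc0.le]
          have e1 : c^2 = 1/τ := by rw [hc, inv_pow, Real.sq_sqrt hτ.le, one_div]
          rw [e1]
          have e2 : ‖x - y‖ ≤ D + r := by
            calc ‖x - y‖ = ‖(x - x') - (y - x')‖ := by congr 1; abel
              _ ≤ ‖x - x'‖ + ‖y - x'‖ := norm_sub_le _ _
              _ ≤ D + r := by linarith
          have e3 : ‖x - y‖^2 ≤ (D+r)^2 := by gcongr
          have e4 : 1/τ * ‖x-y‖^2 ≤ (D+r)^2/τ := by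
            rw [one_div_mul_eq_div]; gcongr
          linarith
      _ ≤ _ := setIntegral_le_integral hIntg (Eventually.of_forall fun y => mul_nonneg (h0 y) (gm_pos _).le)
  have hcd : 0 < c^d := by positivity
  calc _ = c^d * (m * (gcst d * Real.exp (-(1/4) * ((D + r)^2 / τ))) * vr d r) := by ring
    _ ≤ _ := mul_le_mul_of_nonneg_left h1 hcd.le

lemma Pt_comp {B : ℝ} {φ : Euc d → ℝ} (hφ : Measurable φ) (hb : ∀ x, |φ x| ≤ B) (h0 : ∀ x, 0 ≤ φ x) {x y : Euc d} {R : ℝ} (hR : ‖x - y‖ ≤ R) :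
    Ak gm 1 φ y ≤ Real.exp (R^2/4) * Real.sqrt 2 ^ d * Ak gm 2 φ x := by
  have hs : 0 < Real.sqrt 2 := Real.sqrt_pos.2 two_pos
  rw [Ak_y gm one_pos, Ak_y gm two_pos]
  simp only [smul_eq_mul, Real.sqrt_one, inv_one, one_pow, one_mul]
  have e0 : Real.exp (R^2/4) * Real.sqrt 2 ^ d * ((Real.sqrt 2)⁻¹ ^ d * ∫ w, φ w * gm ((Real.sqrt 2)⁻¹ • (x - w)))
      = ∫ w, Real.exp (R^2/4) * (φ w * gm ((Real.sqrt 2)⁻¹ • (x - w))) := by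
    rw [integral_const_mul, mul_assoc, ← mul_assoc (Real.sqrt 2 ^ d), ← mul_pow, mul_inv_cancel₀ hs.ne', one_pow, one_mul]
  rw [e0]
  refine integral_mono (by simpa using yker_int hφ hb one_ne_zero y) ((yker_int hφ hb (inv_pos.2 hs).ne' x).const_mul _) fun w => ?_
  simp only [one_smul]
  rw [mul_left_comm]
  refine mul_le_mul_of_nonneg_left ?_ (h0 w)
  unfold gm
  rw [mul_left_comm, ← Real.exp_add]
  refine mul_le_mul_of_nonneg_left (Real.exp_le_exp.2 ?_) (by positivity)
  rw [norm_smul, mul_pow, Real.norm_of_nonneg (inv_pos.2 hs).le, inv_pow, Real.sq_sqrt two_pos.le]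
  have e2 : ‖x - w‖ ≤ R + ‖y - w‖ := by
    calc ‖x - w‖ = ‖(x - y) + (y - w)‖ := by congr 1; abel
      _ ≤ ‖x - y‖ + ‖y - w‖ := norm_add_le _ _
      _ ≤ _ := by linarith
  have hn := norm_nonneg (x - w)
  have e3 : ‖x-w‖^2 ≤ (R + ‖y - w‖)^2 := by gcongr
  nlinarith [sq_nonneg (R - ‖y-w‖)]

/-- the reference solution -/
structure Own (Ts : ℝ → ℝ) (F : Euc d → ℝ → ℝ) (g : Euc d → ℝ) (u : ℝ → Euc d → ℝ) : Prop where
  sol : IsSolR F g u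
  gc : Continuous g
  mono : ∀ s t x, 0 ≤ s → s ≤ t → u s x ≤ u t x
  Ts0 : ∀ η, 0 ≤ Ts η
  start : ∀ η > 0, ∀ z, 0 < g z → 1 - η ≤ u (Ts η) z

/-- Harnack-type inequality for `1 - u` -/
lemma harnack {M : ℝ} (hM : 0 ≤ M) (R : ℝ) : ∃ C > 0, ∀ (F : Euc d → ℝ → ℝ), Rx F M → ∀ Ts g u, Own Ts F g u → ∀ t > 2, ∀ x y : Euc d, ‖x - y‖ ≤ R →
    1 - u (t+1) y ≤ C * (1 - u t x) := by
  refine ⟨Real.exp (R^2/4) * Real.sqrt 2 ^ d * Real.exp (M*2), by positivity, fun F hF Ts g u hu t ht x y hxy => ?_⟩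
  have hs := hu.sol
  have aux : ∀ t₀ > 0, ContinuousOn (fun p : ℝ × Euc d => 1 - u (t₀ + p.1) p.2) (Ioi 0 ×ˢ univ) := fun t₀ h =>
    continuousOn_const.sub (hs.restart h).contOn
  have m01 : ∀ t x, 0 ≤ t → |1 - u t x| ≤ 1 := fun t x h => by
    have := hs.mem_Icc t x h; rw [abs_le]; constructor <;> linarith [this.1, this.2]
  have hd : ∀ t₀ > 0, ∀ s x, 0 < s → ContDiffAt ℝ 2 (fun x => 1 - u (t₀+s) x) x ∧ HasDerivAt (fun s => 1 - u (t₀+s) x) (-(lap (u (t₀+s)) x + F x (u (t₀+s) x))) s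
      ∧ lap (fun x => 1 - u (t₀+s) x) x = - lap (u (t₀+s)) x := fun t₀ h s x hs' => by
    have hcd := (hs.spatial (t₀+s) (by linarith)).contDiffAt (x := x)
    refine ⟨contDiffAt_const.sub hcd, ((hs.restart h).eqn s x hs').const_sub 1, ?_⟩
    rw [lap_sub contDiffAt_const hcd, lap_const, zero_sub]
  have hlim : ∀ t₀ > 0, ∀ x₀, Tendsto (fun p : ℝ × Euc d => 1 - u (t₀ + p.1) p.2) ((𝓝[>] (0:ℝ)) ×ˢ 𝓝 x₀) (𝓝 (1 - u t₀ x₀)) := fun t₀ h x₀ =>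
    tendsto_const_nhds.sub ((hs.restart h).initLim x₀ (hs.contx h).continuousAt)
  have h1 := heat_le (z := fun s x => 1 - u (t+s) x) (K := 0) (B := 1) (φ := fun x => 1 - u t x) (aux t (by linarith))
    (fun s x h => m01 _ _ (by linarith)) (fun s x h => by
      obtain ⟨a, b, c⟩ := hd t (by linarith) s x h
      refine ⟨a, _, b, ?_⟩
      rw [c]; have := hF.nonneg x _ (hs.mem_Icc (t+s) x (by linarith)); linarith)
    (continuous_const.sub (hs.contx (by linarith))) (fun x => m01 _ _ (by linarith)) (hlim t (by linarith)) one_pos y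
  have h2 := heat_ge (z := fun s x => 1 - u ((t-2)+s) x) (K := -M) (B := 1) (φ := fun x => 1 - u (t-2) x) (aux (t-2) (by linarith))
    (fun s x h => m01 _ _ (by linarith)) (fun s x h => by
      obtain ⟨a, b, c⟩ := hd (t-2) (by linarith) s x h
      refine ⟨a, _, b, ?_⟩
      have h3 := hs.mem_Icc (t-2+s) x (by linarith)
      have := (hF.up x h3 ⟨zero_le_one, le_rfl⟩ h3.2).2
      rw [hF.z1] at this
      rw [c]; linarith)
    (continuous_const.sub (hs.contx (by linarith))) (fun x => m01 _ _ (by linarith)) (hlim (t-2) (by linarith)) two_pos x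
  have m3 : ∀ z, 0 ≤ 1 - u (t-2) z := fun z => by linarith [(hs.mem_Icc (t-2) z (by linarith)).2]
  have mea : ∀ t₀ > 0, Measurable (fun x => 1 - u t₀ x) := fun t₀ h => (continuous_const.sub (hs.contx h)).measurable
  have h3 := Pt_comp (mea (t-2) (by linarith)) (fun x => m01 _ x (by linarith)) m3 hxy
  have h4 : Ak gm 1 (fun x => 1 - u t x) y ≤ Ak gm 1 (fun x => 1 - u (t-2) x) y := by
    refine integral_mono (Ak_integrable gm_GB (mea t (by linarith)) (fun x => m01 _ x (by linarith)) 1 y)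
      (Ak_integrable gm_GB (mea (t-2) (by linarith)) (fun x => m01 _ x (by linarith)) 1 y) fun z => ?_
    refine mul_le_mul_of_nonneg_right ?_ (gm_pos z).le
    have := hu.mono (t-2) t (y - Real.sqrt 1 • z) (by linarith) (by linarith)
    linarith
  simp only [sub_add_cancel, zero_mul, Real.exp_zero, one_mul] at h1 h2
  have h5 : Ak gm 2 (fun x => 1 - u (t-2) x) x ≤ Real.exp (M*2) * (1 - u t x) := by
    have e : Real.exp (M*2) * Real.exp (-M*2) = 1 := by rw [← Real.exp_add]; simp
    calc _ = Real.exp (M*2) * (Real.exp (-M*2) * Ak gm 2 (fun x => 1 - u (t-2) x) x) := by rw [← mul_assoc, e, one_mul]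
      _ ≤ _ := mul_le_mul_of_nonneg_left h2 (Real.exp_pos _).le
  calc 1 - u (t+1) y ≤ _ := h1.trans (h4.trans h3)
    _ ≤ Real.exp (R^2/4) * Real.sqrt 2 ^ d * (Real.exp (M*2) * (1 - u t x)) := mul_le_mul_of_nonneg_left h5 (by positivity)
    _ = _ := by ring

/-- one-sided time regularity -/
lemma time_reg {F : Euc d → ℝ → ℝ} {M : ℝ} (hF : Rx F M) {g : Euc d → ℝ} {u : ℝ → Euc d → ℝ} (hu : IsSolR F g u) {t : ℝ} (ht : 1 < t) {a σ : ℝ} (ha : 0 < a) (hσ : 0 < σ)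
    (x : Euc d) : u (t+σ) x ≤ u t x + lipC d M 1 * a + (lipC d M 1 * d / a + M) * σ := by
  set L := lipC d M 1 with hL
  have hL0 : 0 ≤ L := lipC_nonneg hF.Mn 1
  have hr := hu.restart (t₀ := t) (by linarith)
  have hrc := rad_continuous (d := d) ha x
  set v : ℝ → Euc d → ℝ := fun s y => (u t x + (L * d / a + M) * s) + L * rad a x y with hv
  have hvc : Continuous (fun p : ℝ × Euc d => v p.1 p.2) := by simp only [hv]; fun_prop
  have hux := hu.mem_Icc t x (by linarith)
  have hMn := hF.Mn
  have key := super_ge hF hr σ (v := v) (fun s hs y => by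
      have := rad_pos ha x y
      have h3 := hux.1
      have h4 : 0 ≤ (L * d / a + M) * s := mul_nonneg (by positivity) hs.1.le
      have h5 : 0 ≤ L * rad a x y := by positivity
      simp only [hv]; linarith) hvc.continuousOn (fun s hs y hy => by
      have hcd : ContDiffAt ℝ 2 (fun y => L * rad a x y) y := (contDiff_const.mul (rad_contDiff ha x)).contDiffAt
      refine ⟨contDiffAt_const.add hcd, L * d / a + M, ?_, ?_⟩
      · exact ((((hasDerivAt_id s).const_mul (L * d / a + M)).const_add (u t x)).add_const (L * rad a x y)).congr_deriv (by ring)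
      · have hpos := rad_pos ha x y
        have hlap : lap (v s) y ≤ L * d / a := by
          simp only [hv]
          rw [lap_add contDiffAt_const hcd, lap_const, zero_add, lap_const_mul _ (rad_contDiff ha x).contDiffAt]
          have := lap_rad ha x y (φ := fun r => r) (φ' := fun _ => 1) (φ'' := 0) (fun s => hasDerivAt_id s) (hasDerivAt_const _ _)
          rw [this, zero_mul, zero_add, one_mul, mul_div_assoc]
          refine mul_le_mul_of_nonneg_left ?_ hL0
          have e1 : (d:ℝ) / rad a x y ≤ d / a := div_le_div_of_nonneg_left (by positivity) ha (A_le_rad ha x y)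
          have e2 : 0 ≤ ‖y - x‖^2 / rad a x y ^ 3 := by positivity
          linarith
        have hv0 : 0 ≤ v s y := by
          have h4 : 0 ≤ (L * d / a + M) * s := mul_nonneg (by positivity) hs.1.le
          have h5 : 0 ≤ L * rad a x y := by positivity
          simp only [hv]; linarith [hux.1]
        have := hF.bd y ⟨hv0, hy.le⟩
        have := le_abs_self (F y (v s y))
        linarith)
    (fun y => by
      intro ε hε
      have h1 := hr.initLim y (hu.contx (by linarith)).continuousAt
      have h2 := ev_of_contAt (v := v) (x₀ := y) hvc.continuousAt
      refine (h1.sub h2).eventually (ge_mem_nhds ?_)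
      have h3 := (abs_le.1 (sol_lip hF hu ht y x)).2
      have h4 := mul_le_mul_of_nonneg_left (le_rad ha x y) hL0
      simp only [hv]; linarith) σ ⟨hσ, le_rfl⟩ x
  simp only [hv] at key
  rw [rad_self ha] at key
  linarith

/-- spreading from a hot point -/
lemma hotspread {f₀ : ℝ → ℝ} {M θ₀ θ ζ ξ c₀ c₂ : ℝ} (hM : 0 ≤ M) (h0 : F0 f₀ θ₀) (hc : 0 < c₀) (hf : IsTravelingFrontSpeed f₀ c₀) (hc0 : 0 < c₂) (hc2 : c₂ < c₀) :
    ∃ δ > 0, ∀ η > 0, ∃ C > 0, ∀ (F : Euc d → ℝ → ℝ), Ctx f₀ M θ₀ θ ζ ξ F → ∀ Ts g u, Own Ts F g u →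
      ∀ s ≥ 0, ∀ y, 1 - δ ≤ u s y → ∀ t x, s + ‖x - y‖/c₂ + C ≤ t → 1 - η ≤ u t x := by
  obtain ⟨ct, h, Φ, p, q, hP⟩ := prof_exists h0 hc hf hc0.le hc2
  obtain ⟨A, hA, R, hR, hrad⟩ := radial_sub (d := d) (M := M) (θ := θ) (ζ := ζ) (ξ := ξ) h0 hc0 hP
  obtain ⟨C, hC, hharn⟩ := harnack (d := d) hM R
  have hh := hP.hh
  have th := h0.th
  refine ⟨(1-h)/C, div_pos (by linarith [hh.2]) hC, fun η hη => ?_⟩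
  obtain ⟨T, hT, RG, hRG, hG⟩ := lemG (d := d) (M := M) (θ := θ) (ζ := ζ) (ξ := ξ) h0 (η := min η ((1-θ₀)/4)) (lt_min hη (by linarith [th.2]))
    (lt_of_le_of_lt (min_le_right _ _) (by linarith [th.2]))
  obtain ⟨S, hS⟩ := hP.lim ((1+θ₀)/2) hh.1
  refine ⟨4 + (A + RG + |S|)/c₂ + T, by positivity, fun F hF Ts g u hu s hs y hy t x ht => ?_⟩
  have sol := hu.sol
  have h1 : ∀ z, ‖z - y‖ < R → h ≤ u (s+3+1) z := fun z hz => by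
    have := hharn F hF.toRx Ts g u hu (s+3) (by linarith) y z (by rw [norm_sub_rev]; exact hz.le)
    have h2 := hu.mono s (s+3) y hs (by linarith)
    have h3 : C * (1 - u (s+3) y) ≤ C * ((1-h)/C) := mul_le_mul_of_nonneg_left (by linarith) hC.le
    have h4 : C * ((1-h)/C) = 1 - h := by field_simp
    linarith
  have r1 := sol.restart (t₀ := s+3+1) (by linarith)
  set τ := ‖x - y‖/c₂ + (A + RG + |S|)/c₂ with hτ
  have hτ0 : 0 < τ := by positivity
  have h2 := hrad F hF _ _ r1 y (fun z hz => ⟨h1 z hz, (sol.contx (by linarith)).continuousAt⟩) τ hτ0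
  have r2 := sol.restart (t₀ := s+3+1+τ) (by linarith)
  have h3 := hG F hF _ _ r2 x (fun z hz => ⟨(hS _ ?_).trans (h2 z), (sol.contx (by linarith)).continuousAt⟩)
  · have h4 := hu.mono (s+3+1+τ+T) t x (by linarith) (by linarith)
    have := min_le_left η ((1-θ₀)/4)
    linarith
  · have e1 := rad_le hA y z
    have e2 : ‖z - y‖ ≤ RG + ‖x - y‖ := by
      calc ‖z - y‖ = ‖(z - x) + (x - y)‖ := by congr 1; abel
        _ ≤ ‖z - x‖ + ‖x - y‖ := norm_add_le _ _
        _ ≤ _ := by linarith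
    have e3 : c₂ * τ = ‖x-y‖ + (A + RG + |S|) := by rw [hτ]; field_simp
    have := neg_abs_le S
    linarith
end

section
open MeasureTheory Metric Set Filter
open scoped Topology RealInnerProductSpace NNReal Pointwise
set_option linter.unusedVariables false
set_option linter.unusedSectionVars false
variable {d : ℕ}

/-- exponential barrier on a truncated cone -/
lemma tail {F : Euc d → ℝ → ℝ} {g : Euc d → ℝ} {u : ℝ → Euc d → ℝ} (hu : IsSolR F g u) (hg : Continuous g)
    {lm A c ρ ℓ t : ℝ} (hl : 0 < lm) (hA : 0 < A) (hlm : lm^2 + lm * (d / A) + ρ ≤ lm * c) (ht : 0 < t) (x : Euc d)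
    (hQ : ∀ s ∈ Ioc 0 t, ∀ y, ‖y - x‖ < ℓ + c * (t - s) → F y (u s y) ≤ ρ * u s y)
    (h0 : ∀ y, ‖y - x‖ < ℓ + c * t → g y ≤ 0) : u t x ≤ Real.exp (lm * (A - ℓ)) := by
  set ψ : ℝ → Euc d → ℝ := fun s y => Real.exp (lm * rad A x y + -lm * (ℓ + c * (t - s))) with hψ
  have hrc := rad_continuous (d := d) hA x
  have hψc : Continuous (fun p : ℝ × Euc d => ψ p.1 p.2) := by simp only [hψ]; fun_prop
  have hψp : ∀ s y, 0 < ψ s y := fun s y => Real.exp_pos _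
  have hψ1 : ∀ s y, ℓ + c * (t - s) ≤ ‖y - x‖ → 1 ≤ ψ s y := fun s y h => by
    simp only [hψ]
    apply Real.one_le_exp
    have := le_rad hA x y
    nlinarith
  have key := compLem (fun s y => u s y - ψ s y) t 1 ρ (fun s hs y => by
      have := (hu.mem_Icc s y hs.1.le).2; linarith [hψp s y])
    ((hu.contOn.mono (prod_mono Ioc_subset_Ioi_self le_rfl)).sub hψc.continuousOn)
    (fun s hs y hw => by
      have hlt : ‖y - x‖ < ℓ + c * (t - s) := by
        by_contra h
        have := hψ1 s y (not_lt.1 h)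
        have := (hu.mem_Icc s y hs.1.le).2; linarith
      have hcd := (hu.spatial s hs.1).contDiffAt (x := y)
      have hpd : ContDiffAt ℝ 2 (ψ s) y := by
        have : ContDiffAt ℝ 2 (rad A x) y := (rad_contDiff hA x).contDiffAt
        exact (((contDiffAt_const.mul this).add contDiffAt_const)).exp
      refine ⟨hcd.sub hpd, _, (hu.eqn s y hs.1).sub (g' := ψ s y * (lm * c)) ?_, ?_⟩
      · have := (((((hasDerivAt_id s).const_sub t).const_mul c).const_add ℓ).const_mul (-lm)).const_add (lm * rad A x y)
        exact this.exp.congr_deriv (by simp only [hψ, id]; ring)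
      · rw [lap_sub hcd hpd]
        have h1 := hQ s hs y hlt
        have h2 : lap (ψ s) y ≤ ψ s y * (lm^2 + lm * (d / A)) := by
          have hr := rad_pos hA x y
          have h3 := lap_rad hA x y (φ := fun r => Real.exp (lm * r + -lm * (ℓ + c * (t - s)))) (φ' := fun r => Real.exp (lm * r + -lm * (ℓ + c * (t - s))) * lm)
            (φ'' := Real.exp (lm * rad A x y + -lm * (ℓ + c * (t - s))) * lm * lm)
            (fun r => ((((hasDerivAt_id r).const_mul lm).add_const _).exp).congr_deriv (by simp))
            (((((hasDerivAt_id (rad A x y)).const_mul lm).add_const _).exp.mul_const lm).congr_deriv (by simp))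
          have h4 : lap (ψ s) y = _ := h3
          rw [h4]
          have h5 : ‖y - x‖^2 / rad A x y ^2 ≤ 1 := by
            rw [div_le_one (by positivity)]
            gcongr; exact le_rad hA x y
          have e1 : (d:ℝ) / rad A x y ≤ d / A := div_le_div_of_nonneg_left (by positivity) hA (A_le_rad hA x y)
          have e2 : 0 ≤ ‖y - x‖^2 / rad A x y ^ 3 := by positivity
          have e3 := hψp s y
          change ψ s y * lm * lm * _ + ψ s y * lm * _ ≤ _
          have a1 : ψ s y * lm * lm * (‖y - x‖^2 / rad A x y ^2) ≤ ψ s y * lm * lm * 1 := by gcongr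
          have a2 : ψ s y * lm * (d / rad A x y - ‖y - x‖ ^ 2 / rad A x y ^ 3) ≤ ψ s y * lm * (d/A) := by
            refine mul_le_mul_of_nonneg_left (by linarith) (by positivity)
          linarith
        have h6 := mul_le_mul_of_nonneg_left hlm (hψp s y).le
        linarith)
    (fun y ε hε => by
      have h1 := hu.initLim y hg.continuousAt
      have h2 := ev_of_contAt (v := ψ) (x₀ := y) hψc.continuousAt
      refine (h1.sub h2).eventually (ge_mem_nhds ?_)
      have hgy : g y ≤ 1 := by
        have := (hu.mem_Icc 0 y le_rfl).2; rw [hu.at_zero] at this; exact this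
      by_cases hy : ‖y - x‖ < ℓ + c * t
      · have := h0 y hy; linarith [hψp 0 y]
      · have := hψ1 0 y (by rw [sub_zero]; exact not_lt.1 hy); linarith) t ⟨ht, le_rfl⟩ x
  simp only [hψ] at key
  rw [rad_self hA] at key
  have e : lm * A + -lm * (ℓ + c * (t - t)) = lm * (A - ℓ) := by ring
  rw [e] at key
  linarith

lemma tailq {ρ c ε : ℝ} (hρ : 0 < ρ) (hc : 2 * Real.sqrt ρ < c) (hε : 0 < ε) : ∃ ℓ > 0, ∀ (F : Euc d → ℝ → ℝ) g u, IsSolR F g u → Continuous g →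
    ∀ t > 0, ∀ x, ε ≤ u t x → (∃ s ∈ Ioc 0 t, ∃ y, ‖y - x‖ < ℓ + c * (t - s) ∧ ρ * u s y < F y (u s y)) ∨ ∃ y, ‖y - x‖ < ℓ + c * t ∧ 0 < g y := by
  set lm := Real.sqrt ρ with hlm
  have hl : 0 < lm := Real.sqrt_pos.2 hρ
  have hl2 : lm^2 = ρ := Real.sq_sqrt hρ.le
  have hgap : 0 < c - 2*lm := by linarith
  set A := d / (c - 2*lm) + 1 with hA
  have hA0 : 0 < A := by positivity
  have hdA : d / A ≤ c - 2*lm := by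
    rw [div_le_iff₀ hA0, hA, mul_add, mul_div_cancel₀ _ hgap.ne']; linarith
  refine ⟨A + (|Real.log ε| + 1)/lm, by positivity, fun F g u hu hg t ht x hx => ?_⟩
  by_contra hcon
  push Not at hcon
  have h := tail hu hg (lm := lm) (A := A) (c := c) (ρ := ρ) (ℓ := A + (|Real.log ε| + 1)/lm) hl hA0 (by
    have := mul_le_mul_of_nonneg_left hdA hl.le
    nlinarith) ht x (fun s hs y hy => hcon.1 s hs y hy) hcon.2
  have e : lm * (A - (A + (|Real.log ε| + 1)/lm)) = -(|Real.log ε| + 1) := by field_simp; ring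
  rw [e] at h
  have h2 : Real.exp (-(|Real.log ε| + 1)) < ε := by
    rw [← Real.lt_log_iff_exp_lt hε]
    linarith [neg_abs_le (Real.log ε)]
  linarith

/-- persistence of burning -/
lemma persist {f₀ : ℝ → ℝ} {M θ₀ θ ζ ξ δ : ℝ} (hM : 0 ≤ M) (h0 : F0 f₀ θ₀) (hζ : 0 < ζ) (hξ : 0 < ξ) (hδ : 0 < δ) :
    ∃ ξ₁ > 0, ∀ (F : Euc d → ℝ → ℝ), Ctx f₀ M θ₀ θ ζ ξ F → ∀ x a b, a ∈ Icc (0:ℝ) 1 → ζ * a < F x a → a ≤ b → b ≤ 1 - δ → ξ₁ ≤ F x b := by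
  have th := h0.th
  set ν := min ξ (ζ * θ₀) with hν
  have hν0 : 0 < ν := lt_min hξ (mul_pos hζ th.1)
  set k := θ₀ + ν/(2*(M+1)) with hk
  have hkθ : θ₀ < k := by have : 0 < ν/(2*(M+1)) := by positivity
                          linarith
  obtain ⟨m, hm, hmin⟩ : ∃ m > 0, ∀ b ∈ Icc k (1-δ), m ≤ f₀ b := by
    rcases (Icc k (1-δ)).eq_empty_or_nonempty with he | hne
    · exact ⟨1, one_pos, fun b hb => by rw [he] at hb; exact hb.elim⟩
    · obtain ⟨b, hb, hbm⟩ := isCompact_Icc.exists_isMinOn hne (h0.cont.mono (fun b hb => ⟨by linarith [hb.1, th.1], by linarith [hb.2]⟩))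
      exact ⟨f₀ b, h0.pos b ⟨by linarith [hb.1], by linarith [hb.2]⟩, fun y hy => hbm hy⟩
  refine ⟨min (ν/2) m, lt_min (by linarith) hm, fun F hF x a b ha hab hle hb => ?_⟩
  by_cases hbθ : b ≤ θ₀
  · have := hF.per x a b ha hab hle hbθ
    have h1 := min_le_left (ν/2) m
    have h2 := min_le_left ξ (ζ * θ₀)
    linarith
  push Not at hbθ
  obtain ⟨a', ha1, ha2, ha3⟩ : ∃ a', θ₀ ≤ a' ∧ a' ≤ b ∧ ν ≤ F x a' := by
    by_cases h : a ≤ θ₀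
    · exact ⟨θ₀, le_rfl, hbθ.le, (min_le_left _ _).trans (hF.per x a θ₀ ha hab h le_rfl)⟩
    · push Not at h
      refine ⟨a, h.le, hle, (min_le_right _ _).trans (le_trans ?_ hab.le)⟩
      exact mul_le_mul_of_nonneg_left h.le hζ.le
  by_cases hba : b ≤ a' + ν/(2*(M+1))
  · have h1 := (hF.toRx.up x (a := a') (b := b) ⟨by linarith [th.1], by linarith⟩ ⟨by linarith [th.1], by linarith⟩ ha2).2
    have h2 : M * (b - a') ≤ (M+1) * (ν/(2*(M+1))) := by
      apply mul_le_mul <;> linarith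
    have h3 : (M+1) * (ν/(2*(M+1))) = ν/2 := by field_simp
    have := min_le_left (ν/2) m
    linarith
  · push Not at hba
    have h1 := hmin b ⟨by linarith, hb⟩
    have h2 := hF.f0_le x b ⟨by linarith [th.1], by linarith⟩
    have := min_le_right (ν/2) m
    linarith
end

section
open MeasureTheory Metric Set Filter
open scoped Topology RealInnerProductSpace NNReal Pointwise
set_option linter.unusedVariables false
set_option linter.unusedSectionVars false
variable {d : ℕ}

/-- some earlier active point close to `x` -/
def Nearby (D : ℝ → Euc d → Prop) (r t : ℝ) (x : Euc d) : Prop := ∃ s ≤ t, ∃ z, D s z ∧ ‖z - x‖ < r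
/-- freshly activated -/
def Fresh (D : ℝ → Euc d → Prop) (r σ t : ℝ) (x : Euc d) : Prop := Nearby D r t x ∧ ¬ Nearby D r (t - σ/2) x

lemma fresh_exists {D : ℝ → Euc d → Prop} {r σ t : ℝ} {x : Euc d} (hσ : 0 < σ) (hD : ∀ s z, D s z → 0 < s) (h : Nearby D r t x) :
    ∃ t' ≤ t, Fresh D r σ t' x := by
  classical
  have hex : ∃ k : ℕ, ¬ Nearby D r (t - k * (σ/2)) x := by
    obtain ⟨k, hk⟩ := exists_nat_gt (t/(σ/2))
    refine ⟨k, ?_⟩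
    rintro ⟨s, hs, z, hz, -⟩
    have := hD s z hz
    rw [div_lt_iff₀ (by linarith)] at hk
    linarith
  have h1 := Nat.find_spec hex
  set k := Nat.find hex with hk
  have hk0 : k ≠ 0 := by
    intro h0
    rw [h0] at h1; simp at h1; exact h1 h
  obtain ⟨n, hn⟩ := Nat.exists_eq_succ_of_ne_zero hk0
  have h2 := Nat.find_min hex (m := n) (by omega)
  push Not at h2
  refine ⟨t - n * (σ/2), ?_, h2, ?_⟩
  · have : 0 ≤ (n:ℝ) * (σ/2) := by positivity
    linarith
  · rw [hn] at h1
    have e : t - ((n.succ : ℕ):ℝ) * (σ/2) = t - n * (σ/2) - σ/2 := by push_cast; ring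
    rw [← e]; exact h1

lemma chain {D Hot : ℝ → Euc d → Prop} {c₁ c₂ Ch Cb σ ℓ r C' κ Cs C₃ Γb : ℝ} {m : ℕ} (hc₁ : 0 < c₁) (hc : c₁ < c₂) (hCh : 0 < Ch) (hCb : 0 < Cb) (hσ : 0 < σ) (hℓ : 0 < ℓ)
    (hr : 0 < r) (hC' : C' = (r + ℓ)/c₂ + Ch) (hκ : κ = 1 - c₁/c₂) (hCs : Cs = Cb + r/c₂ + Ch) (hC₃ : C₃ = r + ℓ + c₁ * ((C'+1)/κ))
    (hDpos : ∀ s z, D s z → 0 < s) (hmono : ∀ s t x, Hot s x → s ≤ t → Hot t x)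
    (hsp : ∀ s y t x, Hot s y → s + ‖x - y‖/c₂ + Ch ≤ t → Hot t x)
    (hb : ∀ s z, D s z → Hot (s + Cb) z ∨ ∃ s' z', s' ≤ s - σ ∧ D s' z' ∧ ‖z' - z‖ ≤ ℓ + c₁ * (s - s'))
    (hap : ∀ n, ∃ A, ∀ s z, D s z → s ≤ n → Hot A z)
    (hΓ : C' * m + Cs + 1 ≤ Γb) (hfail : ∃ t x, Fresh D r σ t x ∧ ¬ Hot (t + Γb) x) :
    ∃ (t₀ : ℝ) (x₀ : Euc d) (xs : ℕ → Euc d), 0 < t₀ ∧ ¬ Hot (t₀ + (Γb - 1)) x₀ ∧ ∀ j, 1 ≤ j → j ≤ m →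
      (∃ s ≤ t₀, D s (xs j)) ∧ ‖xs j - x₀‖ ≤ C₃ * j ∧ ∀ i, 1 ≤ i → i < j → r ≤ ‖xs j - xs i‖ := by
  have hc₂ : 0 < c₂ := hc₁.trans hc
  have hκ0 : 0 < κ := by rw [hκ, sub_pos, div_lt_one hc₂]; exact hc
  have hC0 : 0 < C' := by rw [hC']; positivity
  obtain ⟨tb, xb, hFb, hHb⟩ := hfail
  obtain ⟨A, hA⟩ := hap tb
  have near_pos : ∀ t x, Nearby D r t x → 0 < t := fun t x ⟨s, hs, z, hz, _⟩ => lt_of_lt_of_le (hDpos s z hz) hs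
  set G : Set ℝ := {Γ | ∃ t ≤ tb, ∃ x, Fresh D r σ t x ∧ ¬ Hot (t + Γ) x} with hG
  have hGne : Γb ∈ G := ⟨tb, le_rfl, xb, hFb, hHb⟩
  have hGb : BddAbove G := by
    refine ⟨A + r/c₂ + Ch, ?_⟩
    rintro Γ ⟨t, ht, x, hF, hH⟩
    by_contra hlt
    push Not at hlt
    obtain ⟨s, hs, z, hz, hzx⟩ := hF.1
    have h0 := near_pos t x hF.1
    apply hH
    refine hsp A z _ x (hA s z hz (hs.trans ht)) ?_
    have : ‖x - z‖/c₂ ≤ r/c₂ := by rw [norm_sub_rev]; gcongr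
    linarith
  obtain ⟨Γ₀, hΓ₀, hsup⟩ := exists_lt_of_lt_csSup ⟨Γb, hGne⟩ (show sSup G - 1 < sSup G by linarith)
  have hmax : ∀ Γ ∈ G, Γ ≤ Γ₀ + 1 := fun Γ h => by linarith [le_csSup hGb h]
  have hΓ₀b : Γb - 1 ≤ Γ₀ := by linarith [hmax Γb hGne]
  obtain ⟨t₀, ht₀, x₀, hF₀, hH₀⟩ := hΓ₀
  have h0pos := near_pos t₀ x₀ hF₀.1
  -- one step
  have step : ∀ p : ℝ × Euc d × ℝ, ∃ q : ℝ × Euc d × ℝ, (Fresh D r σ p.1 p.2.1 ∧ ¬ Hot (p.1 + p.2.2) p.2.1 ∧ Cs ≤ p.2.2) →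
      (Fresh D r σ q.1 q.2.1 ∧ ¬ Hot (q.1 + q.2.2) q.2.1 ∧ q.1 ≤ p.1 ∧ p.2.2 - C' + κ * (p.1 - q.1) ≤ q.2.2 ∧ ‖q.2.1 - p.2.1‖ ≤ r + ℓ + c₁ * (p.1 - q.1) ∧
        ∃ s ≤ p.1 - σ/2, D s q.2.1) := by
    rintro ⟨t, x, Γ⟩
    by_cases hP : Fresh D r σ t x ∧ ¬ Hot (t + Γ) x ∧ Cs ≤ Γ
    swap
    · exact ⟨⟨t, x, Γ⟩, fun h => (hP h).elim⟩
    obtain ⟨hF, hH, hCsΓ⟩ := hP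
    obtain ⟨s, hs, z, hz, hzx⟩ := hF.1
    have hxz : ‖x - z‖/c₂ ≤ r/c₂ := by rw [norm_sub_rev]; gcongr
    rcases hb s z hz with hhot | ⟨s', z', hs', hz', hzz⟩
    · exact (hH (hsp _ z _ x hhot (by linarith))).elim
    obtain ⟨t', ht', hF'⟩ := fresh_exists (σ := σ) hσ hDpos (⟨s', le_rfl, z', hz', by simpa using hr⟩ : Nearby D r s' z')
    have hdist : ‖z' - x‖ ≤ r + ℓ + c₁ * (t - t') := by
      have e1 : ‖z' - x‖ ≤ ‖z' - z‖ + ‖z - x‖ := by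
        calc ‖z' - x‖ = ‖(z' - z) + (z - x)‖ := by congr 1; abel
          _ ≤ _ := norm_add_le _ _
      have e2 : c₁ * (s - s') ≤ c₁ * (t - t') := mul_le_mul_of_nonneg_left (by linarith) hc₁.le
      linarith
    refine ⟨⟨t', z', Γ - C' + κ * (t - t')⟩, fun _ => ⟨hF', fun hh => hH ?_, by simp only; linarith, le_rfl, hdist, s', by simp only; linarith, hz'⟩⟩
    refine hsp _ z' _ x hh ?_
    have e3 : ‖x - z'‖/c₂ ≤ (r + ℓ + c₁ * (t - t'))/c₂ := by rw [norm_sub_rev]; gcongr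
    have e4 : (r + ℓ + c₁ * (t - t'))/c₂ = (r+ℓ)/c₂ + (c₁/c₂) * (t - t') := by field_simp
    simp only
    rw [hκ, hC']
    linarith
  choose nx hnx using step
  set sq : ℕ → ℝ × Euc d × ℝ := fun j => nx^[j] ⟨t₀, x₀, Γ₀⟩ with hsq
  have sq0 : sq 0 = ⟨t₀, x₀, Γ₀⟩ := rfl
  have sqs : ∀ j, sq (j+1) = nx (sq j) := fun j => Function.iterate_succ_apply' nx j _
  have inv : ∀ j, j ≤ m → Fresh D r σ (sq j).1 (sq j).2.1 ∧ ¬ Hot ((sq j).1 + (sq j).2.2) (sq j).2.1 ∧ (sq j).1 ≤ t₀ ∧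
      Γ₀ - C' * j + κ * (t₀ - (sq j).1) ≤ (sq j).2.2 ∧ ‖(sq j).2.1 - x₀‖ ≤ (r + ℓ) * j + c₁ * (t₀ - (sq j).1) := by
    intro j
    induction j with
    | zero => intro _; rw [sq0]; refine ⟨hF₀, hH₀, le_rfl, by simp, by simp⟩
    | succ j ih =>
      intro hj
      obtain ⟨i1, i2, i3, i4, i5⟩ := ih (by omega)
      have hjm : (j:ℝ) ≤ m := by exact_mod_cast (by omega : j ≤ m)
      have hCj : C' * j ≤ C' * m := mul_le_mul_of_nonneg_left hjm hC0.le
      have hk0 : 0 ≤ κ * (t₀ - (sq j).1) := mul_nonneg hκ0.le (by linarith)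
      obtain ⟨a1, a2, a3, a4, a5, _⟩ := hnx (sq j) ⟨i1, i2, by linarith⟩
      rw [sqs]
      refine ⟨a1, a2, a3.trans i3, ?_, ?_⟩
      · push_cast; linarith
      · have : ‖(nx (sq j)).2.1 - x₀‖ ≤ ‖(nx (sq j)).2.1 - (sq j).2.1‖ + ‖(sq j).2.1 - x₀‖ := by
          calc _ = ‖((nx (sq j)).2.1 - (sq j).2.1) + ((sq j).2.1 - x₀)‖ := by congr 1; abel
            _ ≤ _ := norm_add_le _ _
        push_cast; linarith
  have stp : ∀ j, j < m → (sq (j+1)).1 ≤ (sq j).1 ∧ ∃ s ≤ (sq j).1 - σ/2, D s (sq (j+1)).2.1 := fun j hj => by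
    obtain ⟨i1, i2, i3, i4, i5⟩ := inv j hj.le
    have hjm : (j:ℝ) ≤ m := by exact_mod_cast hj.le
    have hCj : C' * j ≤ C' * m := mul_le_mul_of_nonneg_left hjm hC0.le
    have hk0 : 0 ≤ κ * (t₀ - (sq j).1) := mul_nonneg hκ0.le (by linarith)
    obtain ⟨a1, a2, a3, a4, a5, a6⟩ := hnx (sq j) ⟨i1, i2, by linarith⟩
    rw [sqs]; exact ⟨a3, a6⟩
  have anti : ∀ i k, i + k ≤ m → (sq (i+k)).1 ≤ (sq i).1 := fun i k => by
    induction k with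
    | zero => intro _; simp
    | succ k ih => intro h; exact ((stp (i+k) (by omega)).1).trans (ih (by omega))
  refine ⟨t₀, x₀, fun j => (sq j).2.1, h0pos, fun hh => hH₀ (hmono _ _ _ hh (by linarith)), fun j hj1 hjm => ?_⟩
  obtain ⟨k, rfl⟩ : ∃ k, j = k + 1 := ⟨j - 1, by omega⟩
  obtain ⟨-, s, hs, hDs⟩ := stp k (by omega)
  obtain ⟨i1, i2, i3, i4, i5⟩ := inv (k+1) hjm
  obtain ⟨-, -, i3', -, -⟩ := inv k (by omega)
  refine ⟨⟨s, by linarith, hDs⟩, ?_, fun i hi1 hik => ?_⟩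
  · have h1 := hmax _ (⟨(sq (k+1)).1, i3.trans ht₀, (sq (k+1)).2.1, i1, i2⟩ : (sq (k+1)).2.2 ∈ G)
    have h2 : t₀ - (sq (k+1)).1 ≤ (C' * ((k+1:ℕ):ℝ) + 1)/κ := by
      rw [le_div_iff₀ hκ0]; linarith
    have hk1 : (1:ℝ) ≤ ((k+1:ℕ):ℝ) := by exact_mod_cast hj1
    have h3 : (C' * ((k+1:ℕ):ℝ) + 1)/κ ≤ ((C'+1)/κ) * ((k+1:ℕ):ℝ) := by
      rw [div_mul_eq_mul_div]; gcongr; linarith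
    have h4 : c₁ * (t₀ - (sq (k+1)).1) ≤ c₁ * (((C'+1)/κ) * ((k+1:ℕ):ℝ)) := mul_le_mul_of_nonneg_left (h2.trans h3) hc₁.le
    rw [hC₃]
    calc _ ≤ _ := i5
      _ ≤ (r+ℓ) * ((k+1:ℕ):ℝ) + c₁ * (((C'+1)/κ) * ((k+1:ℕ):ℝ)) := by linarith
      _ = _ := by ring
  · by_contra hlt
    push Not at hlt
    obtain ⟨f1, -⟩ := inv i (by omega)
    apply f1.2
    have := anti i (k - i) (by omega)
    rw [Nat.add_sub_cancel' (by omega : i ≤ k)] at this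
    exact ⟨s, by linarith, _, hDs, hlt⟩

/-- heat semigroup lower bound from many disjoint balls -/
lemma Pt_ge_balls {B : ℝ} {φ : Euc d → ℝ} (hφ : Measurable φ) (hb : ∀ x, |φ x| ≤ B) (h0 : ∀ x, 0 ≤ φ x) {m : ℝ} (hm : 0 ≤ m) {x : Euc d} {r : ℝ} (hr : 0 < r)
    {J : Finset ℕ} {xs : ℕ → Euc d} {Dd : ℕ → ℝ} (hdis : ∀ i ∈ J, ∀ j ∈ J, i < j → 2*r ≤ ‖xs j - xs i‖)
    (hball : ∀ j ∈ J, ∀ y, ‖y - xs j‖ < r → m ≤ φ y) {τ : ℝ} (hτ : 0 < τ) (hD : ∀ j ∈ J, ‖x - xs j‖ ≤ Dd j) :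
    ∑ j ∈ J, m * ((Real.sqrt τ)⁻¹ ^ d * (gcst d * Real.exp (-(1/4) * ((Dd j + r)^2 / τ))) * vr d r) ≤ Ak gm τ φ x := by
  classical
  set ψ : ℕ → Euc d → ℝ := fun j => (ball (xs j) r).indicator φ with hψ
  have hψm : ∀ j, Measurable (ψ j) := fun j => hφ.indicator measurableSet_ball
  have hψ0 : ∀ j y, 0 ≤ ψ j y := fun j y => indicator_nonneg (fun y _ => h0 y) y
  have hψle : ∀ j y, ψ j y ≤ φ y := fun j y => indicator_le_self' (fun y _ => h0 y) y
  have hψb : ∀ j y, |ψ j y| ≤ B := fun j y => by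
    rw [abs_of_nonneg (hψ0 j y)]; exact (hψle j y).trans ((le_abs_self _).trans (hb y))
  have h1 : ∑ j ∈ J, Ak gm τ (ψ j) x ≤ Ak gm τ φ x := by
    unfold Ak
    rw [← integral_finsetSum J (fun j _ => Ak_integrable gm_GB (hψm j) (hψb j) τ x)]
    refine integral_mono (integrable_finsetSum J (fun j _ => Ak_integrable gm_GB (hψm j) (hψb j) τ x)) (Ak_integrable gm_GB hφ hb τ x) fun z => ?_
    simp only [smul_eq_mul]
    rw [← Finset.sum_mul]
    refine mul_le_mul_of_nonneg_right ?_ (gm_pos z).le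
    set y := x - Real.sqrt τ • z
    by_cases hex : ∃ j ∈ J, y ∈ ball (xs j) r
    · obtain ⟨j, hj, hy⟩ := hex
      have : ∑ i ∈ J, ψ i y = ψ j y := by
        refine Finset.sum_eq_single_of_mem j hj fun i hi hij => ?_
        refine indicator_of_notMem (fun hyi => ?_) _
        rw [mem_ball, dist_eq_norm] at hy hyi
        have hd2 : ‖xs j - xs i‖ < 2*r ∧ ‖xs i - xs j‖ < 2*r := by
          have : ‖xs j - xs i‖ ≤ ‖y - xs i‖ + ‖y - xs j‖ := by
            calc _ = ‖(y - xs i) - (y - xs j)‖ := by congr 1; abel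
              _ ≤ _ := norm_sub_le _ _
          have h2 : ‖xs j - xs i‖ < 2*r := by linarith
          exact ⟨h2, by rw [norm_sub_rev]; exact h2⟩
        rcases lt_or_gt_of_ne hij with h | h
        · linarith [hdis i hi j hj h]
        · linarith [hdis j hj i hi h]
      rw [this]; exact hψle j y
    · push Not at hex
      rw [Finset.sum_eq_zero fun i hi => indicator_of_notMem (hex i hi) _]
      exact h0 y
  refine le_trans (Finset.sum_le_sum fun j hj => ?_) h1
  refine Pt_ge_ball (hψm j) (hψb j) (hψ0 j) hm hr (x' := xs j) (fun y hy => ?_) hτ (hD j hj)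
  rw [hψ]; simp only
  rw [indicator_of_mem (by rw [mem_ball, dist_eq_norm]; exact hy)]
  exact hball j hj y hy
end

section
open MeasureTheory Metric Set Filter
open scoped Topology RealInnerProductSpace NNReal Pointwise
set_option linter.unusedVariables false
set_option linter.unusedSectionVars false
variable {d : ℕ}

lemma src_sol {F : Euc d → ℝ → ℝ} {M : ℝ} (hF : Rx F M) {g : Euc d → ℝ} {u : ℝ → Euc d → ℝ} (hu : IsSolR F g u) :
    SrcB (fun s x => F x (u s x)) M := by
  have h := src_of hF hu.contOn
  refine ⟨h.cont.congr fun p hp => ?_, fun s x hs => hF.bd x (hu.mem_Icc s x hs.le)⟩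
  simp only
  rw [cl_of_mem (hu.mem_Icc p.1 p.2 (le_of_lt hp.1))]

/-- too many burning balls would push the solution over one -/
lemma sum_contra (hd3 : d ≤ 3) {M ξ₂ r C₃ : ℝ} (hM : 0 ≤ M) (hξ : 0 < ξ₂) (hr : 0 < r) (hC : 0 < C₃) : ∃ m : ℕ, ∀ (F : Euc d → ℝ → ℝ), Rx F M → ∀ g u, IsSolR F g u →
    ∀ t₀ > 0, ∀ (x₀ : Euc d) (xs : ℕ → Euc d),
    (∀ s ∈ Ioo (0:ℝ) (2*m^2), ∀ j, 1 ≤ j → j ≤ m → ∀ y, ‖y - xs j‖ < r → ξ₂ ≤ F y (u (t₀ + s) y)) →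
    (∀ j, 1 ≤ j → j ≤ m → ‖xs j - x₀‖ ≤ C₃ * j ∧ ∀ i, 1 ≤ i → i < j → 2*r ≤ ‖xs j - xs i‖) → False := by
  set K := ξ₂ * ((Real.sqrt 2)⁻¹ ^ 3 * (gcst d * Real.exp (-(1/4) * (C₃ + r)^2)) * vr d r) with hK
  have hK0 : 0 < K := by
    have := gcst_pos d; have := vr_pos d hr
    have : 0 < Real.sqrt 2 := Real.sqrt_pos.2 two_pos
    positivity
  obtain ⟨m, hm1, hm⟩ := ((Real.tendsto_sum_range_one_div_nat_succ_atTop.eventually (eventually_gt_atTop (1/K))).and (eventually_ge_atTop 1)).exists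
  refine ⟨m, fun F hF g u hu t₀ ht₀ x₀ xs hball hxs => ?_⟩
  have hmR : (1:ℝ) ≤ m := by exact_mod_cast hm
  set S : ℝ := 2*m^2 with hS
  have hS0 : 0 < S := by positivity
  have hr' := hu.restart ht₀
  have hsrc := src_sol hF hr'
  have hmild := congrFun (sol_mild hF hu ht₀ hS0).1 x₀
  have hadm := adm0 gm_GB (kC_nonneg d) hM hsrc
  have hIntg := hadm.ints S x₀
  unfold PV at hmild
  rw [Jd_eq _ hS0] at hmild
  have hP0 : 0 ≤ Ak gm S (u t₀) x₀ := Pt_nonneg (fun x => (hu.mem_Icc t₀ x ht₀.le).1) S x₀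
  set W : ℕ → Set ℝ := fun i => Ioo (S - 2*((i:ℝ)+1)^2) (S - ((i:ℝ)+1)^2) with hW
  have hWs : ∀ i ∈ Finset.range m, W i ⊆ Ioo 0 S := fun i hi s hs => by
    have : ((i:ℝ)+1) ≤ m := by exact_mod_cast Finset.mem_range.1 hi
    have h2 : ((i:ℝ)+1)^2 ≤ (m:ℝ)^2 := by gcongr
    exact ⟨by linarith [hs.1], by have := hs.2; have : 0 < ((i:ℝ)+1)^2 := by positivity
                                  linarith⟩
  have hWint : ∀ i, IntegrableOn ((W i).indicator (fun _ => K/((i:ℝ)+1)^3)) (Ioo 0 S) := fun i =>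
    (integrableOn_const (by simp)).indicator measurableSet_Ioo
  have hlow : ∑ i ∈ Finset.range m, K * (1/((i:ℝ)+1)) ≤ ∫ s in Ioo 0 S, Ak gm (S - s) (fun x => F x (u (t₀ + s) x)) x₀ := by
    calc ∑ i ∈ Finset.range m, K * (1/((i:ℝ)+1)) = ∑ i ∈ Finset.range m, ∫ s in Ioo 0 S, (W i).indicator (fun _ => K/((i:ℝ)+1)^3) s := by
          refine Finset.sum_congr rfl fun i hi => ?_
          rw [setIntegral_indicator measurableSet_Ioo, inter_eq_right.2 (hWs i hi), setIntegral_const, Real.volume_real_Ioo_of_le (by nlinarith [sq_nonneg ((i:ℝ)+1)]), smul_eq_mul]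
          field_simp; ring
      _ = ∫ s in Ioo 0 S, ∑ i ∈ Finset.range m, (W i).indicator (fun _ => K/((i:ℝ)+1)^3) s := (integral_finsetSum _ fun i _ => hWint i).symm
      _ ≤ _ := by
        refine setIntegral_mono_on (integrable_finsetSum _ fun i _ => hWint i) hIntg measurableSet_Ioo fun s hs => ?_
        classical
        have hτ : 0 < S - s := by linarith [hs.2]
        have hc := (hsrc.contx hs.1).measurable
        have hb := Pt_ge_balls (x := x₀) hc (fun x => hsrc.bd s x hs.1) (fun x => hF.nonneg x _ (hu.mem_Icc (t₀+s) x (by linarith [hs.1]))) hξ.le hr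
          (J := (Finset.range m).filter (fun i => s ∈ W i)) (xs := fun i => xs (i+1)) (Dd := fun i => C₃ * ((i:ℝ)+1))
          (fun i hi j hj hij => by
            have := Finset.mem_range.1 (Finset.mem_filter.1 hj).1
            exact (hxs (j+1) (by omega) (by omega)).2 (i+1) (by omega) (by omega))
          (fun j hj y hy => by
            have := Finset.mem_range.1 (Finset.mem_filter.1 hj).1
            exact hball s hs (j+1) (by omega) (by omega) y hy) hτ
          (fun j hj => by
            have := Finset.mem_range.1 (Finset.mem_filter.1 hj).1
            rw [norm_sub_rev]
            have := (hxs (j+1) (by omega) (by omega)).1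
            push_cast at this; exact this)
        refine le_trans ?_ hb
        rw [Finset.sum_filter]
        refine Finset.sum_le_sum fun i hi => ?_
        by_cases hsW : s ∈ W i
        · rw [indicator_of_mem hsW, if_pos hsW]
          set j : ℝ := (i:ℝ)+1 with hj
          have hj1 : 1 ≤ j := by rw [hj]; linarith [(Nat.cast_nonneg i : (0:ℝ) ≤ i)]
          have h1 : j^2 ≤ S - s := by linarith [hsW.2]
          have h2 : S - s ≤ 2*j^2 := by linarith [hsW.1]
          have hq : Real.sqrt (S - s) ≤ Real.sqrt 2 * j := by
            rw [Real.sqrt_le_iff]; refine ⟨by positivity, ?_⟩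
            rw [mul_pow, Real.sq_sqrt two_pos.le]; exact h2
          have hq0 : 0 < Real.sqrt (S-s) := Real.sqrt_pos.2 hτ
          have hs2 : 1 ≤ Real.sqrt 2 := by rw [Real.one_le_sqrt]; norm_num
          have hq1 : 1 ≤ Real.sqrt 2 * j := by nlinarith
          have e1 : (Real.sqrt 2)⁻¹ ^ 3 / j^3 ≤ (Real.sqrt (S-s))⁻¹ ^ d := by
            calc (Real.sqrt 2)⁻¹ ^ 3 / j^3 = (Real.sqrt 2 * j)⁻¹ ^ 3 := by rw [mul_inv, mul_pow, inv_pow j, div_eq_mul_inv]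
              _ ≤ (Real.sqrt 2 * j)⁻¹ ^ d := pow_le_pow_of_le_one (by positivity) (inv_le_one_of_one_le₀ hq1) hd3
              _ ≤ _ := by gcongr
          have e2 : Real.exp (-(1/4) * (C₃ + r)^2) ≤ Real.exp (-(1/4) * ((C₃ * j + r)^2 / (S - s))) := by
            apply Real.exp_le_exp.2
            have : (C₃ * j + r)^2 / (S - s) ≤ (C₃ + r)^2 := by
              rw [div_le_iff₀ hτ]
              calc (C₃ * j + r)^2 ≤ ((C₃ + r) * j)^2 := by
                    have : C₃ * j + r ≤ (C₃ + r) * j := by nlinarith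
                    gcongr
                _ = (C₃+r)^2 * j^2 := by ring
                _ ≤ _ := by gcongr
            linarith
          have g0 := gcst_pos d
          have v0 := vr_pos d hr
          calc K / j^3 = ξ₂ * (((Real.sqrt 2)⁻¹ ^ 3 / j^3) * (gcst d * Real.exp (-(1/4) * (C₃ + r)^2)) * vr d r) := by rw [hK]; ring
            _ ≤ _ := by gcongr
        · rw [indicator_of_notMem hsW, if_neg hsW]
  rw [← Finset.mul_sum] at hlow
  have hle := (hu.mem_Icc (t₀ + S) x₀ (by linarith)).2
  have h1 : 1 < K * ∑ i ∈ Finset.range m, (1/((i:ℝ)+1)) := by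
    rw [div_lt_iff₀ hK0] at hm1; linarith
  linarith
end

section
open MeasureTheory Metric Set Filter
open scoped Topology RealInnerProductSpace NNReal Pointwise
set_option linter.unusedVariables false
set_option linter.unusedSectionVars false
variable {d : ℕ}

set_option maxHeartbeats 4000000 in
/-- bounded width -/
lemma bwidth (hd3 : d ≤ 3) {f₀ : ℝ → ℝ} {M θ₀ θ ζ ξ c₀ : ℝ} (hM : 1 ≤ M) (h0 : F0 f₀ θ₀) (hθ : 0 < θ) (hζ : 0 < ζ) (hζc : ζ < c₀^2/4) (hξ : 0 < ξ)
    (hc : 0 < c₀) (hf : IsTravelingFrontSpeed f₀ c₀) (Ts : ℝ → ℝ) (hTs : ∀ η, 0 ≤ Ts η) {η : ℝ} (hη : 0 < η) :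
    ∃ T > 0, ∀ (F : Euc d → ℝ → ℝ), Ctx f₀ M θ₀ θ ζ ξ F → ∀ g u, Own Ts F g u → ∀ t > 0, ∀ x, θ/8 ≤ u t x → 1 - η ≤ u (t + T) x := by
  have hM0 : 0 ≤ M := by linarith
  set a₀ := 2 * Real.sqrt ζ with ha₀
  have ha₀0 : 0 < a₀ := by have := Real.sqrt_pos.2 hζ; positivity
  have ha₀c : a₀ < c₀ := by
    have : Real.sqrt ζ < c₀/2 := by rw [Real.sqrt_lt' (by linarith)]; linarith
    linarith
  set c₁ := (2*a₀ + c₀)/3 with hc₁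
  set c₂ := (a₀ + 2*c₀)/3 with hc₂
  have hac : a₀ < c₁ := by linarith
  have hc₁0 : 0 < c₁ := by linarith
  have hcc : c₁ < c₂ := by linarith
  have hc₂0 : 0 < c₂ := by linarith
  have hc₂c : c₂ < c₀ := by linarith
  obtain ⟨δ, hδ, hspr⟩ := hotspread (d := d) (θ := θ) (ζ := ζ) (ξ := ξ) hM0 h0 hc hf hc₂0 hc₂c
  obtain ⟨Ch, hCh, hspδ⟩ := hspr δ hδ
  obtain ⟨Cη, hCη, hspη⟩ := hspr η hη
  obtain ⟨ξ₁, hξ₁, hper⟩ := persist (d := d) (θ := θ) hM0 h0 hζ hξ hδ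
  obtain ⟨ℓ, hℓ, htail⟩ := tailq (d := d) hζ (c := c₁) hac (show 0 < θ/8 by linarith)
  set cM := 2 * Real.sqrt M + 1 with hcM
  have hcM0 : 0 < cM := by positivity
  obtain ⟨ℓM, hℓM, htailM⟩ := tailq (d := d) (show 0 < M by linarith) (c := cM) (by linarith) (show 0 < θ/8 by linarith)
  set L := lipC d M 1 with hL
  have hL0 : 0 ≤ L := lipC_nonneg hM0 1
  obtain ⟨r₁, hr₁, hr₁2, hr₁ξ⟩ : ∃ r₁ > 0, 2*r₁ ≤ 1 ∧ M * (r₁ + L * r₁) ≤ ξ₁/2 := by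
    refine ⟨min (1/2) (ξ₁/(2*(M*(1+L)))), lt_min (by norm_num) (by positivity), ?_, ?_⟩
    · have := min_le_left (1/2) (ξ₁/(2*(M*(1+L)))); linarith
    · have h := min_le_right (1/2) (ξ₁/(2*(M*(1+L))))
      rw [le_div_iff₀ (by positivity)] at h
      nlinarith
  obtain ⟨a, σ, ha, hσ, hσ1, haσ⟩ : ∃ a σ : ℝ, 0 < a ∧ 0 < σ ∧ σ < 1 ∧ L * a + (L * d / a + M) * σ ≤ θ/2 := by
    set a := θ/(4*(L+1)) with ha
    have ha0 : 0 < a := by positivity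
    have h1 : L * a ≤ θ/4 := by rw [ha, mul_div_assoc', div_le_iff₀ (by positivity)]; nlinarith
    have hq : 0 < L * d / a + M := by positivity
    refine ⟨a, min (1/2) (θ/(4*(L * d / a + M))), ha0, lt_min (by norm_num) (by positivity), lt_of_le_of_lt (min_le_left _ _) (by norm_num), ?_⟩
    have h := min_le_right (1/2) (θ/(4*(L * d / a + M)))
    rw [le_div_iff₀ (by positivity)] at h
    linarith
  obtain ⟨Cb, hCb⟩ : ∃ Cb, Cb = Ts δ + (ℓM + cM * 2)/c₂ + ℓ/c₂ + Ch := ⟨_, rfl⟩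
  have hTδ := hTs δ
  have hCb0 : 0 < Cb := by rw [hCb]; positivity
  obtain ⟨C', hC'⟩ : ∃ C', C' = (1 + ℓ)/c₂ + Ch := ⟨_, rfl⟩
  obtain ⟨κ, hκ⟩ : ∃ κ, κ = 1 - c₁/c₂ := ⟨_, rfl⟩
  have hκ0 : 0 < κ := by rw [hκ, sub_pos, div_lt_one hc₂0]; exact hcc
  have hC'0 : 0 < C' := by rw [hC']; positivity
  obtain ⟨Cs, hCs⟩ : ∃ Cs, Cs = Cb + 1/c₂ + Ch := ⟨_, rfl⟩
  have hCs0 : 0 < Cs := by rw [hCs]; positivity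
  obtain ⟨C₃, hC₃⟩ : ∃ C₃, C₃ = 1 + ℓ + c₁ * ((C'+1)/κ) := ⟨_, rfl⟩
  have hC₃0 : 0 < C₃ := by rw [hC₃]; positivity
  obtain ⟨m, hm⟩ := sum_contra (d := d) hd3 hM0 (half_pos hξ₁) hr₁ hC₃0
  obtain ⟨Γb, hΓb⟩ : ∃ Γb, Γb = (C' * m + Cs + 1) + (2 + 2*(m:ℝ)^2 + C₃ * m / c₂ + Ch) := ⟨_, rfl⟩
  have hΓb0 : 0 < Γb := by rw [hΓb]; positivity
  refine ⟨Γb + ℓ/c₂ + Cη + Ts δ, by positivity, fun F hF g u hu t ht x hx => ?_⟩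
  have sol := hu.sol
  set D : ℝ → Euc d → Prop := fun s z => 0 < s ∧ ζ * u s z < F z (u s z) with hD
  set Hot : ℝ → Euc d → Prop := fun s z => 0 ≤ s ∧ 1 - δ ≤ u s z with hHot
  have hsp : ∀ s y t x, Hot s y → s + ‖x - y‖/c₂ + Ch ≤ t → Hot t x := fun s y t x h hst => by
    have : 0 ≤ ‖x - y‖/c₂ := by positivity
    exact ⟨by linarith [h.1], hspδ F hF Ts g u hu s h.1 y h.2 t x hst⟩
  have hst : ∀ y, 0 < g y → Hot (Ts δ) y := fun y hy => ⟨hTδ, hu.start δ hδ y hy⟩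
  -- a priori bound
  have hapr : ∀ t > 0, ∀ x, θ/8 ≤ u t x → Hot (Ts δ + (ℓM + cM * t)/c₂ + Ch) x := fun t ht x hx => by
    rcases htailM F g u sol hu.gc t ht x hx with ⟨s, hs, y, -, hy⟩ | ⟨y, hy, hgy⟩
    · exfalso
      have h1 := sol.mem_Icc s y hs.1.le
      have := (hF.toRx.up y (a := 0) ⟨le_rfl, zero_le_one⟩ h1 h1.1).1
      rw [hF.z0] at this
      linarith
    · refine hsp _ y _ x (hst y hgy) ?_
      have : ‖x - y‖/c₂ ≤ (ℓM + cM * t)/c₂ := by rw [norm_sub_rev]; gcongr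
      linarith
  have hDθ : ∀ s z, D s z → θ < u s z := fun s z h => by
    by_contra hle
    have h1 := sol.mem_Icc s z h.1.le
    have h2 := hF.ign z (u s z) ⟨h1.1, not_lt.1 hle⟩
    have h3 := h.2
    rw [h2] at h3
    nlinarith [h1.1]
  have hmono : ∀ s t x, Hot s x → s ≤ t → Hot t x := fun s t x h hst => ⟨h.1.trans hst, h.2.trans (hu.mono s t x h.1 hst)⟩
  have claim : ∀ t x, Fresh D 1 σ t x → Hot (t + Γb) x := by
    by_contra hfail
    push Not at hfail
    obtain ⟨t₀, x₀, xs, ht₀, hH₀, hxs⟩ := chain (D := D) (Hot := Hot) (m := m) hc₁0 hcc hCh hCb0 hσ hℓ one_pos hC' hκ hCs hC₃ (fun s z h => h.1) hmono hsp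
      (fun s z h => by
        have hz := hDθ s z h
        by_cases hs2 : s ≤ 2
        · left
          refine hmono _ _ _ (hapr s h.1 z (by linarith)) ?_
          have h1 : (ℓM + cM * s)/c₂ ≤ (ℓM + cM * 2)/c₂ := by gcongr
          have h2 : 0 < ℓ/c₂ := by positivity
          linarith [h.1]
        · push Not at hs2
          have h1 := time_reg hF.toRx sol (t := s - σ) (by linarith) ha hσ z
          rw [sub_add_cancel] at h1
          rcases htail F g u sol hu.gc (s - σ) (by linarith) z (by linarith) with ⟨s', hs', y, hy, hDy⟩ | ⟨y, hy, hgy⟩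
          · right
            refine ⟨s', y, hs'.2, ⟨hs'.1, hDy⟩, hy.le.trans ?_⟩
            have := mul_le_mul_of_nonneg_left (show s - σ - s' ≤ s - s' by linarith) hc₁0.le
            linarith
          · left
            refine hsp _ y _ z (hst y hgy) ?_
            have h2 : ‖z - y‖/c₂ ≤ ℓ/c₂ + s := by
              rw [norm_sub_rev, div_le_iff₀ hc₂0, add_mul, div_mul_cancel₀ _ hc₂0.ne']
              have : c₁ * (s - σ) ≤ s * c₂ := by nlinarith
              linarith
            have h3 : 0 < (ℓM + cM * 2)/c₂ := by positivity
            linarith)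
      (fun n => ⟨Ts δ + (ℓM + cM * n)/c₂ + Ch, fun s z h hsn => by
        refine hmono _ _ _ (hapr s h.1 z (by linarith [hDθ s z h])) ?_
        have : (ℓM + cM * s)/c₂ ≤ (ℓM + cM * n)/c₂ := by gcongr
        linarith⟩) (Γb := Γb) (by rw [hΓb]; have : 0 ≤ C₃ * m / c₂ := by positivity
                                  have : 0 ≤ (m:ℝ)^2 := by positivity
                                  linarith) hfail
    refine hm F hF.toRx g u sol (t₀ + 1) (by linarith) x₀ xs (fun s hs j hj1 hjm y hy => ?_) (fun j hj1 hjm => ?_)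
    · obtain ⟨⟨s', hs', hD'⟩, hdist, -⟩ := hxs j hj1 hjm
      have hjR : (j:ℝ) ≤ m := by exact_mod_cast hjm
      have hts : 0 ≤ t₀ + 1 + s := by linarith [hs.1]
      have hcold : u (t₀ + 1 + s) (xs j) ≤ 1 - δ := by
        by_contra hh
        push Not at hh
        apply hH₀
        refine hsp (t₀ + 1 + s) (xs j) _ x₀ ⟨hts, hh.le⟩ ?_
        have h1 : ‖x₀ - xs j‖/c₂ ≤ C₃ * m / c₂ := by
          rw [norm_sub_rev]; gcongr; exact hdist.trans (by gcongr)
        have h2 : 0 ≤ C' * m := by positivity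
        rw [hΓb]; linarith [hs.2]
      have h1 := hper F hF (xs j) (u s' (xs j)) (u (t₀+1+s) (xs j)) (sol.mem_Icc _ _ hD'.1.le) hD'.2 (hu.mono _ _ _ hD'.1.le (by linarith [hs.1])) hcold
      have h2 := hF.lip (xs j) y _ _ (sol.mem_Icc (t₀+1+s) (xs j) hts) (sol.mem_Icc (t₀+1+s) y hts)
      have h3 := sol_lip hF.toRx sol (t := t₀+1+s) (by linarith [hs.1]) (xs j) y
      rw [norm_sub_rev] at hy
      have h4 : M * (‖xs j - y‖ + |u (t₀+1+s) (xs j) - u (t₀+1+s) y|) ≤ M * (r₁ + L * r₁) := by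
        refine mul_le_mul_of_nonneg_left (add_le_add hy.le (h3.trans ?_)) hM0
        exact mul_le_mul_of_nonneg_left hy.le hL0
      have h5 := (abs_le.1 h2).2
      linarith
    · obtain ⟨-, h1, h2⟩ := hxs j hj1 hjm
      exact ⟨h1, fun i hi hij => hr₁2.trans (h2 i hi hij)⟩
  have hΓ0 : 0 ≤ ℓ/c₂ := by positivity
  rcases htail F g u sol hu.gc t ht x hx with ⟨s, hs, y, hy, hDy⟩ | ⟨y, hy, hgy⟩
  · obtain ⟨t', ht', hF'⟩ := fresh_exists (σ := σ) hσ (fun s z h => h.1) (⟨s, le_rfl, y, ⟨hs.1, hDy⟩, by simp⟩ : Nearby D 1 s y)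
    have hh := claim t' y hF'
    refine hspη F hF Ts g u hu _ hh.1 y hh.2 _ x ?_
    have h2 : ‖x - y‖/c₂ ≤ ℓ/c₂ + (t - s) := by
      rw [norm_sub_rev, div_le_iff₀ hc₂0, add_mul, div_mul_cancel₀ _ hc₂0.ne']
      have : c₁ * (t - s) ≤ (t - s) * c₂ := by nlinarith [hs.2]
      linarith
    linarith
  · have hh := hst y hgy
    refine hspη F hF Ts g u hu _ hh.1 y hh.2 _ x ?_
    have h2 : ‖x - y‖/c₂ ≤ ℓ/c₂ + t := by
      rw [norm_sub_rev, div_le_iff₀ hc₂0, add_mul, div_mul_cancel₀ _ hc₂0.ne']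
      have : c₁ * t ≤ t * c₂ := by nlinarith
      linarith
    linarith
end

section
open MeasureTheory Metric Set Filter
open scoped Topology RealInnerProductSpace NNReal Pointwise
set_option linter.unusedVariables false
set_option linter.unusedSectionVars false
variable {d : ℕ}

lemma Pt_ge_int {B : ℝ} {φ : Euc d → ℝ} (hφ : Measurable φ) (hb : ∀ x, |φ x| ≤ B) (h0 : ∀ x, 0 ≤ φ x) {x : Euc d} {r : ℝ}
    (hr : 0 < r) {τ σ S : ℝ} (hσ : 0 < σ) (hτ : σ ≤ τ) (hS : τ ≤ S) :
    (Real.sqrt S)⁻¹ ^ d * (gcst d * Real.exp (-(1/4) * (r^2 / σ))) * (∫ y in ball x r, φ y) ≤ Ak gm τ φ x := by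
  have hτ0 : 0 < τ := by linarith
  have hs : 0 < Real.sqrt τ := Real.sqrt_pos.2 hτ0
  rw [Ak_y gm hτ0, smul_eq_mul]
  simp only [smul_eq_mul]
  set c := (Real.sqrt τ)⁻¹ with hc
  have hc0 : 0 < c := inv_pos.2 hs
  have hIntg := yker_int hφ hb hc0.ne' x
  have hφi : IntegrableOn φ (ball x r) := by
    refine Measure.integrableOn_of_bounded (M := B) measure_ball_lt_top.ne hφ.aestronglyMeasurable (Eventually.of_forall fun y => hb y)
  have h1 : (gcst d * Real.exp (-(1/4) * (r^2 / σ))) * (∫ y in ball x r, φ y) ≤ ∫ y, φ y * gm (c • (x - y)) := by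
    calc (gcst d * Real.exp (-(1/4) * (r^2 / σ))) * (∫ y in ball x r, φ y)
        = ∫ y in ball x r, (gcst d * Real.exp (-(1/4) * (r^2 / σ))) * φ y := by rw [integral_const_mul]
      _ ≤ ∫ y in ball x r, φ y * gm (c • (x - y)) := by
          refine setIntegral_mono_on (hφi.const_mul _) hIntg.integrableOn measurableSet_ball fun y hy => ?_
          rw [mem_ball, dist_eq_norm] at hy
          rw [mul_comm]
          refine mul_le_mul_of_nonneg_left ?_ (h0 y)
          unfold gm gcst
          refine mul_le_mul_of_nonneg_left (Real.exp_le_exp.2 ?_) (by positivity)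
          rw [norm_smul, mul_pow, Real.norm_of_nonneg hc0.le]
          have e1 : c^2 = 1/τ := by rw [hc, inv_pow, Real.sq_sqrt hτ0.le, one_div]
          rw [e1]
          rw [norm_sub_rev] at hy
          have e3 : ‖x - y‖^2 ≤ r^2 := by gcongr
          have e4 : 1/τ * ‖x-y‖^2 ≤ r^2/σ := by
            rw [one_div_mul_eq_div]; gcongr
          linarith
      _ ≤ _ := setIntegral_le_integral hIntg (Eventually.of_forall fun y => mul_nonneg (h0 y) (gm_pos _).le)
  have hcd : (Real.sqrt S)⁻¹ ^ d ≤ c^d := by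
    rw [hc]; gcongr
  have hi0 : 0 ≤ ∫ y in ball x r, φ y := integral_nonneg fun y => h0 y
  have g0 := gcst_pos d
  calc _ = (Real.sqrt S)⁻¹ ^ d * ((gcst d * Real.exp (-(1/4) * (r^2 / σ))) * (∫ y in ball x r, φ y)) := by ring
    _ ≤ c^d * ((gcst d * Real.exp (-(1/4) * (r^2 / σ))) * (∫ y in ball x r, φ y)) := mul_le_mul_of_nonneg_right hcd (by positivity)
    _ ≤ _ := mul_le_mul_of_nonneg_left h1 (by positivity)

lemma diff_low {F : Euc d → ℝ → ℝ} {M : ℝ} (hF : Rx F M) {Ts : ℝ → ℝ} {g : Euc d → ℝ} {u : ℝ → Euc d → ℝ} (hu : Own Ts F g u) {t k s : ℝ} (ht : 0 < t) (hk : 0 < k) (hs : 0 < s) (x : Euc d) :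
    Real.exp (-M * s) * Ak gm s (fun y => u (t + k) y - u t y) x ≤ u (t + k + s) x - u (t + s) x := by
  have r1 := hu.sol.restart (t₀ := t + k) (by linarith)
  have r2 := hu.sol.restart ht
  refine heat_ge (z := fun s y => u (t + k + s) y - u (t + s) y) (φ := fun y => u (t + k) y - u t y) (K := -M) (B := 1) (r1.contOn.sub r2.contOn)
    (fun s x hs => ?_) (fun s x hs => ?_) ((hu.sol.contx (by linarith)).sub (hu.sol.contx ht)) (fun x => ?_)
    (fun x₀ => (r1.initLim x₀ (hu.sol.contx (by linarith)).continuousAt).sub (r2.initLim x₀ (hu.sol.contx ht).continuousAt)) hs x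
  · have h1 := r1.mem_Icc s x hs.le
    have h2 := r2.mem_Icc s x hs.le
    rw [abs_le]; constructor <;> linarith [h1.1, h1.2, h2.1, h2.2]
  · have c1 := (r1.spatial s hs).contDiffAt (x := x)
    have c2 := (r2.spatial s hs).contDiffAt (x := x)
    refine ⟨c1.sub c2, _, (r1.eqn s x hs).sub (r2.eqn s x hs), ?_⟩
    rw [lap_sub c1 c2]
    have := (hF.up x (r2.mem_Icc s x hs.le) (r1.mem_Icc s x hs.le) (hu.mono (t + s) (t + k + s) x (by linarith) (by linarith))).2
    linarith
  · have h1 := hu.sol.mem_Icc (t+k) x (by linarith)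
    have h2 := hu.sol.mem_Icc t x ht.le
    rw [abs_le]; constructor <;> linarith [h1.1, h1.2, h2.1, h2.2]

/-- lower bound for the time derivative at intermediate values -/
lemma ut_low (hd3 : d ≤ 3) {f₀ : ℝ → ℝ} {M θ₀ θ ζ ξ c₀ : ℝ} (hM : 1 ≤ M) (h0 : F0 f₀ θ₀) (hθ : 0 < θ) (hζ : 0 < ζ) (hζc : ζ < c₀^2/4) (hξ : 0 < ξ)
    (hc : 0 < c₀) (hf : IsTravelingFrontSpeed f₀ c₀) (Ts : ℝ → ℝ) (hTs : ∀ η, 0 ≤ Ts η) :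
    ∃ μ > 0, ∃ t₁ > 0, ∀ (F : Euc d → ℝ → ℝ), Ctx f₀ M θ₀ θ ζ ξ F → ∀ g u, Own Ts F g u → ∀ t ≥ t₁, ∀ x, θ/2 ≤ u t x → u t x ≤ 1 - θ/2 →
      μ ≤ lap (u t) x + F x (u t x) := by
  have hM0 : 0 ≤ M := by linarith
  obtain ⟨T, hT, hbw⟩ := bwidth (d := d) hd3 hM h0 hθ hζ hζc hξ hc hf Ts hTs (show 0 < θ/4 by linarith)
  set L := lipC d M 1 with hL
  have hL0 : 0 ≤ L := lipC_nonneg hM0 1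
  obtain ⟨a, σ, ha, hσ, hσ1, haσ⟩ : ∃ a σ : ℝ, 0 < a ∧ 0 < σ ∧ σ < 1 ∧ L * a + (L * d / a + M) * σ ≤ θ/8 := by
    set a := θ/(16*(L+1)) with ha
    have ha0 : 0 < a := by positivity
    have h1 : L * a ≤ θ/16 := by rw [ha, mul_div_assoc', div_le_iff₀ (by positivity)]; nlinarith
    have hq : 0 < L * d / a + M := by positivity
    refine ⟨a, min (1/2) (θ/(16*(L * d / a + M))), ha0, lt_min (by norm_num) (by positivity), lt_of_le_of_lt (min_le_left _ _) (by norm_num), ?_⟩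
    have h := min_le_right (1/2) (θ/(16*(L * d / a + M)))
    rw [le_div_iff₀ (by positivity)] at h
    linarith
  obtain ⟨r, hr, hLr⟩ : ∃ r > 0, L * r ≤ θ/16 := by
    refine ⟨θ/(16*(L+1)), by positivity, ?_⟩
    rw [mul_div_assoc', div_le_iff₀ (by positivity)]; nlinarith
  set cc := (Real.sqrt (σ+T))⁻¹ ^ d * (gcst d * Real.exp (-(1/4) * (r^2 / σ))) with hcc
  have g0 := gcst_pos d
  have v0 := vr_pos d hr
  have hcc0 : 0 < cc := by
    have : 0 < Real.sqrt (σ+T) := Real.sqrt_pos.2 (by linarith)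
    positivity
  refine ⟨Real.exp (-M * (σ+T)) * (cc * (vr d r * (θ/8)))/T, by positivity, σ + T + 2, by linarith, fun F hF g u hu t ht x hx1 hx2 => ?_⟩
  have sol := hu.sol
  have hdiff : vr d r * (θ/8) ≤ ∫ y in ball x r, (u (t - σ) y - u (t - σ - T) y) := by
    have hi : IntegrableOn (fun y => u (t - σ) y - u (t - σ - T) y) (ball x r) := by
      refine Measure.integrableOn_of_bounded (M := 1) measure_ball_lt_top.ne ((sol.contx (by linarith)).sub (sol.contx (by linarith))).measurable.aestronglyMeasurable (Eventually.of_forall fun y => ?_)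
      have h1 := sol.mem_Icc (t-σ) y (by linarith)
      have h2 := sol.mem_Icc (t-σ-T) y (by linarith)
      rw [Real.norm_eq_abs, abs_le]; constructor <;> linarith [h1.1, h1.2, h2.1, h2.2]
    calc vr d r * (θ/8) = ∫ y in ball x r, (θ/8) := by rw [setIntegral_const, vr_eq, smul_eq_mul]
      _ ≤ _ := by
        refine setIntegral_mono_on (integrableOn_const measure_ball_lt_top.ne) hi measurableSet_ball fun y hy => ?_
        rw [mem_ball, dist_eq_norm] at hy
        have hLy : L * ‖y - x‖ ≤ θ/16 := (mul_le_mul_of_nonneg_left hy.le hL0).trans hLr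
        have h1 := time_reg hF.toRx sol (t := t - σ) (by linarith) ha hσ x
        rw [sub_add_cancel] at h1
        have h2 := (abs_le.1 (sol_lip hF.toRx sol (t := t - σ) (by linarith) y x)).1
        have h3 : u (t - σ - T) y ≤ θ/8 := by
          by_contra hh
          push Not at hh
          have h4 := hbw F hF g u hu (t - σ - T) (by linarith) y hh.le
          have h5 := hu.mono (t - σ - T + T) t y (by linarith) (by linarith)
          have h6 := (abs_le.1 (sol_lip hF.toRx sol (t := t) (by linarith) y x)).2
          linarith
        linarith
  have hder := sol.eqn t x (by linarith)
  rw [hasDerivAt_iff_tendsto_slope_zero] at hder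
  have hk : Tendsto (fun N : ℕ => T/((N:ℝ)+1)) atTop (𝓝[≠] 0) := by
    refine tendsto_nhdsWithin_iff.2 ⟨?_, Eventually.of_forall fun N => ?_⟩
    · have := (tendsto_one_div_add_atTop_nhds_zero_nat (𝕜 := ℝ)).const_mul T
      simpa [div_eq_mul_inv] using this
    · have : 0 < T/((N:ℝ)+1) := by positivity
      exact this.ne'
  refine ge_of_tendsto' (hder.comp hk) fun N => ?_
  simp only [Function.comp, smul_eq_mul]
  set k := T/((N:ℝ)+1) with hkd
  have hk0 : 0 < k := by positivity
  have hkN : k * ((N:ℝ)+1) = T := by rw [hkd]; field_simp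
  set φ : ℕ → Euc d → ℝ := fun i y => u (t - σ - i * k) y - u (t - σ - (i+1) * k) y with hφ
  have hik : ∀ i ∈ Finset.range (N+1), ((i:ℝ)+1) * k ≤ T := fun i hi => by
    have : ((i:ℝ)+1) ≤ (N:ℝ)+1 := by exact_mod_cast Finset.mem_range.1 hi
    calc ((i:ℝ)+1) * k ≤ ((N:ℝ)+1) * k := by gcongr
      _ = T := by rw [mul_comm]; exact hkN
  have hpos : ∀ i ∈ Finset.range (N+1), 0 < t - σ - ((i:ℝ)+1) * k := fun i hi => by linarith [hik i hi]
  have hφc : ∀ i ∈ Finset.range (N+1), Continuous (φ i) := fun i hi =>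
    (sol.contx (by have := hpos i hi; linarith)).sub (sol.contx (hpos i hi))
  have hφ0 : ∀ i ∈ Finset.range (N+1), ∀ y, 0 ≤ φ i y := fun i hi y => by
    have := hu.mono (t - σ - ((i:ℝ)+1) * k) (t - σ - i * k) y (hpos i hi).le (by linarith)
    simp only [hφ]; linarith
  have hφb : ∀ i ∈ Finset.range (N+1), ∀ y, |φ i y| ≤ 1 := fun i hi y => by
    have h1 := sol.mem_Icc (t - σ - ((i:ℝ)+1) * k) y (hpos i hi).le
    have h2 := sol.mem_Icc (t - σ - i * k) y (by have := hpos i hi; linarith)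
    simp only [hφ]
    rw [abs_le]; constructor <;> linarith [h1.1, h1.2, h2.1, h2.2]
  have hφi : ∀ i ∈ Finset.range (N+1), IntegrableOn (φ i) (ball x r) := fun i hi =>
    Measure.integrableOn_of_bounded (M := 1) measure_ball_lt_top.ne (hφc i hi).measurable.aestronglyMeasurable (Eventually.of_forall fun y => hφb i hi y)
  have hone : ∀ i ∈ Finset.range (N+1), Real.exp (-M * (σ+T)) * (cc * ∫ y in ball x r, φ i y) ≤ u (t + k) x - u t x := fun i hi => by
    have hs : 0 < σ + ((i:ℝ)+1) * k := by positivity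
    have h1 := diff_low hF.toRx hu (hpos i hi) hk0 hs x
    have e1 : t - σ - ((i:ℝ)+1) * k + k = t - σ - i * k := by ring
    have e2 : t - σ - ((i:ℝ)+1) * k + k + (σ + ((i:ℝ)+1) * k) = t + k := by ring
    have e3 : t - σ - ((i:ℝ)+1) * k + (σ + ((i:ℝ)+1) * k) = t := by ring
    rw [e2, e3, e1] at h1
    have hq : 0 ≤ ((i:ℝ)+1)*k := by positivity
    have h2 := Pt_ge_int (hφc i hi).measurable (hφb i hi) (hφ0 i hi) (x := x) hr (τ := σ + ((i:ℝ)+1) * k) (σ := σ) (S := σ + T) hσ (by linarith) (by linarith [hik i hi])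
    have hi0 : 0 ≤ ∫ y in ball x r, φ i y := integral_nonneg fun y => hφ0 i hi y
    have h3 : Real.exp (-M * (σ+T)) ≤ Real.exp (-M * (σ + ((i:ℝ)+1) * k)) := by
      apply Real.exp_le_exp.2
      have := mul_le_mul_of_nonneg_left (hik i hi) hM0
      linarith
    refine le_trans ?_ h1
    exact mul_le_mul h3 h2 (by positivity) (Real.exp_pos _).le
  have hsum := Finset.sum_le_sum hone
  rw [← Finset.mul_sum, ← Finset.mul_sum, ← integral_finsetSum _ hφi, Finset.sum_const, Finset.card_range, nsmul_eq_mul] at hsum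
  have htel : ∀ y, ∑ i ∈ Finset.range (N+1), φ i y = u (t - σ) y - u (t - σ - T) y := fun y => by
    have := Finset.sum_range_sub' (fun i : ℕ => u (t - σ - i * k) y) (N+1)
    simp only [hφ]
    have e : ∀ i : ℕ, ((i+1:ℕ):ℝ) = (i:ℝ)+1 := fun i => by push_cast; ring
    simp only [e] at this
    rw [this]
    have e2 : ((N:ℝ)+1) * k = T := by rw [mul_comm]; exact hkN
    rw [e2]; simp
  simp only [htel] at hsum
  have hexp := Real.exp_pos (-M * (σ+T))
  have h5 : Real.exp (-M * (σ+T)) * (cc * (vr d r * (θ/8))) ≤ ((N+1:ℕ):ℝ) * (u (t+k) x - u t x) :=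
    le_trans (by gcongr) hsum
  rw [div_le_iff₀ hT]
  refine h5.trans (le_of_eq ?_)
  push_cast
  rw [← hkN]; field_simp
end

section
open MeasureTheory Metric Set Filter
open scoped Topology RealInnerProductSpace NNReal Pointwise
set_option linter.unusedVariables false
set_option linter.unusedSectionVars false
variable {d : ℕ}

lemma inner_near {e : Euc d} (he : ‖e‖ = 1) {x y : Euc d} {r : ℝ} (h : ‖y - x‖ < r) : ⟪y, e⟫ < ⟪x, e⟫ + r := by
  have h1 : ⟪y - x, e⟫ ≤ ‖y - x‖ := by
    have := real_inner_le_norm (y - x) e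
    rwa [he, mul_one] at this
  rw [inner_sub_left] at h1
  linarith

lemma hot {f₀ : ℝ → ℝ} {M θ₀ θ ζ ξ : ℝ} {c₂ ct h : ℝ} {Φ p q : ℝ → ℝ} (h0 : F0 f₀ θ₀) (hP : Prof f₀ θ₀ c₂ ct h Φ p q) (hct : 0 < ct)
    {η : ℝ} (hη : 0 < η) (A : ℝ) :
    ∃ t > 0, ∀ (F : Euc d → ℝ → ℝ), Ctx f₀ M θ₀ θ ζ ξ F → ∀ g u, IsSolR F g u → Continuous g → ∀ (e : Euc d) (a : ℝ), ‖e‖ = 1 →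
      (∀ x, Φ (⟪x, e⟫ + a) ≤ g x) → ∀ z, ⟪z, e⟫ + a ≤ A → 1 - η ≤ u t z := by
  have th := h0.th
  set η' := min η ((1-θ₀)/4) with hη'
  have h1 : 0 < η' := lt_min hη (by linarith [th.2])
  have h2 : η' < (1-θ₀)/2 := lt_of_le_of_lt (min_le_right _ _) (by linarith [th.2])
  obtain ⟨T', hT', R', hR', hG⟩ := lemG (d := d) (M := M) (θ := θ) (ζ := ζ) (ξ := ξ) h0 h1 h2
  obtain ⟨S, hS⟩ := hP.lim _ hP.hh.1
  set τ := max 1 ((A + R' - S)/ct) with hτ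
  have hτ1 : 1 ≤ τ := le_max_left _ _
  have hτ2 : A + R' - S ≤ τ * ct := (div_le_iff₀ hct).1 (le_max_right _ _)
  refine ⟨τ + T', by linarith, fun F hF g u hu hg e a he hle z hz => ?_⟩
  have hr := hu.restart (t₀ := τ) (by linarith)
  have := hG F hF _ _ hr z (fun y hy => ⟨?_, (hu.contx (by linarith)).continuousAt⟩)
  · have := min_le_left η ((1-θ₀)/4)
    linarith
  · have h3 := planar_sub hP hF hu hg he hle (t := τ) (by linarith) y
    have h4 := inner_near he hy
    exact (hS _ (by linarith)).trans h3

lemma own_exists {f₀ : ℝ → ℝ} {M θ₀ θ ζ ξ c₀ : ℝ} (h0 : F0 f₀ θ₀) (hc : 0 < c₀) (hf : IsTravelingFrontSpeed f₀ c₀) :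
    ∃ Ts : ℝ → ℝ, (∀ η, 0 ≤ Ts η) ∧ ∀ (F : Euc d → ℝ → ℝ), Ctx f₀ M θ₀ θ ζ ξ F → ∀ e : Euc d, ‖e‖ = 1 →
      ∃ g u, Own Ts F g u ∧ (∃ T > 0, ∀ w, IsSolR F ({x : Euc d | ⟪x, e⟫ < 0}.indicator fun _ => (1+θ₀)/2) w → ∀ t, 0 ≤ t → ∀ x, u t x ≤ w (T + t) x) ∧
        ∀ α > 0, ∃ t₀ > 0, ∀ x, ⟪x, e⟫ ≤ 1 → 1 - α ≤ u t₀ x := by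
  have th := h0.th
  obtain ⟨ct, h, Φ, p, q, hP⟩ := prof_exists h0 hc hf le_rfl hc
  have hct := hP.hc
  have hh := hP.hh
  have hot' := fun (η : ℝ) (hη : 0 < η) (A : ℝ) => hot (d := d) (M := M) (θ := θ) (ζ := ζ) (ξ := ξ) h0 hP hct hη A
  have hTs : ∀ η : ℝ, ∃ t : ℝ, 0 ≤ t ∧ (0 < η → ∀ (F : Euc d → ℝ → ℝ), Ctx f₀ M θ₀ θ ζ ξ F → ∀ g u, IsSolR F g u → Continuous g → ∀ (e : Euc d) (a : ℝ), ‖e‖ = 1 →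
      (∀ x, Φ (⟪x, e⟫ + a) ≤ g x) → ∀ z, ⟪z, e⟫ + a ≤ 0 → 1 - η ≤ u t z) := fun η => by
    by_cases hη : 0 < η
    · obtain ⟨t, ht, h⟩ := hot' η hη 0
      exact ⟨t, ht.le, fun _ => h⟩
    · exact ⟨0, le_rfl, fun h => absurd h hη⟩
  choose Ts hTs0 hTs1 using hTs
  obtain ⟨Th, hTh, Rh, hRh, hG⟩ := lemG (d := d) (M := M) (θ := θ) (ζ := ζ) (ξ := ξ) (η := 1 - h) h0 (by linarith [hh.2]) (by linarith [hh.1])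
  refine ⟨Ts, hTs0, fun F hF e he => ?_⟩
  have hΦc : Continuous Φ := continuous_iff_continuousAt.2 fun s => (hP.d1 s).continuousAt
  set g : Euc d → ℝ := fun x => max 0 (Φ (⟪x, e⟫ + Rh)) with hg
  have hgc : Continuous g := by simp only [hg]; fun_prop
  have hle : ∀ x, Φ (⟪x, e⟫ + Rh) ≤ g x := fun x => le_max_right _ _
  obtain ⟨u, hu, -, -⟩ := ET hF.toRx hgc.measurable (fun x => ⟨le_max_left _ _, max_le zero_le_one ((hP.lt _).trans hh.2).le⟩)
  have hmono : ∀ s t x, 0 ≤ s → s ≤ t → u s x ≤ u t x := fun s t x hs hst => by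
    rcases eq_or_lt_of_le hst with h | h
    · rw [h]
    have hk : 0 < t - s := by linarith
    have := sol_cmp hF.toRx hu (hu.restart hk) hgc (hu.contx hk) (fun y => ?_) hs x
    · simpa using this
    · refine max_le (hu.mem_Icc _ y hk.le).1 (le_trans (hP.anti.antitone ?_) (planar_sub hP hF hu hgc he hle hk.le y))
      have : 0 < ct * (t - s) := mul_pos hct hk
      linarith
  refine ⟨g, u, ⟨hu, hgc, hmono, hTs0, fun η hη z hz => ?_⟩, ⟨Th, hTh, fun w hw t ht x => ?_⟩, fun α hα => ?_⟩
  · refine hTs1 η hη F hF g u hu hgc e Rh he hle z ?_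
    by_contra hn
    push Not at hn
    have h1 := hP.anti hn
    rw [hP.zero] at h1
    simp only [hg] at hz
    rw [max_eq_left h1.le] at hz
    exact lt_irrefl _ hz
  · refine sol_cmp hF.toRx hu (hw.restart hTh) hgc (hw.contx hTh) (fun y => ?_) ht x
    refine max_le (hw.mem_Icc _ y hTh.le).1 ?_
    by_cases hy : ⟪y, e⟫ + Rh ≤ 0
    · have := hG F hF _ w hw y (fun z hz => ?_)
      · linarith [hP.lt (⟪y, e⟫ + Rh)]
      · have hz0 : ⟪z, e⟫ < 0 := by linarith [inner_near he hz]
        have hop : IsOpen {x : Euc d | ⟪x, e⟫ < 0} := isOpen_lt (by fun_prop) continuous_const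
        refine ⟨by rw [indicator_of_mem (show z ∈ {x : Euc d | ⟪x, e⟫ < 0} from hz0)], ?_⟩
        refine (continuousAt_const (y := (1+θ₀)/2)).congr ?_
        filter_upwards [hop.mem_nhds hz0] with v hv
        rw [indicator_of_mem (show v ∈ {x : Euc d | ⟪x, e⟫ < 0} from hv)]
    · push Not at hy
      have h1 := hP.anti hy
      rw [hP.zero] at h1
      exact h1.le.trans (hw.mem_Icc _ y hTh.le).1
  · obtain ⟨t, ht, h⟩ := hot' α hα (1 + Rh)
    exact ⟨t, ht, fun x hx => h F hF g u hu hgc e Rh he hle x (by linarith)⟩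
end

section
open MeasureTheory Metric Set Filter
open scoped Topology RealInnerProductSpace NNReal Pointwise
set_option linter.unusedVariables false
set_option linter.unusedSectionVars false
variable {d : ℕ}

lemma deriv_nonneg_of_mono {φ : ℝ → ℝ} {D t : ℝ} (ht : 0 < t) (hm : ∀ s s', 0 ≤ s → s ≤ s' → φ s ≤ φ s') (h : HasDerivAt φ D t) : 0 ≤ D := by
  have h1 := h.hasDerivWithinAt (s := Ioi 0)
  have hmo : MonotoneOn φ (Ioi 0) := fun s hs s' _ hss => hm s s' (le_of_lt hs) hss
  have h2 := hmo.derivWithin_nonneg (x := t)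
  rwa [h1.derivWithin (isOpen_Ioi.uniqueDiffWithinAt ht)] at h2

lemma main_cmp {f₀ : ℝ → ℝ} {M θ₀ θ ζ ξ μ t₀ α : ℝ} {F : Euc d → ℝ → ℝ} (hF : Ctx f₀ M θ₀ θ ζ ξ F) {Ts : ℝ → ℝ} {g : Euc d → ℝ} {u : ℝ → Euc d → ℝ}
    (hu : Own Ts F g u) (hμ : 0 < μ) (hlow : ∀ t ≥ t₀, ∀ x, θ/2 ≤ u t x → u t x ≤ 1 - θ/2 → μ ≤ lap (u t) x + F x (u t x))
    (ht₀ : 0 < t₀) (hα : 0 < α) (hαθ : α ≤ θ/2) {e : Euc d} (hini : ∀ x, ⟪x, e⟫ ≤ 1 → 1 - α ≤ u t₀ x)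
    {w : ℝ → Euc d → ℝ} (hw : IsSolR F (fun x => if ⟪x, e⟫ < 0 then 1 else α) w) {t : ℝ} (ht : 0 < t) (x : Euc d) :
    w t x ≤ u (t₀ + (1 + M*α/μ) * t) x + α := by
  have hM := hF.toRx.Mn
  set δ := M*α/μ with hδ
  have hδ0 : 0 ≤ δ := by positivity
  have hδμ : δ * μ = M * α := by rw [hδ]; field_simp
  have hpos : ∀ s, 0 ≤ s → 0 < t₀ + (1+δ)*s := fun s hs => by positivity
  have hge : ∀ s, 0 ≤ s → t₀ ≤ t₀ + (1+δ)*s := fun s hs => by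
    have : 0 ≤ (1+δ)*s := by positivity
    linarith
  set v : ℝ → Euc d → ℝ := fun s y => u (t₀ + (1+δ)*s) y + α with hv
  have hvc : ∀ s, 0 ≤ s → ∀ y, ContinuousAt (fun p : ℝ × Euc d => v p.1 p.2) (s, y) := fun s hs y => by
    refine ContinuousAt.add ?_ continuousAt_const
    exact ContinuousAt.comp (f := fun p : ℝ × Euc d => (t₀ + (1+δ)*p.1, p.2)) (g := fun p : ℝ × Euc d => u p.1 p.2)
      (hu.sol.contAt (hpos s hs) y) (by fun_prop)
  refine super_ge hF.toRx hw t (v := v) (fun s hs y => ?_) (fun p hp => (hvc p.1 hp.1.1.le p.2).continuousWithinAt) (fun s hs y hy => ?_)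
    (fun y ε hε => ?_) t ⟨ht, le_rfl⟩ x
  · have := (hu.sol.mem_Icc _ y (hpos s hs.1.le).le).1
    simp only [hv]; linarith
  · have hs0 := hpos s hs.1.le
    have hUI := hu.sol.mem_Icc _ y hs0.le
    have hcd := (hu.sol.spatial _ hs0).contDiffAt (x := y)
    have hder := hu.sol.eqn _ y hs0
    have hlow' := hlow _ (hge s hs.1.le) y
    have hD0 := deriv_nonneg_of_mono hs0 (fun s s' h h' => hu.mono s s' y h h') hder
    have hl : lap (v s) y = lap (u (t₀ + (1+δ)*s)) y := by
      have := lap_add hcd (contDiffAt_const (c := α))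
      rw [lap_const, add_zero] at this
      exact this
    have hinner : HasDerivAt (fun s : ℝ => t₀ + (1+δ)*s) (1+δ) s :=
      (((hasDerivAt_id s).const_mul (1+δ)).const_add t₀).congr_deriv (by ring)
    have hvd : HasDerivAt (fun s => v s y) ((lap (u (t₀ + (1+δ)*s)) y + F y (u (t₀ + (1+δ)*s) y)) * (1+δ)) s :=
      (HasDerivAt.comp (h₂ := fun τ => u τ y) (h := fun s : ℝ => t₀ + (1+δ)*s) s hder hinner).add_const α
    refine ⟨hcd.add contDiffAt_const, _, hvd, ?_⟩
    rw [hl]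
    have hvy : v s y = u (t₀ + (1+δ)*s) y + α := rfl
    rw [hvy] at hy ⊢
    generalize u (t₀ + (1+δ)*s) y = U at *
    generalize lap (u (t₀ + (1+δ)*s)) y = L at *
    have hUα : U + α ∈ Icc (0:ℝ) 1 := ⟨by linarith [hUI.1], hy.le⟩
    have hδD : 0 ≤ δ * (L + F y U) := mul_nonneg hδ0 hD0
    suffices F y (U + α) ≤ F y U + δ * (L + F y U) by nlinarith
    by_cases h1 : U < θ/2
    · rw [hF.ign y (U+α) ⟨hUα.1, by linarith⟩]
      linarith [hF.toRx.nonneg y U hUI]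
    by_cases h2 : 1 - θ/2 < U
    · have := hF.anti y (show U ∈ Icc (1-θ) 1 from ⟨by linarith, hUI.2⟩) (show U + α ∈ Icc (1-θ) 1 from ⟨by linarith, hUα.2⟩) (by linarith)
      linarith
    · push Not at h1 h2
      have h3 := hlow' h1 h2
      have h4 := (hF.toRx.up y hUI hUα (by linarith)).1
      have h5 := mul_le_mul_of_nonneg_left h3 hδ0
      rw [hδμ] at h5
      linarith
  · have hc := ev_of_contAt (v := v) (x₀ := y) (hvc 0 le_rfl y)
    have hv0 : v 0 y = u t₀ y + α := by simp [hv]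
    rw [hv0] at hc
    by_cases hy : ⟪y, e⟫ < 1
    · have h1 := hini y hy.le
      filter_upwards [hc.eventually (le_mem_nhds (show u t₀ y + α - ε < u t₀ y + α by linarith)), ev_pos y] with p hp hp2
      have := (hw.mem_Icc p.1 p.2 hp2.le).2
      linarith
    · push Not at hy
      have hop : IsOpen {x : Euc d | 0 < ⟪x, e⟫} := isOpen_lt continuous_const (by fun_prop)
      have hy0 : 0 < ⟪y, e⟫ := by linarith
      have hgc : ContinuousAt (fun x : Euc d => if ⟪x, e⟫ < 0 then (1:ℝ) else α) y := by
        refine (continuousAt_const (y := α)).congr ?_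
        filter_upwards [hop.mem_nhds hy0] with z hz
        have hz' : 0 < ⟪z, e⟫ := hz
        rw [if_neg (by linarith)]
      have h1 := hw.initLim y hgc
      rw [if_neg (by linarith)] at h1
      refine (h1.sub hc).eventually (ge_mem_nhds ?_)
      have := (hu.sol.mem_Icc t₀ y ht₀.le).1
      linarith

lemma K_bound {e : Euc d} {c : ℝ} {K : Set (Euc d)} (hK : IsCompact K) (hKs : K ⊆ {x : Euc d | 0 < ⟪x, e⟫}) (he : ‖e‖ = 1) :
    ∃ r₀ : ℝ, 0 < r₀ ∧ r₀ < 1 ∧ ∃ K' : Set (Euc d), IsCompact K' ∧ K' ⊆ {x : Euc d | 0 < ⟪x, e⟫} ∧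
      ∀ k ∈ K, ∀ r ∈ Icc r₀ 1, r • k - ((1 - r) * c) • e ∈ K' := by
  obtain ⟨m, hm, hmK⟩ : ∃ m > 0, ∀ k ∈ K, m ≤ ⟪k, e⟫ := by
    rcases K.eq_empty_or_nonempty with h | h
    · exact ⟨1, one_pos, fun k hk => by rw [h] at hk; exact hk.elim⟩
    · obtain ⟨k₀, hk₀, hmin⟩ := hK.exists_isMinOn h (f := fun k : Euc d => ⟪k, e⟫) (by fun_prop)
      exact ⟨_, hKs hk₀, fun k hk => hmin hk⟩
  have hc := abs_nonneg c
  have hden : 0 < |c| + m := by positivity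
  refine ⟨(|c| + m/2)/(|c| + m), by positivity, by rw [div_lt_one hden]; linarith,
    (fun p : Euc d × ℝ => p.2 • p.1 - ((1 - p.2) * c) • e) '' (K ×ˢ Icc ((|c| + m/2)/(|c| + m)) 1),
    (hK.prod isCompact_Icc).image (by fun_prop), ?_, fun k hk r hr => ⟨(k, r), ⟨hk, hr⟩, rfl⟩⟩
  rintro _ ⟨⟨k, r⟩, ⟨hk, hr⟩, rfl⟩
  have hk' := hmK k hk
  have hr1 := hr.1
  have hr2 := hr.2
  simp only at hr1 hr2
  rw [div_le_iff₀ hden] at hr1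
  have hr0 : 0 < r := by
    by_contra hn
    push Not at hn
    nlinarith
  simp only [mem_ofPred_eq, inner_sub_left, inner_smul_left, real_inner_self_eq_norm_sq, he]
  simp only [conj_trivial]
  have h1 : r * m ≤ r * ⟪k, e⟫ := mul_le_mul_of_nonneg_left hk' hr0.le
  have h2 : (1 - r) * c ≤ (1 - r) * |c| := mul_le_mul_of_nonneg_left (le_abs_self c) (by linarith)
  nlinarith
end

/-- Theorem 1.6(i): under (H1)–(H3), `d ≤ 3`, for an ignition reaction
`f ∈ F(f₀,M,ζ,ξ)` with `ζ < c₀²/4`, `ξ > 0`, any deterministic front speed in direction `e` is a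
deterministic exclusive front speed in direction `e`. -/
theorem stmt3 {d : ℕ} (hd1 : 1 ≤ d) (hd3 : d ≤ 3)
    {Ω : Type*} [MeasurableSpace Ω] (P : Measure Ω) [IsProbabilityMeasure P]
    (T : Euc d → Ω → Ω)
    (hTmp : ∀ y, MeasurePreserving (T y) P P)
    (hTgrp : ∀ y z : Euc d, T y ∘ T z = T (y + z))
    (f : Euc d → ℝ → Ω → ℝ) (f₀ : ℝ → ℝ) (M θ₀ : ℝ)
    (hmeas : Measurable fun p : (Euc d × ℝ) × Ω => f p.1.1 p.1.2 p.2)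
    (h1 : H1 f f₀ M θ₀)
    (h2 : ∀ (x y : Euc d) (u : ℝ) (ω : Ω), f (x + y) u ω = f x u (T y ω))
    (h3 : ∀ E : Set Ω, MeasurableSet E → (∀ y, T y ⁻¹' E = E) → P E = 0 ∨ P E = 1)
    (hign : ∃ θ : ℝ, 0 < θ ∧ (∀ (x : Euc d) (ω : Ω), ∀ u ∈ Icc (0:ℝ) θ, f x u ω = 0) ∧
      ∀ (x : Euc d) (ω : Ω), AntitoneOn (fun u => f x u ω) (Icc (1-θ) 1))
    (c₀ ζ ξ : ℝ) (hc₀ : 0 < c₀) (hc₀front : IsTravelingFrontSpeed f₀ c₀)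
    (hζpos : 0 < ζ) (hζ : ζ < c₀ ^ 2 / 4) (hξ : 0 < ξ)
    (hF : memF f θ₀ ζ ξ)
    (e : Euc d) (he : e ∈ sphere (0:Euc d) 1) (c : ℝ)
    (hfs : DetFrontSpeed P f θ₀ e c) :
    DetExclFrontSpeed P f θ₀ e c := by
  have th := h1.theta_mem
  have hM := h1.M_ge_one
  have hM0 : 0 < M := by linarith
  have he1 : ‖e‖ = 1 := by simpa using he
  have h0 : F0 f₀ θ₀ := ⟨th, h1.f0_lip, h1.f0_nonneg, h1.f0_zero_low, h1.f0_zero_one, h1.f0_pos⟩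
  obtain ⟨θ', hθ', hig, han⟩ := hign
  obtain ⟨θ, hθ, hθle⟩ : ∃ θ > 0, θ ≤ θ' := ⟨θ', hθ', le_rfl⟩
  have hctx : ∀ ω, Ctx f₀ M θ₀ θ ζ ξ (fun x v => f x v ω) := fun ω =>
    { Mn := hM0.le
      lip := fun x x' u u' hu hu' => h1.lip x x' u u' ω hu hu'
      nonneg := fun x u hu => h1.nonneg x u ω hu
      z0 := fun x => h1.zero_at_zero x ω
      z1 := fun x => h1.zero_at_one x ω
      f0_le := fun x u hu => h1.f0_le x u ω hu
      ign := fun x u hu => hig x ω u ⟨hu.1, hu.2.trans hθle⟩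
      anti := fun x => (han x ω).mono (Icc_subset_Icc (by linarith) le_rfl)
      per := fun x a b ha hab hb hb0 => by
        have hm : a ∈ {u : ℝ | 0 ≤ u ∧ ζ * u < f x u ω} := ⟨ha.1, hab⟩
        refine hF x ω ⟨a, hm⟩ b ⟨le_trans (csInf_le ⟨0, fun y hy => hy.1⟩ hm) hb, hb0⟩ }
  obtain ⟨Ts, hTs, hown⟩ := own_exists (d := d) (M := M) (θ := θ) (ζ := ζ) (ξ := ξ) h0 hc₀ hc₀front
  obtain ⟨μ, hμ, t₁, ht₁, hlow⟩ := ut_low (d := d) hd3 hM h0 hθ hζpos hζ hξ hc₀ hc₀front Ts hTs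
  refine ⟨hfs, fun K hK hKs => ?_⟩
  obtain ⟨r₀, hr0, hr1, K', hK', hKs', hKK⟩ := K_bound (c := c) hK hKs he1
  obtain ⟨Ω₀, hΩm, hΩ1, hΩ⟩ := hfs
  set A := min (θ/2) (μ * (1 - r₀) / (2 * M * r₀)) with hA
  have hA0 : 0 < A := by
    refine lt_min (by linarith) (div_pos (mul_pos hμ (by linarith)) (by positivity))
  refine ⟨fun α => if α ≤ A then α else 1, fun α hα => ?_, ?_, Ω₀, hΩm, hΩ1, fun ω hω α hα w hw ε hε => ?_⟩
  · simp only
    split_ifs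
    · exact hα
    · exact ⟨one_pos, le_rfl⟩
  · have hid : Tendsto (fun α : ℝ => α) (𝓝[>] (0:ℝ)) (𝓝 0) := tendsto_id.mono_left nhdsWithin_le_nhds
    refine hid.congr' ?_
    filter_upwards [Ioo_mem_nhdsGT hA0] with α hα
    rw [if_pos hα.2.le]
  by_cases hαA : α ≤ A
  swap
  · refine ⟨0, fun t ht k hk => ?_⟩
    simp only [if_neg hαA]
    have := (hw.mem_Icc t (t • (c • e + k)) ht).2
    linarith
  simp only [if_pos hαA]
  have hα0 := hα.1
  have hαθ : α ≤ θ/2 := hαA.trans (min_le_left _ _)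
  have hFω := hctx ω
  obtain ⟨g, u, hu, ⟨T₁, hT₁, hle⟩, hhot⟩ := hown _ hFω e he1
  have hmg : Measurable ({x : Euc d | ⟪x, e⟫ < 0}.indicator fun _ => (1+θ₀)/2) :=
    measurable_const.indicator (isOpen_lt (by fun_prop) continuous_const).measurableSet
  obtain ⟨uh, huh, -, -⟩ := ET hFω.toRx hmg (fun x => by
    by_cases hx : x ∈ {x : Euc d | ⟪x, e⟫ < 0}
    · rw [indicator_of_mem hx]; constructor <;> linarith [th.1, th.2]
    · rw [indicator_of_notMem hx]; exact ⟨le_rfl, zero_le_one⟩)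
  obtain ⟨τ, hτ, hτh⟩ := hhot α hα0
  set t₀ := max t₁ τ with ht₀
  have ht₀1 : t₁ ≤ t₀ := le_max_left _ _
  have hcmp := fun (t : ℝ) (ht : 0 < t) (x : Euc d) => main_cmp hFω hu hμ (t₀ := t₀) (fun t ht x a b => hlow _ hFω g u hu t (ht₀1.trans ht) x a b)
    (by linarith) hα0 hαθ (fun x hx => (hτh x hx).trans (hu.mono τ t₀ x hτ.le (le_max_right _ _))) hw ht x
  set δ := M*α/μ with hδ
  have hδ0 : 0 ≤ δ := by positivity
  have hδr : r₀ * (1 + δ) ≤ (r₀ + 1)/2 := by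
    have h5 := hαA.trans (min_le_right _ _)
    rw [le_div_iff₀ (by positivity)] at h5
    have h6 : r₀ * δ = M * α * r₀ / μ := by rw [hδ]; ring
    have h7 : r₀ * δ ≤ (1 - r₀)/2 := by
      rw [h6, div_le_iff₀ hμ]; linarith
    linarith
  obtain ⟨T₂, hT₂⟩ := (hΩ ω hω uh huh K' hK' hKs').2 ε hε
  refine ⟨max (max 1 T₂) (r₀ * (T₁ + t₀) * 2 / (1 - r₀)), fun t ht k hk => ?_⟩
  have ht1 : 1 ≤ t := ((le_max_left _ _).trans (le_max_left _ _)).trans ht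
  have ht2 : T₂ ≤ t := ((le_max_right _ _).trans (le_max_left _ _)).trans ht
  have ht3 := (le_max_right _ _).trans ht
  rw [div_le_iff₀ (by linarith)] at ht3
  have ht0 : 0 < t := by linarith
  set s := T₁ + (t₀ + (1 + δ) * t) with hs
  have hst : t ≤ s := by
    have : 0 ≤ δ * t := by positivity
    rw [hs]; linarith
  have hs0 : 0 < s := by linarith
  have hrs : r₀ ≤ t/s := by
    rw [le_div_iff₀ hs0, hs]
    have := mul_le_mul_of_nonneg_right hδr ht0.le
    linarith
  have hmem := hKK k hk (t/s) ⟨hrs, (div_le_one hs0).2 hst⟩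
  have h5 := hT₂ s (ht2.trans hst) _ hmem
  have hpt : s • (c • e + ((t/s) • k - ((1 - t/s) * c) • e)) = t • (c • e + k) := by
    have e1 : s * (t/s) = t := by field_simp
    have e2 : s * ((1 - t/s) * c) = (s - t) * c := by
      have : s * ((1 - t/s) * c) = (s - s * (t/s)) * c := by ring
      rw [this, e1]
    rw [smul_add, smul_sub, smul_smul, smul_smul, smul_smul, e1, e2, smul_add, smul_smul, sub_mul, sub_smul]
    abel
  rw [hpt] at h5
  have h6 := hcmp t ht0 (t • (c • e + k))
  have h7 := hle uh huh (t₀ + (1 + δ) * t) (by positivity) (t • (c • e + k))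
  linarith
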